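/- Let (ΛW,d) = (Λ(x₁,…,x_n, u₁,…,u_n, y), d) be the minimal Sullivan model with dx_i = 0, du_i = x_i², and dy ∈ Λ²(x₁,…,x_n). Then for every integer r ≥ 2, TC_r(ΛW) = r·cat(ΛW) + χ_π(ΛW) = r·(n+1) − 1. Moreover MTC_r(ΛW) = TC_r(ΛW). -/

import Mathlib

noncomputable section

namespace RHT

/-- A graded-commutative differential graded algebra over `ℚ`, graded by `ℕ`,
with a degree `+1` differential satisfying the graded Leibniz rule. -/
class GCDGA (A : Type) extends Ring A, Algebra ℚ A where
  grading : ℕ → Submodule ℚ A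
  gradedAlgebra : GradedAlgebra grading
  grading_comm : ∀ (i j : ℕ) (a b : A), a ∈ grading i → b ∈ grading j →
    a * b = ((-1 : ℚ) ^ (i * j)) • (b * a)
  d : A →ₗ[ℚ] A
  d_sq : ∀ a : A, d (d a) = 0
  d_grading : ∀ (i : ℕ) (a : A), a ∈ grading i → d a ∈ grading (i + 1)
  d_leibniz : ∀ (i : ℕ) (a b : A), a ∈ grading i →
    d (a * b) = d a * b + ((-1 : ℚ) ^ i) • (a * d b)

/-- The grading of a gcdga, with the algebra explicit. -/
def Gr (A : Type) [GCDGA A] : ℕ → Submodule ℚ A := GCDGA.grading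

/-- The differential of a gcdga, with the algebra explicit. -/
def Dd (A : Type) [GCDGA A] : A →ₗ[ℚ] A := GCDGA.d

/-- Morphisms of cdga's: `ℚ`-algebra morphisms preserving the grading and
commuting with the differentials. -/
def IsDGAHom {A B : Type} [GCDGA A] [GCDGA B] (f : A →ₐ[ℚ] B) : Prop :=
  (∀ a : A, f (Dd A a) = Dd B (f a)) ∧
    ∀ (i : ℕ) (a : A), a ∈ Gr A i → f a ∈ Gr B i

theorem isDGAHom_id (A : Type) [GCDGA A] : IsDGAHom (AlgHom.id ℚ A) :=
  ⟨fun _ => rfl, fun _ _ h => h⟩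

/-- A quasi-isomorphism: a morphism inducing an isomorphism in cohomology
(stated elementwise: surjectivity and injectivity on cohomology classes). -/
def QuasiIso {A B : Type} [GCDGA A] [GCDGA B] (f : A →ₐ[ℚ] B) : Prop :=
  (∀ b : B, Dd B b = 0 → ∃ a : A, Dd A a = 0 ∧ ∃ c : B, f a - b = Dd B c) ∧
    ∀ a : A, Dd A a = 0 → (∃ c : B, f a = Dd B c) → ∃ e : A, a = Dd A e

/-- Injectivity in cohomology, stated elementwise. -/
def CohomologyInjective {A B : Type} [GCDGA A] [GCDGA B] (f : A →ₐ[ℚ] B) : Prop :=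
  ∀ a : A, Dd A a = 0 → (∃ c : B, f a = Dd B c) → ∃ e : A, a = Dd A e

/-- A homotopy retraction for a morphism `ρ` of cdga's: a factorization of `ρ`
through a surjective quasi-isomorphism `q : C → Q` (playing the role of the
relative Sullivan model of `ρ`) together with a cdga retraction `τ`. -/
structure HtpyRetraction {T Q : Type} [GCDGA T] [GCDGA Q] (ρ : T →ₐ[ℚ] Q) where
  C : Type
  [instC : GCDGA C]
  j : T →ₐ[ℚ] C
  q : C →ₐ[ℚ] Q
  τ : C →ₐ[ℚ] T
  j_dga : IsDGAHom j
  q_dga : IsDGAHom q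
  τ_dga : IsDGAHom τ
  q_surj : Function.Surjective q
  q_quasi : QuasiIso q
  hqj : q.comp j = ρ
  hτj : τ.comp j = AlgHom.id ℚ T

attribute [instance] HtpyRetraction.instC

/-- A homotopy retraction of `T`-modules for a morphism `ρ : T → Q` of cdga's:
as above, but the retraction `τ` is only required to be a morphism of
differential `T`-modules. -/
structure ModHtpyRetraction {T Q : Type} [GCDGA T] [GCDGA Q] (ρ : T →ₐ[ℚ] Q) where
  C : Type
  [instC : GCDGA C]
  j : T →ₐ[ℚ] C
  q : C →ₐ[ℚ] Q
  τ : C →ₗ[ℚ] T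
  j_dga : IsDGAHom j
  q_dga : IsDGAHom q
  q_surj : Function.Surjective q
  q_quasi : QuasiIso q
  hqj : q.comp j = ρ
  τ_chain : ∀ c : C, τ (Dd C c) = Dd T (τ c)
  τ_mod : ∀ (t : T) (c : C), τ (j t * c) = t * τ c
  hτj : ∀ t : T, τ (j t) = t

attribute [instance] ModHtpyRetraction.instC

/-- `T`, together with the morphisms `ι j : A → T`, is the `r`-fold (graded)
tensor power of `A`, characterized as the `r`-fold coproduct of copies of `A`
in the category of cdga's. -/
structure TensorPower (A : Type) [GCDGA A] (r : ℕ) (T : Type) [GCDGA T] where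
  ι : Fin r → (A →ₐ[ℚ] T)
  ι_dga : ∀ j, IsDGAHom (ι j)
  coprod : ∀ (B : Type) [GCDGA B] (f : Fin r → (A →ₐ[ℚ] B)), (∀ j, IsDGAHom (f j)) →
    ∃! g : T →ₐ[ℚ] B, IsDGAHom g ∧ ∀ j, g.comp (ι j) = f j

/-- The `r`-fold multiplication morphism `μ : A^{⊗ r} → A`, i.e. the fold map
of the coproduct. -/
noncomputable def TensorPower.mu {A : Type} [GCDGA A] {r : ℕ} {T : Type} [GCDGA T]
    (TP : TensorPower A r T) : T →ₐ[ℚ] A :=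
  (TP.coprod A (fun _ => AlgHom.id ℚ A) (fun _ => isDGAHom_id A)).choose

/-- The kernel of the `r`-fold multiplication, as a `ℚ`-submodule (ideal). -/
noncomputable def TensorPower.kerMu {A : Type} [GCDGA A] {r : ℕ} {T : Type} [GCDGA T]
    (TP : TensorPower A r T) : Submodule ℚ T :=
  LinearMap.ker TP.mu.toLinearMap

/-- A witness that `TC_r(ΛV) ≤ n`: the projection
`ρ^r_n : (ΛV)^{⊗ r} → (ΛV)^{⊗ r}/(ker μ^r)^{n+1}` admits a homotopy retraction
of cdga's.  The quotient is encoded as a surjective cdga morphism with kernel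
`(ker μ^r)^{n+1}`. -/
structure TCWitness (A : Type) [GCDGA A] (r n : ℕ) where
  T : Type
  [instT : GCDGA T]
  TP : TensorPower A r T
  Q : Type
  [instQ : GCDGA Q]
  ρ : T →ₐ[ℚ] Q
  ρ_dga : IsDGAHom ρ
  ρ_surj : Function.Surjective ρ
  ρ_ker : LinearMap.ker ρ.toLinearMap = TP.kerMu ^ (n + 1)
  retr : Nonempty (HtpyRetraction ρ)

/-- The higher rational topological complexity `TC_r`. -/
noncomputable def TC (A : Type) [GCDGA A] (r : ℕ) : ℕ :=
  sInf {n | Nonempty (TCWitness A r n)}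

/-- A witness that `MTC_r(ΛV) ≤ n`: `ρ^r_n` admits a homotopy retraction of
`(ΛV)^{⊗ r}`-modules. -/
structure MTCWitness (A : Type) [GCDGA A] (r n : ℕ) where
  T : Type
  [instT : GCDGA T]
  TP : TensorPower A r T
  Q : Type
  [instQ : GCDGA Q]
  ρ : T →ₐ[ℚ] Q
  ρ_dga : IsDGAHom ρ
  ρ_surj : Function.Surjective ρ
  ρ_ker : LinearMap.ker ρ.toLinearMap = TP.kerMu ^ (n + 1)
  retr : Nonempty (ModHtpyRetraction ρ)

/-- The higher module rational topological complexity `MTC_r`. -/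
noncomputable def MTC (A : Type) [GCDGA A] (r : ℕ) : ℕ :=
  sInf {n | Nonempty (MTCWitness A r n)}

/-- A witness that `HTC_r(ΛV) ≤ n`: `ρ^r_n` is injective in cohomology. -/
structure HTCWitness (A : Type) [GCDGA A] (r n : ℕ) where
  T : Type
  [instT : GCDGA T]
  TP : TensorPower A r T
  Q : Type
  [instQ : GCDGA Q]
  ρ : T →ₐ[ℚ] Q
  ρ_dga : IsDGAHom ρ
  ρ_surj : Function.Surjective ρ
  ρ_ker : LinearMap.ker ρ.toLinearMap = TP.kerMu ^ (n + 1)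
  inj : CohomologyInjective ρ

/-- The invariant `HTC_r`. -/
noncomputable def HTC (A : Type) [GCDGA A] (r : ℕ) : ℕ :=
  sInf {n | Nonempty (HTCWitness A r n)}

/-- A minimal Sullivan model structure on a gcdga `A`: a simply-connected
graded space of generators `V` of finite type, the word-length grading `lam`
(`lam k` is `Λ^k V`), freeness of `A` over `V` as a graded-commutative
algebra (expressed by the universal property), and minimality `d V ⊆ Λ^{≥2}V`. -/
structure MinimalSullivan (A : Type) [GCDGA A] where
  V : ℕ → Submodule ℚ A
  lam : ℕ → Submodule ℚ A
  V_le : ∀ n, V n ≤ Gr A n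
  V0 : V 0 = ⊥
  V1 : V 1 = ⊥
  V_fin : ∀ n, FiniteDimensional ℚ (V n)
  lam_zero : lam 0 = 1
  lam_one : lam 1 = ⨆ n, V n
  lam_mul : ∀ p q, lam p * lam q ≤ lam (p + q)
  lam_internal : DirectSum.IsInternal lam
  minimal : ∀ (n : ℕ), ∀ v ∈ V n, Dd A v ∈ ⨆ k, ⨆ (_ : 2 ≤ k), lam k
  free : ∀ (B : Type) [GCDGA B] (f : ∀ n, V n →ₗ[ℚ] B),
    (∀ (n : ℕ) (v : V n), f n v ∈ Gr B n) →
    ∃! g : A →ₐ[ℚ] B, (∀ (i : ℕ) (a : A), a ∈ Gr A i → g a ∈ Gr B i) ∧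
      ∀ (n : ℕ) (v : V n), g (v : A) = f n v

namespace MinimalSullivan

variable {A : Type} [GCDGA A] (S : MinimalSullivan A)

/-- The even part of the space of generators. -/
def Veven : Submodule ℚ A := ⨆ n, S.V (2 * n)

/-- The odd part of the space of generators. -/
def Vodd : Submodule ℚ A := ⨆ n, S.V (2 * n + 1)

/-- The homotopy characteristic `χ_π = dim V^even - dim V^odd`. -/
noncomputable def chiPi : ℤ :=
  (Module.finrank ℚ S.Veven : ℤ) - (Module.finrank ℚ S.Vodd : ℤ)

/-- Purity: `d V^even = 0` and `d V^odd ⊆ Λ V^even`. -/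
def Pure : Prop :=
  (∀ a ∈ S.Veven, Dd A a = 0) ∧
    ∀ a ∈ S.Vodd, Dd A a ∈ Algebra.adjoin ℚ (S.Veven : Set A)

/-- Coformality: the differential is quadratic, `d V ⊆ Λ² V`. -/
def Coformal : Prop := ∀ (n : ℕ), ∀ v ∈ S.V n, Dd A v ∈ S.lam 2

/-- Constant length `l` of the differential: `d V ⊆ Λ^l V`. -/
def ConstantLength (l : ℕ) : Prop := ∀ (n : ℕ), ∀ v ∈ S.V n, Dd A v ∈ S.lam l

end MinimalSullivan

/-- The cohomology of a gcdga, as a `ℚ`-module. -/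
def CohClasses (A : Type) [GCDGA A] :=
  LinearMap.ker (Dd A) ⧸ ((LinearMap.range (Dd A)).comap (LinearMap.ker (Dd A)).subtype)

instance (A : Type) [GCDGA A] : AddCommGroup (CohClasses A) := by
  unfold CohClasses; infer_instance

instance (A : Type) [GCDGA A] : Module ℚ (CohClasses A) := by
  unfold CohClasses; infer_instance

/-- Ellipticity: both the generating space `V` and the cohomology are
finite-dimensional. -/
def Elliptic (A : Type) [GCDGA A] (S : MinimalSullivan A) : Prop :=
  FiniteDimensional ℚ (⨆ n, S.V n : Submodule ℚ A) ∧ FiniteDimensional ℚ (CohClasses A)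

/-- A witness of formality: a quasi-isomorphism to a gcdga with zero
differential. -/
structure FormalityWitness (A : Type) [GCDGA A] where
  B : Type
  [instB : GCDGA B]
  hd : Dd B = 0
  ψ : A →ₐ[ℚ] B
  ψ_dga : IsDGAHom ψ
  ψ_quasi : QuasiIso ψ

/-- Formality of a (Sullivan) cdga. -/
def Formal (A : Type) [GCDGA A] : Prop := Nonempty (FormalityWitness A)

/-- A witness that `cat(ΛV) ≤ n`: the projection `ΛV → ΛV/Λ^{>n}V` admits a
homotopy retraction.  The quotient is encoded as a surjective cdga morphism
whose kernel is `Λ^{>n}V`. -/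
structure CatWitness (A : Type) [GCDGA A] (S : MinimalSullivan A) (n : ℕ) where
  Q : Type
  [instQ : GCDGA Q]
  π : A →ₐ[ℚ] Q
  π_dga : IsDGAHom π
  π_surj : Function.Surjective π
  π_ker : LinearMap.ker π.toLinearMap = ⨆ k, ⨆ (_ : n < k), S.lam k
  retr : Nonempty (HtpyRetraction π)

/-- The rational LS-category. -/
noncomputable def cat (A : Type) [GCDGA A] (S : MinimalSullivan A) : ℕ :=
  sInf {n | Nonempty (CatWitness A S n)}

/-- A witness that `zcl_r(ΛV) ≥ p`: `p` cocycles in `(ΛV)^{⊗ r}` whose classes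
are zero-divisors (killed by `H(μ^r)`) and whose product is not exact. -/
structure ZclWitness (A : Type) [GCDGA A] (r p : ℕ) where
  T : Type
  [instT : GCDGA T]
  TP : TensorPower A r T
  a : Fin p → T
  closed : ∀ i, Dd T (a i) = 0
  zero_div : ∀ i, ∃ b : A, TP.mu (a i) = Dd A b
  prod_ne : ∀ b : T, (List.ofFn a).prod ≠ Dd T b

/-- The `r`-zero-divisor-cuplength `zcl_r`. -/
noncomputable def zcl (A : Type) [GCDGA A] (r : ℕ) : ℕ :=
  sSup {p | Nonempty (ZclWitness A r p)}

/-- A witness that `cl_ℚ(ΛV) ≥ p`: `p` cocycles of positive degree with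
non-exact product. -/
structure ClWitness (A : Type) [GCDGA A] (p : ℕ) where
  a : Fin p → A
  pos : ∀ i, a i ∈ ⨆ k, ⨆ (_ : 0 < k), Gr A k
  closed : ∀ i, Dd A (a i) = 0
  prod_ne : ∀ b : A, (List.ofFn a).prod ≠ Dd A b

/-- The rational cuplength `cl_ℚ`. -/
noncomputable def clQ (A : Type) [GCDGA A] : ℕ :=
  sSup {p | Nonempty (ClWitness A p)}


section Koszul

open scoped TensorProduct
open MvPolynomial

/-- Degrees of the even and odd generators of a pure Sullivan algebra, together with the
polynomials that are the differentials of the odd generators. -/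
structure KoszulData (I J : Type) where
  degI : I → ℕ
  degJ : J → ℕ
  even_degI : ∀ i, Even (degI i)
  odd_degJ : ∀ j, Odd (degJ j)
  q : J → MvPolynomial I ℚ
  q_scale : ∀ j, aeval (fun i => (2 : ℚ) ^ degI i • (X i : MvPolynomial I ℚ)) (q j) =
    (2 : ℚ) ^ (degJ j + 1) • q j

/-- The free graded-commutative algebra on the generators of `D`, as polynomials tensor
exterior algebra. -/
def Koszul {I J : Type} (_ : KoszulData I J) : Type :=
  MvPolynomial I ℚ ⊗[ℚ] ExteriorAlgebra ℚ (J → ℚ)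

namespace Koszul

variable {I J : Type} {D : KoszulData I J}

instance : Ring (Koszul D) :=
  inferInstanceAs (Ring (MvPolynomial I ℚ ⊗[ℚ] ExteriorAlgebra ℚ (J → ℚ)))

instance : Algebra ℚ (Koszul D) :=
  inferInstanceAs (Algebra ℚ (MvPolynomial I ℚ ⊗[ℚ] ExteriorAlgebra ℚ (J → ℚ)))

/-- The pure tensor of a polynomial and an exterior form. -/
def mk (p : MvPolynomial I ℚ) (s : ExteriorAlgebra ℚ (J → ℚ)) : Koszul D := p ⊗ₜ[ℚ] s

theorem mk_mul_mk (p p' : MvPolynomial I ℚ) (s s' : ExteriorAlgebra ℚ (J → ℚ)) :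
    (mk p s * mk p' s' : Koszul D) = mk (p * p') (s * s') :=
  Algebra.TensorProduct.tmul_mul_tmul p p' s s'

theorem mk_induction {P : Koszul D → Prop} (a : Koszul D) (h0 : P 0)
    (hmk : ∀ p s, P (mk p s)) (hadd : ∀ a b, P a → P b → P (a + b)) : P a :=
  TensorProduct.induction_on a h0 hmk hadd

/-- The inclusion of the polynomial part. -/
def poly (D : KoszulData I J) : MvPolynomial I ℚ →ₐ[ℚ] Koszul D :=
  (Algebra.TensorProduct.includeLeft :
    MvPolynomial I ℚ →ₐ[ℚ] MvPolynomial I ℚ ⊗[ℚ] ExteriorAlgebra ℚ (J → ℚ))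

/-- The inclusion of the exterior part. -/
def extr (D : KoszulData I J) : ExteriorAlgebra ℚ (J → ℚ) →ₐ[ℚ] Koszul D :=
  (Algebra.TensorProduct.includeRight :
    ExteriorAlgebra ℚ (J → ℚ) →ₐ[ℚ] MvPolynomial I ℚ ⊗[ℚ] ExteriorAlgebra ℚ (J → ℚ))

theorem poly_eq (p : MvPolynomial I ℚ) : poly D p = mk p 1 := rfl

theorem extr_eq (s : ExteriorAlgebra ℚ (J → ℚ)) : extr D s = mk 1 s := rfl

/-- The inclusion of the space spanned by the odd generators. -/
def ev (D : KoszulData I J) : (J → ℚ) →ₗ[ℚ] Koszul D :=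
  (extr D).toLinearMap ∘ₗ ExteriorAlgebra.ι ℚ

theorem ev_eq (v : J → ℚ) : ev D v = mk 1 (ExteriorAlgebra.ι ℚ v) := rfl

theorem mk_eq (p : MvPolynomial I ℚ) (s : ExteriorAlgebra ℚ (J → ℚ)) :
    (mk p s : Koszul D) = poly D p * extr D s := by
  rw [poly_eq, extr_eq, mk_mul_mk, mul_one, one_mul]

theorem poly_comm (p : MvPolynomial I ℚ) (a : Koszul D) : poly D p * a = a * poly D p := by
  induction a using mk_induction with
  | h0 => simp
  | hmk p' s => rw [poly_eq, mk_mul_mk, mk_mul_mk, mul_comm, one_mul, mul_one]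
  | hadd a b ha hb => rw [mul_add, add_mul, ha, hb]

theorem ev_sq (v : J → ℚ) : ev D v * ev D v = 0 := by
  change extr D _ * extr D _ = 0
  rw [← map_mul, ExteriorAlgebra.ι_sq_zero, map_zero]

theorem ev_anticomm (v w : J → ℚ) : ev D v * ev D w = -(ev D w * ev D v) := by
  have h := ev_sq (D := D) (v + w)
  rw [map_add, mul_add, add_mul, add_mul, ev_sq, ev_sq] at h
  rw [eq_neg_iff_add_eq_zero]
  simpa [add_comm] using h

/-- The even generators. -/
def xg (D : KoszulData I J) (i : I) : Koszul D := poly D (X i)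

/-- The odd generators. -/
def wg [DecidableEq J] (D : KoszulData I J) (j : J) : Koszul D := ev D (Pi.single j 1)

theorem ev_eq_sum [Fintype J] [DecidableEq J] (v : J → ℚ) : ev D v = ∑ j, v j • wg D j := by
  conv_lhs => rw [pi_eq_sum_univ' v]
  simp [wg, map_sum]

/-- Induction by left multiplication with polynomials and odd vectors. -/
theorem induction_left {P : Koszul D → Prop} (a : Koszul D) (h1 : P 1)
    (hadd : ∀ a b, P a → P b → P (a + b)) (hpoly : ∀ p a, P a → P (poly D p * a))
    (hev : ∀ v a, P a → P (ev D v * a)) : P a := by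
  have key : ∀ s, P (extr D s) := by
    intro s
    induction s using CliffordAlgebra.left_induction with
    | algebraMap r =>
      have := hpoly (algebraMap ℚ _ r) 1 h1
      rw [mul_one, AlgHom.commutes] at this
      rwa [AlgHom.commutes]
    | add a b ha hb => rw [map_add]; exact hadd _ _ ha hb
    | ι_mul s v hs => rw [map_mul]; exact hev _ _ hs
  induction a using mk_induction with
  | h0 => simpa using hpoly 0 1 h1
  | hmk p s => rw [mk_eq]; exact hpoly _ _ (key s)
  | hadd a b ha hb => exact hadd _ _ ha hb

/-- Induction by left multiplication with generators. -/
theorem induction_gen [Fintype J] [DecidableEq J] {P : Koszul D → Prop} (a : Koszul D) (h1 : P 1)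
    (hadd : ∀ a b, P a → P b → P (a + b)) (hsmul : ∀ (c : ℚ) a, P a → P (c • a))
    (hx : ∀ i a, P a → P (xg D i * a))
    (hw : ∀ j a, P a → P (wg D j * a)) : P a := by
  have h0 : P 0 := by simpa using hsmul 0 1 h1
  induction a using induction_left with
  | h1 => exact h1
  | hadd a b ha hb => exact hadd a b ha hb
  | hpoly p a ha =>
    induction p using MvPolynomial.induction_on generalizing a with
    | C r =>
      rw [← MvPolynomial.algebraMap_eq, AlgHom.commutes, ← Algebra.smul_def]
      exact hsmul _ _ ha
    | add p q hp hq => rw [map_add, add_mul]; exact hadd _ _ (hp a ha) (hq a ha)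
    | mul_X p i hp => rw [map_mul, mul_assoc]; exact hp _ (hx i a ha)
  | hev v a ha =>
    rw [ev_eq_sum, Finset.sum_mul]
    refine Finset.sum_induction _ P hadd h0 fun j _ => ?_
    rw [smul_mul_assoc]
    exact hsmul _ _ (hw j a ha)

section lift

variable {B : Type} [Ring B] [Algebra ℚ B]

/-- The polynomial part of the morphism out of the free graded-commutative algebra. -/
def liftPoly (b : I → B) (hb : ∀ i c, b i * c = c * b i) : MvPolynomial I ℚ →ₐ[ℚ] B :=
  (Subalgebra.center ℚ B).val.comp
    (aeval fun i => (⟨b i, Subalgebra.mem_center_iff.2 fun c => (hb i c).symm⟩ :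
      Subalgebra.center ℚ B))

theorem liftPoly_X (b : I → B) (hb : ∀ i c, b i * c = c * b i) (i : I) :
    liftPoly b hb (X i) = b i := by
  simp [liftPoly]

theorem liftPoly_comm (b : I → B) (hb : ∀ i c, b i * c = c * b i) (p : MvPolynomial I ℚ) (c : B) :
    liftPoly b hb p * c = c * liftPoly b hb p :=
  (Subalgebra.mem_center_iff.1 (Subtype.mem _) c).symm

/-- The universal morphism determined by central elements and anticommuting elements. -/
def lift [Fintype J] (D : KoszulData I J) (b : I → B) (hb : ∀ i c, b i * c = c * b i) (c : J → B)
    (hc : ∀ j k, c j * c k = -(c k * c j)) : Koszul D →ₐ[ℚ] B :=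
  Algebra.TensorProduct.lift (S := ℚ) (liftPoly b hb)
    (ExteriorAlgebra.lift ℚ ⟨Fintype.linearCombination ℚ c, fun v => by
      have h : ∀ v w, Fintype.linearCombination ℚ c v * Fintype.linearCombination ℚ c w =
          -(Fintype.linearCombination ℚ c w * Fintype.linearCombination ℚ c v) := by
        intro v w
        simp only [Fintype.linearCombination_apply, Finset.sum_mul_sum, smul_mul_smul_comm]
        rw [Finset.sum_comm, ← Finset.sum_neg_distrib]
        refine Finset.sum_congr rfl fun j _ => ?_
        rw [← Finset.sum_neg_distrib]
        refine Finset.sum_congr rfl fun k _ => ?_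
        rw [hc, mul_comm, smul_neg]
      have h2 : (2 : ℚ) • (Fintype.linearCombination ℚ c v * Fintype.linearCombination ℚ c v) = 0 := by
        rw [two_smul]
        exact eq_neg_iff_add_eq_zero.1 (h v v)
      simpa using h2⟩)
    fun _ _ => liftPoly_comm b hb _ _

variable [Fintype J] [DecidableEq J] (b : I → B) (hb : ∀ i c, b i * c = c * b i) (c : J → B)
    (hc : ∀ j k, c j * c k = -(c k * c j))

theorem lift_poly (p : MvPolynomial I ℚ) : lift D b hb c hc (poly D p) = liftPoly b hb p := by
  rw [poly_eq, lift]
  erw [Algebra.TensorProduct.lift_tmul]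
  simp

theorem lift_xg (i : I) : lift D b hb c hc (xg D i) = b i := by
  rw [xg, lift_poly, liftPoly_X]

theorem lift_wg (j : J) : lift D b hb c hc (wg D j) = c j := by
  rw [wg, ev_eq, lift]
  erw [Algebra.TensorProduct.lift_tmul]
  simp [ExteriorAlgebra.lift_ι_apply]

end lift

theorem algHom_ext [Fintype J] [DecidableEq J] {B : Type} [Ring B] [Algebra ℚ B]
    {f g : Koszul D →ₐ[ℚ] B} (hx : ∀ i, f (xg D i) = g (xg D i))
    (hw : ∀ j, f (wg D j) = g (wg D j)) : f = g := by
  ext a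
  induction a using induction_gen with
  | h1 => simp
  | hadd a b ha hb => simp [ha, hb]
  | hsmul c a ha => simp [ha]
  | hx i a ha => rw [map_mul, map_mul, hx, ha]
  | hw i a ha => rw [map_mul, map_mul, hw, ha]

end Koszul
end Koszul

section Koszul

open scoped TensorProduct
open MvPolynomial

namespace Koszul

variable {I J : Type} {D : KoszulData I J} [Fintype J]

/-- The value of a polynomial-valued function on the odd generators at an odd vector. -/
def pair (f : J → MvPolynomial I ℚ) : (J → ℚ) →ₗ[ℚ] MvPolynomial I ℚ :=
  Fintype.linearCombination ℚ f

theorem pair_apply (f : J → MvPolynomial I ℚ) (v : J → ℚ) : pair f v = ∑ j, v j • f j :=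
  Fintype.linearCombination_apply ℚ f v

theorem pair_single [DecidableEq J] (f : J → MvPolynomial I ℚ) (j : J) :
    pair f (Pi.single j 1) = f j := by
  simp [pair_apply, Pi.single_apply]

/-- Contraction with a polynomial-valued function on the odd generators. -/
def contr (D : KoszulData I J) (f : J → MvPolynomial I ℚ) : Koszul D →ₗ[ℚ] Koszul D :=
  ∑ j, (TensorProduct.map (LinearMap.mulLeft ℚ (f j))
    (CliffordAlgebra.contractLeft (Q := (0 : QuadraticForm ℚ (J → ℚ))) (LinearMap.proj j)) :
      MvPolynomial I ℚ ⊗[ℚ] ExteriorAlgebra ℚ (J → ℚ) →ₗ[ℚ]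
        MvPolynomial I ℚ ⊗[ℚ] ExteriorAlgebra ℚ (J → ℚ))

theorem contr_mk (f : J → MvPolynomial I ℚ) (p : MvPolynomial I ℚ)
    (s : ExteriorAlgebra ℚ (J → ℚ)) : contr D f (mk p s) =
      ∑ j, mk (f j * p) (CliffordAlgebra.contractLeft (Q := (0 : QuadraticForm ℚ (J → ℚ)))
        (LinearMap.proj j) s) := by
  exact LinearMap.sum_apply (M := MvPolynomial I ℚ ⊗[ℚ] ExteriorAlgebra ℚ (J → ℚ))
    (M₂ := MvPolynomial I ℚ ⊗[ℚ] ExteriorAlgebra ℚ (J → ℚ)) _ _ _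

theorem contr_one (f : J → MvPolynomial I ℚ) : contr D f 1 = 0 := by
  have : (1 : Koszul D) = mk 1 1 := rfl
  rw [this, contr_mk]
  refine Finset.sum_eq_zero fun j _ => ?_
  rw [CliffordAlgebra.contractLeft_one]
  exact TensorProduct.tmul_zero _ _

theorem contr_poly_mul (f : J → MvPolynomial I ℚ) (p : MvPolynomial I ℚ) (a : Koszul D) :
    contr D f (poly D p * a) = poly D p * contr D f a := by
  induction a using mk_induction with
  | h0 => simp
  | hmk p' s =>
    rw [poly_eq, mk_mul_mk, contr_mk, contr_mk, Finset.mul_sum]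
    refine Finset.sum_congr rfl fun j _ => ?_
    rw [mk_mul_mk, one_mul, one_mul, mul_left_comm]
  | hadd a b ha hb => rw [mul_add, map_add, ha, hb, map_add, mul_add]

theorem contr_ev_mul (f : J → MvPolynomial I ℚ) (v : J → ℚ) (a : Koszul D) :
    contr D f (ev D v * a) = poly D (pair f v) * a - ev D v * contr D f a := by
  induction a using mk_induction with
  | h0 => simp
  | hmk p' s =>
    rw [ev_eq, mk_mul_mk, contr_mk, contr_mk, Finset.mul_sum, pair_apply, map_sum,
      Finset.sum_mul, ← Finset.sum_sub_distrib]
    refine Finset.sum_congr rfl fun j _ => ?_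
    erw [CliffordAlgebra.contractLeft_ι_mul]
    rw [mk_mul_mk, one_mul, one_mul, map_smul, smul_mul_assoc, poly_eq, mk_mul_mk, one_mul]
    refine (TensorProduct.tmul_sub _ _ _).trans ?_
    congr 1
    exact TensorProduct.tmul_smul _ _ _
  | hadd a b ha hb =>
    rw [mul_add, map_add, ha, hb, map_add, mul_add, mul_add]
    abel

theorem contr_poly (f : J → MvPolynomial I ℚ) (p : MvPolynomial I ℚ) :
    contr D f (poly D p) = 0 := by
  simpa [contr_one] using contr_poly_mul (D := D) f p 1

theorem contr_ev (f : J → MvPolynomial I ℚ) (v : J → ℚ) :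
    contr D f (ev D v) = poly D (pair f v) := by
  simpa [contr_one] using contr_ev_mul (D := D) f v 1

theorem contr_anticomm (f g : J → MvPolynomial I ℚ) (a : Koszul D) :
    contr D f (contr D g a) = -contr D g (contr D f a) := by
  induction a using induction_left with
  | h1 => simp [contr_one]
  | hadd a b ha hb => rw [map_add, map_add, ha, hb, map_add, map_add, neg_add]
  | hpoly p a ha => simp only [contr_poly_mul, ha, mul_neg]
  | hev v a ha => simp only [contr_ev_mul, map_sub, contr_poly_mul, ha, mul_neg]; abel

theorem contr_contr_self (f : J → MvPolynomial I ℚ) (a : Koszul D) :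
    contr D f (contr D f a) = 0 := by
  have h2 : (2 : ℚ) • contr D f (contr D f a) = 0 := by
    rw [two_smul]
    exact eq_neg_iff_add_eq_zero.1 (contr_anticomm f f a)
  simpa using h2

theorem contr_add (f g : J → MvPolynomial I ℚ) (a : Koszul D) :
    contr D (f + g) a = contr D f a + contr D g a := by
  induction a using induction_left with
  | h1 => simp [contr_one]
  | hadd a b ha hb => rw [map_add, map_add, map_add, ha, hb]; abel
  | hpoly p a ha => simp only [contr_poly_mul, ha, mul_add]
  | hev v a ha =>
    have : pair (f + g) v = pair f v + pair g v := by
      simp [pair_apply, Finset.sum_add_distrib]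
    simp only [contr_ev_mul, ha, this, map_add, mul_add, add_mul]; abel

theorem contr_mul (p : MvPolynomial I ℚ) (f : J → MvPolynomial I ℚ) (a : Koszul D) :
    contr D (fun j => p * f j) a = poly D p * contr D f a := by
  induction a using induction_left with
  | h1 => simp [contr_one]
  | hadd a b ha hb => rw [map_add, map_add, ha, hb, mul_add]
  | hpoly q a ha =>
    rw [contr_poly_mul, contr_poly_mul, ha, ← mul_assoc, poly_comm, mul_assoc]
  | hev v a ha =>
    have : pair (fun j => p * f j) v = p * pair f v := by
      simp [pair_apply, Finset.mul_sum]
    rw [contr_ev_mul, contr_ev_mul, ha, this, map_mul, mul_sub, mul_assoc, ← mul_assoc (ev D v),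
      ← poly_comm, mul_assoc]

theorem contr_zero (a : Koszul D) : contr D (0 : J → MvPolynomial I ℚ) a = 0 := by
  have h := contr_mul 0 (0 : J → MvPolynomial I ℚ) a
  simpa [Pi.zero_def] using h

theorem contr_sum {K : Type} (s : Finset K) (f : K → J → MvPolynomial I ℚ) (a : Koszul D) :
    contr D (∑ k ∈ s, f k) a = ∑ k ∈ s, contr D (f k) a := by
  classical
  induction s using Finset.induction_on with
  | empty => simp [contr_zero]
  | insert k s hk ih => rw [Finset.sum_insert hk, Finset.sum_insert hk, contr_add, ih]

section scaling

variable [DecidableEq J]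

/-- The automorphism rescaling the generators. -/
def scale (D : KoszulData I J) (s : I → ℚ) (t : J → ℚ) : Koszul D →ₐ[ℚ] Koszul D :=
  lift D (fun i => s i • xg D i)
    (fun i c => by rw [smul_mul_assoc, mul_smul_comm, xg, poly_comm])
    (fun j => t j • wg D j)
    (fun j k => by
      rw [smul_mul_smul_comm, smul_mul_smul_comm, wg, wg, ev_anticomm, mul_comm, smul_neg])

theorem scale_xg (s : I → ℚ) (t : J → ℚ) (i : I) :
    scale D s t (xg D i) = s i • xg D i := lift_xg ..

theorem scale_wg (s : I → ℚ) (t : J → ℚ) (j : J) :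
    scale D s t (wg D j) = t j • wg D j := lift_wg ..

theorem scale_poly (s : I → ℚ) (t : J → ℚ) (p : MvPolynomial I ℚ) :
    scale D s t (poly D p) = poly D (aeval (fun i => s i • (X i : MvPolynomial I ℚ)) p) := by
  have : (scale D s t).comp (poly D) =
      (poly D).comp (aeval (fun i => s i • (X i : MvPolynomial I ℚ))) := by
    ext i
    have := scale_xg (D := D) s t i
    rw [xg] at this
    simp [this]
  exact DFunLike.congr_fun this p

/-- The parity involution. -/
def par (D : KoszulData I J) : Koszul D →ₐ[ℚ] Koszul D := scale D 1 (-1)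

theorem par_poly (p : MvPolynomial I ℚ) : par D (poly D p) = poly D p := by
  rw [par, scale_poly]
  simp

theorem par_wg (j : J) : par D (wg D j) = -wg D j := by
  rw [par, scale_wg]; simp

theorem par_ev (v : J → ℚ) : par D (ev D v) = -ev D v := by
  simp [ev_eq_sum, par_wg]

theorem par_par (a : Koszul D) : par D (par D a) = a := by
  have : (par D).comp (par D) = AlgHom.id ℚ (Koszul D) := by
    refine algHom_ext (fun i => ?_) fun j => ?_
    · simp [xg, par_poly]
    · simp [par_wg]
  exact DFunLike.congr_fun this a

theorem ev_mul (v : J → ℚ) (b : Koszul D) : ev D v * b = par D b * ev D v := by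
  induction b using induction_left with
  | h1 => simp
  | hadd a b ha hb => rw [mul_add, map_add, add_mul, ha, hb]
  | hpoly p a ha =>
    rw [← mul_assoc, ← poly_comm, mul_assoc, ha, map_mul, par_poly, mul_assoc]
  | hev w a ha =>
    rw [← mul_assoc, ev_anticomm, neg_mul, mul_assoc, ha, map_mul, par_ev, neg_mul, neg_mul,
      mul_assoc]

theorem mul_comm_of_par_eq {b : Koszul D} (hb : par D b = b) (a : Koszul D) : a * b = b * a := by
  induction a using induction_left with
  | h1 => simp
  | hadd a c ha hc => rw [mul_add, add_mul, ha, hc]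
  | hpoly p a ha => rw [mul_assoc, ha, ← mul_assoc, poly_comm, mul_assoc]
  | hev v a ha => rw [mul_assoc, ha, ← mul_assoc, ev_mul, hb, mul_assoc]

theorem mul_comm_of_par_neg {b : Koszul D} (hb : par D b = -b) (a : Koszul D) :
    a * b = b * par D a := by
  induction a using induction_left with
  | h1 => simp
  | hadd a c ha hc => rw [map_add, mul_add, add_mul, ha, hc]
  | hpoly p a ha => rw [mul_assoc, ha, ← mul_assoc, poly_comm, mul_assoc, map_mul, par_poly]
  | hev v a ha =>
    rw [mul_assoc, ha, ← mul_assoc, ev_mul, hb, mul_assoc, map_mul, par_ev, neg_mul, neg_mul,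
      mul_neg]

theorem contr_par (f : J → MvPolynomial I ℚ) (a : Koszul D) :
    contr D f (par D a) = -par D (contr D f a) := by
  induction a using induction_left with
  | h1 => simp [contr_one]
  | hadd a b ha hb => simp only [map_add, ha, hb, neg_add]
  | hpoly p a ha => simp only [contr_poly_mul, map_mul, ha, par_poly, mul_neg]
  | hev v a ha =>
    simp only [contr_ev_mul, map_sub, map_mul, par_poly, par_ev, neg_mul, map_neg, ha]
    noncomm_ring

theorem contr_mul_left (f : J → MvPolynomial I ℚ) (a b : Koszul D) :
    contr D f (a * b) = contr D f a * b + par D a * contr D f b := by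
  induction a using induction_left with
  | h1 => simp [contr_one]
  | hadd a c ha hc => rw [add_mul, map_add, map_add, map_add, ha, hc]; noncomm_ring
  | hpoly p a ha => rw [mul_assoc, contr_poly_mul, contr_poly_mul, map_mul (par D), par_poly, ha]; noncomm_ring
  | hev v a ha => rw [mul_assoc, contr_ev_mul, contr_ev_mul, map_mul (par D), par_ev, ha]; noncomm_ring

/-- The automorphism scaling by the power of two given by the degree. -/
def wt (D : KoszulData I J) : Koszul D →ₐ[ℚ] Koszul D :=
  scale D (fun i => 2 ^ D.degI i) (fun j => 2 ^ D.degJ j)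

/-- The graded pieces. -/
def grd (D : KoszulData I J) (i : ℕ) : Submodule ℚ (Koszul D) :=
  Module.End.eigenspace (wt D).toLinearMap (2 ^ i) ⊓
    Module.End.eigenspace (par D).toLinearMap ((-1) ^ i)

theorem mem_grd {i : ℕ} {a : Koszul D} :
    a ∈ grd D i ↔ wt D a = (2 : ℚ) ^ i • a ∧ par D a = (-1 : ℚ) ^ i • a := by
  simp [grd]

theorem xg_mem_grd (i : I) : xg D i ∈ grd D (D.degI i) := by
  rw [mem_grd]
  refine ⟨scale_xg _ _ _, ?_⟩
  rw [xg, par_poly, (D.even_degI i).neg_one_pow, one_smul]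

theorem wg_mem_grd (j : J) : wg D j ∈ grd D (D.degJ j) := by
  rw [mem_grd]
  refine ⟨scale_wg _ _ _, ?_⟩
  rw [par_wg, (D.odd_degJ j).neg_one_pow, neg_one_smul]

instance : SetLike.GradedMonoid (grd D) where
  one_mem := by rw [mem_grd]; simp
  mul_mem i j a b ha hb := by
    rw [mem_grd] at *
    rw [map_mul, map_mul, ha.1, ha.2, hb.1, hb.2, smul_mul_smul_comm, smul_mul_smul_comm, pow_add,
      pow_add]
    exact ⟨rfl, rfl⟩

theorem iSup_eq_top_of_gen (G : ℕ → Submodule ℚ (Koszul D)) [SetLike.GradedMonoid G]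
    (hx : ∀ i, ∃ k, xg D i ∈ G k) (hw : ∀ j, ∃ k, wg D j ∈ G k) : ⨆ i, G i = ⊤ := by
  rw [eq_top_iff]
  intro a _
  have hmul : ∀ (b : Koszul D) (k : ℕ), b ∈ G k → ∀ a ∈ ⨆ i, G i, b * a ∈ ⨆ i, G i := by
    intro b k hb a ha
    induction ha using Submodule.iSup_induction' with
    | mem i a ha => exact Submodule.mem_iSup_of_mem _ (SetLike.mul_mem_graded hb ha)
    | zero => simp
    | add a c _ _ ha hc => rw [mul_add]; exact add_mem ha hc
  induction a using induction_gen with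
  | h1 => exact Submodule.mem_iSup_of_mem 0 SetLike.GradedOne.one_mem
  | hadd a b ha hb => exact add_mem (ha trivial) (hb trivial)
  | hsmul c a ha => exact Submodule.smul_mem _ _ (ha trivial)
  | hx i a ha => obtain ⟨k, hk⟩ := hx i; exact hmul _ _ hk _ (ha trivial)
  | hw j a ha => obtain ⟨k, hk⟩ := hw j; exact hmul _ _ hk _ (ha trivial)

theorem iSup_grd : ⨆ i, grd D i = ⊤ :=
  iSup_eq_top_of_gen _ (fun i => ⟨_, xg_mem_grd i⟩) fun j => ⟨_, wg_mem_grd j⟩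

theorem iSupIndep_grd : iSupIndep (grd D) := by
  have h := (Module.End.eigenspaces_iSupIndep (wt D).toLinearMap).comp
    (f := fun i : ℕ => (2 : ℚ) ^ i) (fun i j h => Nat.pow_right_injective le_rfl (by
      have : (2 : ℚ) ^ i = 2 ^ j := h
      exact_mod_cast this))
  exact h.mono fun i => inf_le_left

instance : GradedAlgebra (grd D) :=
  { (inferInstance : SetLike.GradedMonoid (grd D)),
    (DirectSum.isInternal_submodule_of_iSupIndep_of_iSup_eq_top iSupIndep_grd
      iSup_grd).chooseDecomposition with }

theorem wt_contr_q (a : Koszul D) : wt D (contr D D.q a) = (2 : ℚ) • contr D D.q (wt D a) := by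
  induction a using induction_gen with
  | h1 => simp [contr_one]
  | hadd a b ha hb => simp only [map_add, ha, hb, smul_add]
  | hsmul c a ha => simp only [map_smul, ha, smul_comm c]
  | hx i a ha =>
    rw [xg, contr_poly_mul, map_mul, ha, map_mul, ← xg]
    simp only [wt]
    rw [scale_xg, smul_mul_assoc, smul_mul_assoc, map_smul, xg, contr_poly_mul, mul_smul_comm,
      smul_smul, smul_smul, mul_comm (2 : ℚ)]
  | hw j a ha =>
    rw [wg, contr_ev_mul, map_sub, map_mul, map_mul, ha, map_mul, ← wg]
    have h1 : wt D (poly D (pair D.q (Pi.single j 1))) =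
        (2 : ℚ) ^ (D.degJ j + 1) • poly D (pair D.q (Pi.single j 1)) := by
      rw [pair_single, wt, scale_poly, D.q_scale, map_smul]
    have h2 : wt D (wg D j) = (2 : ℚ) ^ D.degJ j • wg D j := scale_wg _ _ _
    rw [h1, h2, smul_mul_assoc, smul_mul_assoc, smul_mul_assoc, map_smul]
    conv_rhs => rw [wg, contr_ev_mul, ← wg]
    rw [smul_smul, smul_sub, mul_smul_comm, smul_smul, mul_comm (2 : ℚ), pow_succ]

instance : GCDGA (Koszul D) where
  grading := grd D
  gradedAlgebra := inferInstance
  grading_comm i j a b ha hb := by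
    rw [mem_grd] at ha hb
    rcases Nat.even_or_odd j with hj | hj
    · rw [hj.neg_one_pow, one_smul] at hb
      rw [(hj.mul_left i).neg_one_pow, one_smul]
      exact mul_comm_of_par_eq hb.2 a
    · rw [hj.neg_one_pow, neg_one_smul] at hb
      rw [mul_comm_of_par_neg hb.2, ha.2, mul_comm i j, pow_mul, hj.neg_one_pow, mul_smul_comm]
  d := contr D D.q
  d_sq := contr_contr_self _
  d_grading i a ha := by
    rw [mem_grd] at *
    constructor
    · rw [wt_contr_q, ha.1, map_smul, smul_smul, pow_succ, mul_comm]
    · have := contr_par D.q a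
      rw [ha.2, map_smul] at this
      rw [pow_succ, mul_neg_one, neg_smul, this, neg_neg]
  d_leibniz i a b ha := by
    rw [mem_grd] at ha
    rw [contr_mul_left, ha.2, smul_mul_assoc]

theorem Dd_eq (a : Koszul D) : Dd (Koszul D) a = contr D D.q a := rfl

end scaling

end Koszul
end Koszul

section General

theorem iSupIndep.eq_of_le {M : Type} [AddCommGroup M] [Module ℚ M] {g g' : ℕ → Submodule ℚ M}
    (hg : iSupIndep g) (hle : ∀ i, g' i ≤ g i) (htop : ⨆ i, g' i = ⊤) (i : ℕ) : g' i = g i := by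
  refine le_antisymm (hle i) fun a ha => ?_
  have h : a ∈ g' i ⊔ ⨆ (j) (_ : j ≠ i), g j := by
    have h1 : (⊤ : Submodule ℚ M) ≤ g' i ⊔ ⨆ (j) (_ : j ≠ i), g j := by
      rw [← htop]
      refine iSup_le fun j => ?_
      by_cases hj : j = i
      · exact hj ▸ le_sup_left
      · exact le_sup_of_le_right (le_iSup₂_of_le j hj (hle j))
    exact h1 trivial
  obtain ⟨b, hb, c, hc, rfl⟩ := Submodule.mem_sup.1 h
  have hc' : c ∈ g i := by simpa using sub_mem ha (hle i hb)
  have := Submodule.disjoint_def.1 (hg i) c hc' hc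
  simpa [this] using hb

variable {A : Type} [GCDGA A]

instance : GradedAlgebra (Gr A) := GCDGA.gradedAlgebra

theorem iSup_Gr : ⨆ i, Gr A i = ⊤ :=
  (DirectSum.Decomposition.isInternal (Gr A)).submodule_iSup_eq_top

theorem Gr_induction {P : A → Prop} (a : A) (hmem : ∀ i, ∀ a ∈ Gr A i, P a)
    (hadd : ∀ a b, P a → P b → P (a + b)) : P a := by
  have ha : a ∈ ⨆ i, Gr A i := by rw [iSup_Gr]; trivial
  induction ha using Submodule.iSup_induction' with
  | mem i a ha => exact hmem i a ha
  | zero => exact hmem 0 0 (zero_mem _)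
  | add a b _ _ ha hb => exact hadd _ _ ha hb

theorem comm_of_even {i : ℕ} (hi : Even i) {a : A} (ha : a ∈ Gr A i) (c : A) :
    a * c = c * a := by
  induction c using Gr_induction with
  | hmem j c hc =>
    have := GCDGA.grading_comm i j a c ha hc
    rwa [(hi.mul_right j).neg_one_pow, one_smul] at this
  | hadd c d hc hd => rw [mul_add, add_mul, hc, hd]

theorem anticomm_of_odd {i j : ℕ} (hi : Odd i) (hj : Odd j) {a b : A} (ha : a ∈ Gr A i)
    (hb : b ∈ Gr A j) : a * b = -(b * a) := by
  have := GCDGA.grading_comm i j a b ha hb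
  rwa [(hi.mul hj).neg_one_pow, neg_one_smul] at this

theorem Dd_mul {i : ℕ} {a : A} (ha : a ∈ Gr A i) (b : A) :
    Dd A (a * b) = Dd A a * b + ((-1 : ℚ) ^ i) • (a * Dd A b) :=
  GCDGA.d_leibniz i a b ha

theorem Dd_Dd (a : A) : Dd A (Dd A a) = 0 := GCDGA.d_sq a

theorem Dd_mem {i : ℕ} {a : A} (ha : a ∈ Gr A i) : Dd A a ∈ Gr A (i + 1) :=
  GCDGA.d_grading i a ha

theorem Dd_one : Dd A 1 = 0 := by
  have h := Dd_mul (A := A) (SetLike.GradedOne.one_mem (A := Gr A)) 1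
  simpa using h

theorem IsDGAHom.comp {B C : Type} [GCDGA B] [GCDGA C] {f : A →ₐ[ℚ] B} {g : B →ₐ[ℚ] C}
    (hg : IsDGAHom g) (hf : IsDGAHom f) : IsDGAHom (g.comp f) :=
  ⟨fun a => by simp [hf.1, hg.1], fun i a ha => hg.2 i _ (hf.2 i a ha)⟩

end General

section Koszul

open MvPolynomial

namespace Koszul

variable {I J : Type} {D : KoszulData I J} [Fintype J] [DecidableEq J] {B : Type} [GCDGA B]

/-- The morphism of graded algebras determined by homogeneous images of the generators. -/
def homOf (D : KoszulData I J) (b : I → B) (c : J → B) (hb : ∀ i, b i ∈ Gr B (D.degI i))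
    (hc : ∀ j, c j ∈ Gr B (D.degJ j)) : Koszul D →ₐ[ℚ] B :=
  lift D b (fun i => comm_of_even (D.even_degI i) (hb i)) c
    (fun j k => anticomm_of_odd (D.odd_degJ j) (D.odd_degJ k) (hc j) (hc k))

variable {b : I → B} {c : J → B} (hb : ∀ i, b i ∈ Gr B (D.degI i))
  (hc : ∀ j, c j ∈ Gr B (D.degJ j))

theorem homOf_xg (i : I) : homOf D b c hb hc (xg D i) = b i := lift_xg ..

theorem homOf_wg (j : J) : homOf D b c hb hc (wg D j) = c j := lift_wg ..

theorem grading_of_gen (f : Koszul D →ₐ[ℚ] B) (hx : ∀ i, f (xg D i) ∈ Gr B (D.degI i))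
    (hw : ∀ j, f (wg D j) ∈ Gr B (D.degJ j)) (i : ℕ) (a : Koszul D)
    (ha : a ∈ Gr (Koszul D) i) : f a ∈ Gr B i := by
  let G : ℕ → Submodule ℚ (Koszul D) := fun i => grd D i ⊓ (Gr B i).comap f.toLinearMap
  have : SetLike.GradedMonoid G :=
    { one_mem := ⟨SetLike.GradedOne.one_mem, by
        simpa using SetLike.GradedOne.one_mem (A := Gr B)⟩
      mul_mem := fun i j a b ha hb => ⟨SetLike.mul_mem_graded ha.1 hb.1, by
        simpa using SetLike.mul_mem_graded (A := Gr B) ha.2 hb.2⟩ }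
  have htop : ⨆ i, G i = ⊤ := iSup_eq_top_of_gen G (fun i => ⟨_, xg_mem_grd i, hx i⟩)
    fun j => ⟨_, wg_mem_grd j, hw j⟩
  have := iSupIndep.eq_of_le iSupIndep_grd (g' := G) (fun i => inf_le_left) htop i
  have ha' : a ∈ G i := by rw [this]; exact ha
  exact ha'.2

theorem dga_of_gen (f : Koszul D →ₐ[ℚ] B) (hx : ∀ i, f (xg D i) ∈ Gr B (D.degI i))
    (hw : ∀ j, f (wg D j) ∈ Gr B (D.degJ j)) (hdx : ∀ i, Dd B (f (xg D i)) = 0)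
    (hdw : ∀ j, Dd B (f (wg D j)) = f (poly D (D.q j))) : IsDGAHom f := by
  refine ⟨fun a => ?_, grading_of_gen f hx hw⟩
  rw [Dd_eq]
  induction a using induction_gen with
  | h1 => rw [contr_one, map_zero, map_one, Dd_one]
  | hadd a b ha hb => simp only [map_add, ha, hb]
  | hsmul c a ha => simp only [map_smul, ha]
  | hx i a ha =>
    rw [xg, contr_poly_mul, map_mul, ← xg, map_mul, Dd_mul (hx i), hdx, zero_mul, zero_add, ha,
      (D.even_degI i).neg_one_pow, one_smul]
  | hw j a ha =>
    rw [wg, contr_ev_mul, pair_single, ← wg, map_sub, map_mul, map_mul, map_mul, Dd_mul (hw j),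
      hdw, ha, (D.odd_degJ j).neg_one_pow, neg_one_smul, sub_eq_add_neg]

/-- Several copies of a Koszul algebra: the data of the tensor power. -/
def _root_.RHT.KoszulData.copies (D : KoszulData I J) (r : ℕ) :
    KoszulData (I × Fin r) (J × Fin r) where
  degI p := D.degI p.1
  degJ p := D.degJ p.1
  even_degI p := D.even_degI p.1
  odd_degJ p := D.odd_degJ p.1
  q p := rename (fun i => (i, p.2)) (D.q p.1)
  q_scale p := by
    rw [aeval_rename, ← map_smul, ← D.q_scale, ← AlgHom.comp_apply]
    congr 1
    ext i
    simp

variable {r : ℕ}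

/-- The inclusion of one of the copies. -/
def copy (D : KoszulData I J) (r : ℕ) (k : Fin r) : Koszul D →ₐ[ℚ] Koszul (D.copies r) :=
  homOf D (fun i => xg (D.copies r) (i, k)) (fun j => wg (D.copies r) (j, k))
    (fun i => xg_mem_grd (D := D.copies r) (i, k)) (fun j => wg_mem_grd (D := D.copies r) (j, k))

theorem copy_xg (k : Fin r) (i : I) : copy D r k (xg D i) = xg (D.copies r) (i, k) :=
  homOf_xg ..

theorem copy_wg (k : Fin r) (j : J) : copy D r k (wg D j) = wg (D.copies r) (j, k) :=
  homOf_wg ..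

theorem copy_poly (k : Fin r) (p : MvPolynomial I ℚ) :
    copy D r k (poly D p) = poly (D.copies r) (rename (fun i => (i, k)) p) := by
  have : (copy D r k).comp (poly D) = (poly (D.copies r)).comp (rename (fun i => (i, k))) := by
    ext i
    have := copy_xg (D := D) k i
    rw [xg, xg] at this
    simp [this]
  exact DFunLike.congr_fun this p

theorem Dd_xg (i : I) : Dd (Koszul D) (xg D i) = 0 := contr_poly _ _

theorem Dd_wg (j : J) : Dd (Koszul D) (wg D j) = poly D (D.q j) := by
  rw [Dd_eq, wg, contr_ev, pair_single]

theorem copy_dga (k : Fin r) : IsDGAHom (copy D r k) := by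
  refine dga_of_gen _ (fun i => ?_) (fun j => ?_) (fun i => ?_) (fun j => ?_)
  · rw [copy_xg]; exact xg_mem_grd (D := D.copies r) (i, k)
  · rw [copy_wg]; exact wg_mem_grd (D := D.copies r) (j, k)
  · rw [copy_xg, Dd_xg]
  · rw [copy_wg, Dd_wg, copy_poly]; rfl

variable {A : Type} [GCDGA A]

/-- The tensor power of an algebra isomorphic to a Koszul algebra. -/
def tensorPower (Θ : Koszul D ≃ₐ[ℚ] A) (hΘ : IsDGAHom (Θ : Koszul D →ₐ[ℚ] A))
    (hΘ' : IsDGAHom (Θ.symm : A →ₐ[ℚ] Koszul D)) (r : ℕ) :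
    TensorPower A r (Koszul (D.copies r)) where
  ι k := (copy D r k).comp (Θ.symm : A →ₐ[ℚ] Koszul D)
  ι_dga k := (copy_dga k).comp hΘ'
  coprod B _ f hf := by
    have hg : ∀ k, IsDGAHom ((f k).comp (Θ : Koszul D →ₐ[ℚ] A)) := fun k => (hf k).comp hΘ
    let g : Koszul (D.copies r) →ₐ[ℚ] B :=
      homOf (D.copies r) (fun p => f p.2 (Θ (xg D p.1))) (fun p => f p.2 (Θ (wg D p.1)))
        (fun p => (hg p.2).2 _ _ (xg_mem_grd p.1)) (fun p => (hg p.2).2 _ _ (wg_mem_grd p.1))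
    have gx : ∀ p, g (xg (D.copies r) p) = f p.2 (Θ (xg D p.1)) := homOf_xg _ _
    have gw : ∀ p, g (wg (D.copies r) p) = f p.2 (Θ (wg D p.1)) := homOf_wg _ _
    have gc : ∀ k a, g (copy D r k a) = f k (Θ a) := by
      intro k a
      have : g.comp (copy D r k) = (f k).comp (Θ : Koszul D →ₐ[ℚ] A) := by
        refine algHom_ext (fun i => ?_) fun j => ?_
        · simp [copy_xg, gx]
        · simp [copy_wg, gw]
      exact DFunLike.congr_fun this a
    refine ⟨g, ⟨dga_of_gen g (fun p => ?_) (fun p => ?_) (fun p => ?_) (fun p => ?_), fun k => ?_⟩,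
      fun g' hg' => ?_⟩
    · rw [gx]; exact (hg p.2).2 _ _ (xg_mem_grd p.1)
    · rw [gw]; exact (hg p.2).2 _ _ (wg_mem_grd p.1)
    · rw [gx, ← (hf p.2).1]
      erw [← hΘ.1]
      rw [Dd_xg]; simp
    · rw [gw, ← (hf p.2).1]
      erw [← hΘ.1]
      rw [Dd_wg]
      change f p.2 (Θ _) = g (poly _ (rename _ _))
      rw [← copy_poly, gc]
    · ext a; simp [gc]
    · have hc : ∀ k a, g' (copy D r k a) = f k (Θ a) := by
        intro k a
        have := DFunLike.congr_fun (hg'.2 k) (Θ a)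
        simpa using this
      refine algHom_ext (fun p => ?_) fun p => ?_
      · rw [gx, ← hc, copy_xg]
      · rw [gw, ← hc, copy_wg]

end Koszul
end Koszul

theorem TensorPower.mu_spec {A : Type} [GCDGA A] {r : ℕ} {T : Type} [GCDGA T]
    (TP : TensorPower A r T) : IsDGAHom TP.mu ∧ ∀ j a, TP.mu (TP.ι j a) = a := by
  have h := (TP.coprod A (fun _ => AlgHom.id ℚ A) (fun _ => isDGAHom_id A)).choose_spec.1
  exact ⟨h.1, fun j a => DFunLike.congr_fun (h.2 j) a⟩

section General

variable {A : Type} [GCDGA A]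

theorem mem_span_of_mem_Gr {K : Type} {z : K → A} {d : K → ℕ} (hz : ∀ i, z i ∈ Gr A (d i))
    {m : ℕ} {a : A} (ha : a ∈ Gr A m) (hspan : a ∈ Submodule.span ℚ (Set.range z)) :
    a ∈ Submodule.span ℚ (z '' {i | d i = m}) := by
  have key : ∀ b ∈ Submodule.span ℚ (Set.range z),
      ((DirectSum.decompose (Gr A) b m : Gr A m) : A) ∈
        Submodule.span ℚ (z '' {i | d i = m}) := by
    intro b hb
    induction hb using Submodule.span_induction with
    | mem b hb =>
      obtain ⟨i, rfl⟩ := hb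
      by_cases h : d i = m
      · subst h
        rw [DirectSum.decompose_of_mem_same _ (hz i)]
        exact Submodule.subset_span ⟨i, rfl, rfl⟩
      · rw [DirectSum.decompose_of_mem_ne _ (hz i) h]
        exact zero_mem _
    | zero => simp
    | add b c _ _ hb hc => simpa using add_mem hb hc
    | smul r b _ hb =>
      rw [DirectSum.decompose_smul]
      exact Submodule.smul_mem _ r hb
  have := key a hspan
  rwa [DirectSum.decompose_of_mem_same _ ha] at this

theorem exists_linearMap_of_li {K : Type} {z : K → A} (hz : LinearIndependent ℚ z)
    {M : Type} [AddCommGroup M] [Module ℚ M] (w : K → M) :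
    ∃ L : A →ₗ[ℚ] M, ∀ i, L (z i) = w i := by
  obtain ⟨L, hL⟩ := ((Module.Basis.span hz).constr ℚ w).exists_extend
  refine ⟨L, fun i => ?_⟩
  have h := DFunLike.congr_fun hL (Module.Basis.span hz i)
  rw [Module.Basis.constr_basis] at h
  rw [← h, LinearMap.comp_apply, Submodule.subtype_apply, Module.Basis.span_apply]

end General

open MvPolynomial in
/-- The data of a model with even generators `x i` and odd generators `u i`, `y`, with
`d (u i) = x i ^ 2` and `d y = ∑ C p q • x p * x q`. -/
structure SpecialData (n : ℕ) where
  e : Fin n → ℕ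
  k : ℕ
  even_e : ∀ i, Even (e i)
  pos_e : ∀ i, 0 < e i
  odd_k : Odd k
  C : Fin n → Fin n → ℚ
  symm : ∀ p q, C p q = C q p
  homog : ∀ p q, C p q ≠ 0 → e p + e q = k + 1

namespace SpecialData

open MvPolynomial

variable {n : ℕ} (S : SpecialData n)

/-- The coefficients of the quadratic differentials. -/
def B : Option (Fin n) → Fin n → Fin n → ℚ
  | some i => fun p q => if p = i ∧ q = i then 1 else 0
  | none => S.C

/-- The degrees of the odd generators. -/
def deg : Option (Fin n) → ℕ
  | some i => 2 * S.e i - 1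
  | none => S.k

theorem B_symm (a : Option (Fin n)) (p q : Fin n) : S.B a p q = S.B a q p := by
  cases a with
  | none => exact S.symm p q
  | some i => simp [B, and_comm]

theorem deg_add {a : Option (Fin n)} {p q : Fin n} (h : S.B a p q ≠ 0) :
    S.e p + S.e q = S.deg a + 1 := by
  cases a with
  | none => exact S.homog p q h
  | some i =>
    have : p = i ∧ q = i := by
      by_contra h'
      simp [B, h'] at h
    have h0 := S.pos_e i
    simp only [deg, this.1, this.2]
    omega

/-- The associated Koszul data. -/
def K : KoszulData (Fin n) (Option (Fin n)) where
  degI := S.e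
  degJ := S.deg
  even_degI := S.even_e
  odd_degJ a := by
    cases a with
    | none => exact S.odd_k
    | some i =>
      have h0 := S.pos_e i
      exact ⟨S.e i - 1, by simp only [deg]; omega⟩
  q a := ∑ p, ∑ q, S.B a p q • (X p * X q)
  q_scale a := by
    rw [map_sum, Finset.smul_sum]
    refine Finset.sum_congr rfl fun p _ => ?_
    rw [map_sum, Finset.smul_sum]
    refine Finset.sum_congr rfl fun q _ => ?_
    by_cases h : S.B a p q = 0
    · simp [h]
    · rw [map_smul, map_mul, aeval_X, aeval_X, smul_mul_smul_comm, ← pow_add, S.deg_add h,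
        smul_comm]

theorem K_q (a : Option (Fin n)) : S.K.q a = ∑ p, ∑ q, S.B a p q • (X p * X q) := rfl

theorem K_q_some (i : Fin n) : S.K.q (some i) = X i ^ 2 := by
  rw [K_q, Finset.sum_eq_single i, Finset.sum_eq_single i]
  · simp [B, sq]
  · intro q _ hq; simp [B, hq]
  · simp
  · intro p _ hp; simp [B, hp]
  · simp

end SpecialData

section Model

open Koszul MvPolynomial

theorem exists_coeff {A : Type} [GCDGA A] {n : ℕ} {x : Fin n → A} {e : Fin n → ℕ} {k : ℕ}
    (he : ∀ i, Even (e i)) (hx : ∀ i, x i ∈ Gr A (e i)) {z : A} (hz : z ∈ Gr A (k + 1))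
    (hspan : z ∈ Submodule.span ℚ {w : A | ∃ p q, w = x p * x q}) :
    ∃ C : Fin n → Fin n → ℚ, (∀ p q, C p q = C q p) ∧ (∀ p q, C p q ≠ 0 → e p + e q = k + 1) ∧
      z = ∑ p, ∑ q, C p q • (x p * x q) := by
  have hset : {w : A | ∃ p q, w = x p * x q} =
      Set.range fun pq : Fin n × Fin n => x pq.1 * x pq.2 := by
    ext w; simp [eq_comm]
  rw [hset] at hspan
  have h := mem_span_of_mem_Gr (d := fun pq : Fin n × Fin n => e pq.1 + e pq.2)
    (fun pq => SetLike.mul_mem_graded (hx pq.1) (hx pq.2)) hz hspan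
  have hcomm : ∀ p q, x p * x q = x q * x p := fun p q => comm_of_even (he p) (hx p) _
  clear hz hspan
  induction h using Submodule.span_induction with
  | mem w hw =>
    obtain ⟨⟨p, q⟩, hpq, rfl⟩ := hw
    refine ⟨fun a b => (if a = p ∧ b = q then 1 / 2 else 0) + if a = q ∧ b = p then 1 / 2 else 0,
      fun a b => ?_, fun a b hab => ?_, ?_⟩
    · simp only [and_comm]; rw [add_comm]
    · have hpq' : e p + e q = k + 1 := hpq
      by_cases h1 : a = p ∧ b = q
      · rw [h1.1, h1.2, hpq']
      · by_cases h2 : a = q ∧ b = p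
        · rw [h2.1, h2.2, add_comm, hpq']
        · simp [h1, h2] at hab
    · simp only [add_smul, Finset.sum_add_distrib, ite_and, ite_smul, zero_smul,
        Finset.sum_ite_eq', Finset.sum_ite_irrel, Finset.mem_univ, if_true, Finset.sum_const_zero]
      rw [hcomm q p, ← add_smul]
      norm_num
  | zero => exact ⟨0, by simp, by simp, by simp⟩
  | add a b _ _ ha hb =>
    obtain ⟨C, h1, h2, h3⟩ := ha
    obtain ⟨C', h1', h2', h3'⟩ := hb
    refine ⟨C + C', fun p q => by simp [h1 p q, h1' p q], fun p q h => ?_, ?_⟩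
    · by_cases h0 : C p q = 0
      · exact h2' p q fun h0' => h (by simp [h0, h0'])
      · exact h2 p q h0
    · simp [h3, h3', add_smul, Finset.sum_add_distrib]
  | smul c a _ ha =>
    obtain ⟨C, h1, h2, h3⟩ := ha
    refine ⟨c • C, fun p q => by simp [h1 p q], fun p q h => h2 p q fun h0 => h (by simp [h0]), ?_⟩
    simp [h3, mul_smul, Finset.smul_sum]

theorem exists_equiv {A : Type} [GCDGA A] (S : MinimalSullivan A)
    {n : ℕ} {x u : Fin n → A} {y : A} {e : Fin n → ℕ} {k : ℕ}
    (he_even : ∀ i, Even (e i)) (he_pos : ∀ i, 0 < e i) (hk_odd : Odd k)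
    (hx_mem : ∀ i, x i ∈ S.V (e i)) (hu_mem : ∀ i, u i ∈ S.V (2 * e i - 1))
    (hy_mem : y ∈ S.V k)
    (hx_li : LinearIndependent ℚ x)
    (hx_span : Submodule.span ℚ (Set.range x) = S.Veven)
    (huy_li : LinearIndependent ℚ (Sum.elim u (fun _ : Unit => y)))
    (huy_span : Submodule.span ℚ (Set.range u ∪ {y}) = S.Vodd)
    (hdx : ∀ i, Dd A (x i) = 0) (hdu : ∀ i, Dd A (u i) = x i ^ 2)
    (hdy : Dd A y ∈ Submodule.span ℚ {w : A | ∃ p q, w = x p * x q}) :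
    ∃ (Sd : SpecialData n) (Θ : Koszul Sd.K ≃ₐ[ℚ] A),
      IsDGAHom (Θ : Koszul Sd.K →ₐ[ℚ] A) ∧ IsDGAHom (Θ.symm : A →ₐ[ℚ] Koszul Sd.K) ∧
      (∀ i, Θ (xg Sd.K i) = x i) ∧ (∀ i, Θ (wg Sd.K (some i)) = u i) ∧
      Θ (wg Sd.K none) = y := by
  have hx : ∀ i, x i ∈ Gr A (e i) := fun i => S.V_le _ (hx_mem i)
  obtain ⟨C, hC1, hC2, hC3⟩ := exists_coeff he_even hx (Dd_mem (S.V_le _ hy_mem)) hdy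
  let Sd : SpecialData n := ⟨e, k, he_even, he_pos, hk_odd, C, hC1, hC2⟩
  let w : Option (Fin n) → A := fun a => a.elim y u
  have hwV : ∀ a, w a ∈ S.V (Sd.deg a) := fun a => by
    cases a with
    | none => exact hy_mem
    | some i => exact hu_mem i
  have hw : ∀ a, w a ∈ Gr A (Sd.deg a) := fun a => S.V_le _ (hwV a)
  have hw_span : Submodule.span ℚ (Set.range w) = S.Vodd := by
    rw [← huy_span]
    congr 1
    ext a
    simp [w, Option.exists, eq_comm]
  have hw_li : LinearIndependent ℚ w := by
    have := huy_li.comp (Equiv.optionEquivSumPUnit (Fin n)) (Equiv.injective _)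
    convert this using 1
    ext a
    cases a <;> simp [w]
  let Θ : Koszul Sd.K →ₐ[ℚ] A := homOf Sd.K x w hx hw
  have Θx : ∀ i, Θ (xg Sd.K i) = x i := homOf_xg _ _
  have Θw : ∀ a, Θ (wg Sd.K a) = w a := homOf_wg _ _
  have hΘ : IsDGAHom Θ := by
    refine dga_of_gen Θ (fun i => ?_) (fun j => ?_) (fun i => ?_) (fun j => ?_)
    · rw [Θx]; exact hx i
    · rw [Θw]; exact hw j
    · rw [Θx, hdx]
    · have hX : ∀ i, Θ (poly Sd.K (X i)) = x i := Θx
      rw [Θw]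
      cases j with
      | none => simpa [SpecialData.K_q, SpecialData.B, hX, Sd, w] using hC3
      | some i => simpa [SpecialData.K_q_some, hX, w] using hdu i
  obtain ⟨L0, hL0⟩ := exists_linearMap_of_li hx_li (xg Sd.K)
  obtain ⟨L1, hL1⟩ := exists_linearMap_of_li hw_li (wg Sd.K)
  have hVeven : ∀ m, Even m → ∀ v ∈ S.V m, v ∈ Submodule.span ℚ (Set.range x) := by
    rintro m ⟨l, rfl⟩ v hv
    rw [hx_span, MinimalSullivan.Veven]
    exact Submodule.mem_iSup_of_mem l (by rwa [two_mul])
  have hVodd : ∀ m, ¬Even m → ∀ v ∈ S.V m, v ∈ Submodule.span ℚ (Set.range w) := by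
    intro m hm v hv
    obtain ⟨l, rfl⟩ := Nat.not_even_iff_odd.1 hm
    rw [hw_span, MinimalSullivan.Vodd]
    exact Submodule.mem_iSup_of_mem l hv
  obtain ⟨ι, ⟨hι1, hι2⟩, -⟩ := S.free (Koszul Sd.K)
    (fun m => (if Even m then L0 else L1).comp (S.V m).subtype) (by
      rintro m ⟨v, hv⟩
      have hvG := S.V_le m hv
      rw [LinearMap.comp_apply, Submodule.subtype_apply]
      by_cases hm : Even m
      · rw [if_pos hm]
        have h := mem_span_of_mem_Gr hx hvG (hVeven m hm v hv)
        refine Submodule.span_le (p := (Gr (Koszul Sd.K) m).comap L0).2 ?_ h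
        rintro _ ⟨i, rfl, rfl⟩
        rw [SetLike.mem_coe, Submodule.mem_comap, hL0]
        exact xg_mem_grd (D := Sd.K) i
      · rw [if_neg hm]
        have h := mem_span_of_mem_Gr hw hvG (hVodd m hm v hv)
        refine Submodule.span_le (p := (Gr (Koszul Sd.K) m).comap L1).2 ?_ h
        rintro _ ⟨i, rfl, rfl⟩
        rw [SetLike.mem_coe, Submodule.mem_comap, hL1]
        exact wg_mem_grd (D := Sd.K) i)
  have ιx : ∀ i, ι (x i) = xg Sd.K i := fun i => by
    have := hι2 (e i) ⟨x i, hx_mem i⟩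
    simpa [he_even i, hL0] using this
  have ιw : ∀ a, ι (w a) = wg Sd.K a := fun a => by
    have := hι2 (Sd.deg a) ⟨w a, hwV a⟩
    have hodd : ¬Even (Sd.deg a) := Nat.not_even_iff_odd.2 (Sd.K.odd_degJ a)
    simpa [hodd, hL1] using this
  have hιΘ : ι.comp Θ = AlgHom.id ℚ _ := by
    refine algHom_ext (fun i => ?_) fun a => ?_
    · simp [Θx, ιx]
    · simp [Θw, ιw]
  have hΘι : Θ.comp ι = AlgHom.id ℚ A := by
    refine (S.free A (fun m => (S.V m).subtype) fun m v => S.V_le m v.2).unique ⟨?_, ?_⟩ ⟨?_, ?_⟩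
    · intro i a ha
      exact hΘ.2 _ _ (hι1 i a ha)
    · rintro m ⟨v, hv⟩
      change (Θ.comp ι) v = AlgHom.id ℚ A v
      by_cases hm : Even m
      · have h := hVeven m hm v hv
        refine LinearMap.eqOn_span (f := (Θ.comp ι).toLinearMap) (g := (AlgHom.id ℚ A).toLinearMap)
          ?_ h
        rintro _ ⟨i, rfl⟩
        simp [ιx, Θx]
      · have h := hVodd m hm v hv
        refine LinearMap.eqOn_span (f := (Θ.comp ι).toLinearMap) (g := (AlgHom.id ℚ A).toLinearMap)
          ?_ h
        rintro _ ⟨i, rfl⟩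
        simp [ιw, Θw]
    · exact fun i a ha => ha
    · exact fun m v => rfl
  let E : Koszul Sd.K ≃ₐ[ℚ] A := AlgEquiv.ofAlgHom Θ ι hΘι hιΘ
  refine ⟨Sd, E, hΘ, ⟨fun a => ?_, hι1⟩, Θx, fun i => Θw (some i), Θw none⟩
  change ι (Dd A a) = Dd _ (ι a)
  have h1 : ∀ a, Θ (ι a) = a := DFunLike.congr_fun hΘι
  have h2 : ∀ a, ι (Θ a) = a := DFunLike.congr_fun hιΘ
  rw [← h2 (Dd _ (ι a)), hΘ.1, h1]

end Model

section Homogeneous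

variable {A : Type} [GCDGA A]

/-- Homogeneous subspaces. -/
def IsHom (p : Submodule ℚ A) : Prop := p ≤ ⨆ i, p ⊓ Gr A i

/-- Subspaces stable under the differential. -/
def IsDStable (p : Submodule ℚ A) : Prop := p ≤ p.comap (Dd A)

theorem IsHom.induction {p : Submodule ℚ A} (hp : IsHom p) {P : (a : A) → a ∈ p → Prop}
    (hmem : ∀ (i : ℕ) (a : A) (ha : a ∈ p), a ∈ Gr A i → P a ha)
    (hadd : ∀ (a b : A) (ha : a ∈ p) (hb : b ∈ p), P a ha → P b hb → P (a + b) (add_mem ha hb))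
    {a : A} (ha : a ∈ p) : P a ha := by
  have key : ∀ a ∈ ⨆ i, p ⊓ Gr A i, ∃ ha : a ∈ p, P a ha := by
    intro a ha
    induction ha using Submodule.iSup_induction' with
    | mem i a ha =>
      obtain ⟨h1, h2⟩ := Submodule.mem_inf.1 ha
      exact ⟨h1, hmem i a h1 h2⟩
    | zero => exact ⟨zero_mem _, hmem 0 0 (zero_mem _) (zero_mem _)⟩
    | add a b _ _ ha hb =>
      obtain ⟨ha, ha'⟩ := ha
      obtain ⟨hb, hb'⟩ := hb
      exact ⟨add_mem ha hb, hadd _ _ _ _ ha' hb'⟩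
  exact (key a (hp ha)).2

theorem isHom_top : IsHom (⊤ : Submodule ℚ A) := by
  intro a _
  simp only [top_inf_eq, iSup_Gr]
  trivial

theorem isHom_span {s : Set A} (hs : ∀ a ∈ s, ∃ i, a ∈ Gr A i) : IsHom (Submodule.span ℚ s) := by
  refine Submodule.span_le.2 fun a ha => ?_
  obtain ⟨i, hi⟩ := hs a ha
  exact Submodule.mem_iSup_of_mem i ⟨Submodule.subset_span ha, hi⟩

theorem IsHom.mul {p q : Submodule ℚ A} (hp : IsHom p) (hq : IsHom q) : IsHom (p * q) := by
  refine Submodule.mul_le.2 fun a ha b hb => ?_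
  induction ha using hp.induction with
  | hmem i a ha hai =>
    induction hb using hq.induction with
    | hmem j b hb hbj =>
      exact Submodule.mem_iSup_of_mem (i + j)
        ⟨Submodule.mul_mem_mul ha hb, SetLike.mul_mem_graded hai hbj⟩
    | hadd b c _ _ hb hc => rw [mul_add]; exact add_mem hb hc
  | hadd a c _ _ ha hc => rw [add_mul]; exact add_mem ha hc

theorem IsHom.pow_succ {p : Submodule ℚ A} (hp : IsHom p) (m : ℕ) : IsHom (p ^ (m + 1)) := by
  induction m with
  | zero => simpa using hp
  | succ m ih => rw [_root_.pow_succ]; exact ih.mul hp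

theorem IsDStable.mul {p q : Submodule ℚ A} (hp : IsHom p) (hdp : IsDStable p)
    (hdq : IsDStable q) : IsDStable (p * q) := by
  refine Submodule.mul_le.2 fun a ha b hb => ?_
  rw [Submodule.mem_comap]
  induction ha using hp.induction with
  | hmem i a ha hai =>
    rw [Dd_mul hai]
    exact add_mem (Submodule.mul_mem_mul (hdp ha) hb)
      (Submodule.smul_mem _ _ (Submodule.mul_mem_mul ha (hdq hb)))
  | hadd a c _ _ ha hc => rw [add_mul, map_add]; exact add_mem ha hc

theorem IsDStable.pow_succ {p : Submodule ℚ A} (hp : IsHom p) (hd : IsDStable p) (m : ℕ) :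
    IsDStable (p ^ (m + 1)) := by
  induction m with
  | zero => simpa using hd
  | succ m ih => rw [_root_.pow_succ]; exact IsDStable.mul (hp.pow_succ m) ih hd

theorem isHom_iSup {K : Sort*} {p : K → Submodule ℚ A} (hp : ∀ k, IsHom (p k)) :
    IsHom (⨆ k, p k) := by
  refine iSup_le fun k => (hp k).trans (iSup_mono fun i => ?_)
  exact inf_le_inf_right _ (le_iSup p k)

variable (A) in
/-- An endomorphism acting on each graded piece by a power of two. -/
def weight : A →ₗ[ℚ] A :=
  (DirectSum.toModule ℚ ℕ A fun i => (2 : ℚ) ^ i • (Gr A i).subtype) ∘ₗ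
    (DirectSum.decomposeLinearEquiv (Gr A)).toLinearMap

theorem weight_apply {i : ℕ} {a : A} (ha : a ∈ Gr A i) : weight A a = (2 : ℚ) ^ i • a := by
  rw [weight, LinearMap.comp_apply]
  simp only [LinearEquiv.coe_coe, DirectSum.decomposeLinearEquiv_apply]
  rw [DirectSum.decompose_of_mem _ ha]
  erw [DirectSum.toModule_lof]
  simp

theorem iSupIndep_of_weight {M : Type} [AddCommGroup M] [Module ℚ M] (θ : M →ₗ[ℚ] M)
    {G : ℕ → Submodule ℚ M} (h : ∀ i, ∀ a ∈ G i, θ a = (2 : ℚ) ^ i • a) : iSupIndep G := by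
  have h' := (Module.End.eigenspaces_iSupIndep θ).comp
    (f := fun i : ℕ => (2 : ℚ) ^ i) (fun i j h => Nat.pow_right_injective le_rfl (by
      have : (2 : ℚ) ^ i = 2 ^ j := h
      exact_mod_cast this))
  refine h'.mono fun i a ha => ?_
  rw [Function.comp_apply, Module.End.mem_eigenspace_iff]
  exact h i a ha

theorem iSupIndep_of_injective {M N : Type} [AddCommGroup M] [Module ℚ M] [AddCommGroup N]
    [Module ℚ N] {f : M →ₗ[ℚ] N} (hf : Function.Injective f) {G : ℕ → Submodule ℚ M}
    {H : ℕ → Submodule ℚ N} (hH : iSupIndep H) (h : ∀ i, G i ≤ (H i).comap f) : iSupIndep G := by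
  intro i
  rw [Submodule.disjoint_def]
  intro a ha ha'
  refine hf ?_
  rw [map_zero]
  refine Submodule.disjoint_def.1 (hH i) _ (h i ha) ?_
  have : (⨆ (j) (_ : j ≠ i), G j) ≤ (⨆ (j) (_ : j ≠ i), H j).comap f :=
    iSup₂_le fun j hj => (h j).trans (Submodule.comap_mono (le_iSup₂_of_le j hj le_rfl))
  exact this ha'

end Homogeneous

/-- Homogeneous two-sided ideals stable under the differential. -/
structure DGIdeal (T : Type) [GCDGA T] where
  carrier : Submodule ℚ T
  mul_left : ∀ t, ∀ a ∈ carrier, t * a ∈ carrier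
  mul_right : ∀ t, ∀ a ∈ carrier, a * t ∈ carrier
  isHom : IsHom carrier
  isDStable : IsDStable carrier

namespace DGIdeal

variable {T : Type} [GCDGA T] (I J : DGIdeal T)

/-- The underlying ideal. -/
def toIdeal : Ideal T :=
  { I.carrier.toAddSubmonoid with smul_mem' := fun t a ha => I.mul_left t a ha }

theorem mem_toIdeal {a : T} : a ∈ I.toIdeal ↔ a ∈ I.carrier := Iff.rfl

instance : I.toIdeal.IsTwoSided := ⟨fun t ha => I.mul_right t _ ha⟩

/-- The quotient algebra. -/
def Quot : Type := T ⧸ I.toIdeal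

instance : Ring I.Quot := inferInstanceAs (Ring (T ⧸ I.toIdeal))

instance : Algebra ℚ I.Quot := inferInstanceAs (Algebra ℚ (T ⧸ I.toIdeal))

/-- The quotient map. -/
def proj : T →ₐ[ℚ] I.Quot := Ideal.Quotient.mkₐ ℚ I.toIdeal

theorem proj_surjective : Function.Surjective I.proj := Ideal.Quotient.mkₐ_surjective ℚ I.toIdeal

theorem proj_eq_zero {a : T} : I.proj a = 0 ↔ a ∈ I.carrier :=
  (Ideal.Quotient.eq_zero_iff_mem (I := I.toIdeal)).trans I.mem_toIdeal

theorem exists_factor {f : T →ₗ[ℚ] T} (hf : I.carrier ≤ I.carrier.comap f) :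
    ∃ g : I.Quot →ₗ[ℚ] I.Quot, ∀ a, g (I.proj a) = I.proj (f a) := by
  have hsurj : Function.Surjective I.proj.toLinearMap := I.proj_surjective
  have hker : LinearMap.ker I.proj.toLinearMap ≤ LinearMap.ker (I.proj.toLinearMap ∘ₗ f) := by
    intro a ha
    exact I.proj_eq_zero.2 (hf (I.proj_eq_zero.1 ha))
  refine ⟨(LinearMap.ker I.proj.toLinearMap).liftQ _ hker ∘ₗ
    (I.proj.toLinearMap.quotKerEquivOfSurjective hsurj).symm.toLinearMap, fun a => ?_⟩
  have : (I.proj.toLinearMap.quotKerEquivOfSurjective hsurj).symm (I.proj a) =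
      (LinearMap.ker I.proj.toLinearMap).mkQ a := by
    rw [LinearEquiv.symm_apply_eq]
    rfl
  rw [LinearMap.comp_apply, LinearEquiv.coe_coe, this]
  rfl

/-- The differential of the quotient. -/
def dQuot : I.Quot →ₗ[ℚ] I.Quot := (I.exists_factor I.isDStable).choose

theorem dQuot_proj (a : T) : I.dQuot (I.proj a) = I.proj (Dd T a) :=
  (I.exists_factor I.isDStable).choose_spec a

/-- The grading of the quotient. -/
def grQuot (i : ℕ) : Submodule ℚ I.Quot := (Gr T i).map I.proj.toLinearMap

theorem proj_mem_grQuot {i : ℕ} {a : T} (ha : a ∈ Gr T i) : I.proj a ∈ I.grQuot i := ⟨a, ha, rfl⟩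

instance : SetLike.GradedMonoid I.grQuot where
  one_mem := ⟨1, SetLike.GradedOne.one_mem, map_one I.proj⟩
  mul_mem := by
    rintro i j _ _ ⟨a, ha, rfl⟩ ⟨b, hb, rfl⟩
    exact ⟨a * b, SetLike.mul_mem_graded ha hb, map_mul I.proj a b⟩

theorem iSup_grQuot : ⨆ i, I.grQuot i = ⊤ := by
  simp only [grQuot]
  rw [← Submodule.map_iSup, iSup_Gr, Submodule.map_top, LinearMap.range_eq_top]
  exact I.proj_surjective

theorem iSupIndep_grQuot : iSupIndep I.grQuot := by
  have hw : I.carrier ≤ I.carrier.comap (weight T) := by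
    intro a ha
    rw [Submodule.mem_comap]
    induction ha using I.isHom.induction with
    | hmem i a ha hai => rw [weight_apply hai]; exact Submodule.smul_mem _ _ ha
    | hadd a b _ _ ha hb => rw [map_add]; exact add_mem ha hb
  obtain ⟨θ, hθ⟩ := I.exists_factor hw
  refine iSupIndep_of_weight θ ?_
  rintro i _ ⟨a, ha, rfl⟩
  change θ (I.proj a) = (2 : ℚ) ^ i • I.proj a
  rw [hθ, weight_apply ha, map_smul]

instance : GradedAlgebra I.grQuot :=
  { (inferInstance : SetLike.GradedMonoid I.grQuot),
    (DirectSum.isInternal_submodule_of_iSupIndep_of_iSup_eq_top I.iSupIndep_grQuot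
      I.iSup_grQuot).chooseDecomposition with }

instance : GCDGA I.Quot where
  grading := I.grQuot
  gradedAlgebra := inferInstance
  grading_comm := by
    rintro i j _ _ ⟨a, ha, rfl⟩ ⟨b, hb, rfl⟩
    change I.proj a * I.proj b = _ • (I.proj b * I.proj a)
    rw [← map_mul, GCDGA.grading_comm i j a b ha hb, map_smul, map_mul]
  d := I.dQuot
  d_sq a := by
    obtain ⟨a, rfl⟩ := I.proj_surjective a
    rw [dQuot_proj, dQuot_proj, Dd_Dd, map_zero]
  d_grading := by
    rintro i _ ⟨a, ha, rfl⟩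
    change I.dQuot (I.proj a) ∈ _
    rw [dQuot_proj]
    exact I.proj_mem_grQuot (Dd_mem ha)
  d_leibniz := by
    rintro i _ b ⟨a, ha, rfl⟩
    obtain ⟨b, rfl⟩ := I.proj_surjective b
    change I.dQuot (I.proj a * I.proj b) = I.dQuot (I.proj a) * I.proj b + _ • (I.proj a * I.dQuot (I.proj b))
    rw [← map_mul, dQuot_proj, Dd_mul ha, dQuot_proj, dQuot_proj, map_add, map_smul, map_mul, map_mul]

theorem Dd_proj (a : T) : Dd I.Quot (I.proj a) = I.proj (Dd T a) := I.dQuot_proj a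

theorem proj_dga : IsDGAHom I.proj := ⟨fun a => (I.Dd_proj a).symm, fun _ _ ha => I.proj_mem_grQuot ha⟩

/-- The pairs `(t, q)` with `q` congruent to `t` modulo the image of `J`. -/
def cylSub : Subalgebra ℚ (T × I.Quot) where
  carrier := {c | ∃ s ∈ J.carrier, c.2 = I.proj (c.1 + s)}
  mul_mem' := by
    rintro ⟨t, q⟩ ⟨t', q'⟩ ⟨s, hs, h⟩ ⟨s', hs', h'⟩
    refine ⟨t * s' + s * t' + s * s', add_mem (add_mem (J.mul_left _ _ hs') (J.mul_right _ _ hs))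
      (J.mul_left _ _ hs'), ?_⟩
    change q = I.proj (t + s) at h
    change q' = I.proj (t' + s') at h'
    change q * q' = I.proj (t * t' + _)
    rw [h, h', ← map_mul]
    congr 1
    noncomm_ring
  add_mem' := by
    rintro ⟨t, q⟩ ⟨t', q'⟩ ⟨s, hs, h⟩ ⟨s', hs', h'⟩
    refine ⟨s + s', add_mem hs hs', ?_⟩
    change q = I.proj (t + s) at h
    change q' = I.proj (t' + s') at h'
    change q + q' = I.proj (t + t' + _)
    rw [h, h', ← map_add]
    congr 1
    abel
  algebraMap_mem' r := ⟨0, zero_mem _, by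
    change algebraMap ℚ I.Quot r = I.proj (algebraMap ℚ T r + 0)
    rw [add_zero, AlgHom.commutes]⟩

/-- The algebra underlying `cylSub`. -/
def Cyl : Type := cylSub I J

instance : Ring (Cyl I J) := inferInstanceAs (Ring (cylSub I J))

instance : Algebra ℚ (Cyl I J) := inferInstanceAs (Algebra ℚ (cylSub I J))

namespace Cyl

/-- The first projection. -/
def fst : Cyl I J →ₐ[ℚ] T := (AlgHom.fst ℚ T I.Quot).comp (cylSub I J).val

/-- The second projection. -/
def snd : Cyl I J →ₐ[ℚ] I.Quot := (AlgHom.snd ℚ T I.Quot).comp (cylSub I J).val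

variable {I J}

theorem ext {a b : Cyl I J} (h1 : fst I J a = fst I J b) (h2 : snd I J a = snd I J b) : a = b :=
  Subtype.ext (Prod.ext h1 h2)

theorem exists_snd (a : Cyl I J) : ∃ s ∈ J.carrier, snd I J a = I.proj (fst I J a + s) := a.2

/-- The pair given by an element and an element of `J`. -/
def of (t : T) (s : T) (hs : s ∈ J.carrier) : Cyl I J := ⟨(t, I.proj (t + s)), s, hs, rfl⟩

theorem fst_of (t s : T) (hs : s ∈ J.carrier) : fst I J (of t s hs) = t := rfl

theorem snd_of (t s : T) (hs : s ∈ J.carrier) : snd I J (of t s hs) = I.proj (t + s) := rfl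

theorem exists_of (a : Cyl I J) : ∃ t s, ∃ hs : s ∈ J.carrier, a = of t s hs := by
  obtain ⟨s, hs, h⟩ := exists_snd a
  exact ⟨fst I J a, s, hs, ext rfl h⟩

variable (I J)

/-- The differential. -/
def d : Cyl I J →ₗ[ℚ] Cyl I J where
  toFun a := ⟨(Dd T (fst I J a), Dd I.Quot (snd I J a)), by
    obtain ⟨s, hs, h⟩ := exists_snd a
    exact ⟨Dd T s, J.isDStable hs, by rw [h, Dd_proj, map_add]⟩⟩
  map_add' a b := ext
    (by exact (congrArg (Dd T) (map_add (fst I J) a b)).trans (map_add _ _ _))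
    (by exact (congrArg (Dd I.Quot) (map_add (snd I J) a b)).trans (map_add _ _ _))
  map_smul' r a := ext
    (by exact (congrArg (Dd T) (map_smul (fst I J) r a)).trans (map_smul _ _ _))
    (by exact (congrArg (Dd I.Quot) (map_smul (snd I J) r a)).trans (map_smul _ _ _))

theorem fst_d (a : Cyl I J) : fst I J (d I J a) = Dd T (fst I J a) := rfl

theorem snd_d (a : Cyl I J) : snd I J (d I J a) = Dd I.Quot (snd I J a) := rfl

/-- The grading. -/
def gr (i : ℕ) : Submodule ℚ (Cyl I J) :=
  (Gr T i).comap (fst I J).toLinearMap ⊓ (Gr I.Quot i).comap (snd I J).toLinearMap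

variable {I J} in
theorem mem_gr {i : ℕ} {a : Cyl I J} :
    a ∈ gr I J i ↔ fst I J a ∈ Gr T i ∧ snd I J a ∈ Gr I.Quot i := Iff.rfl

instance : SetLike.GradedMonoid (gr I J) where
  one_mem := mem_gr.2 ⟨by rw [map_one]; exact SetLike.GradedOne.one_mem,
    by rw [map_one]; exact SetLike.GradedOne.one_mem⟩
  mul_mem i j a b ha hb := mem_gr.2 ⟨by
    rw [map_mul]; exact SetLike.mul_mem_graded (mem_gr.1 ha).1 (mem_gr.1 hb).1, by
    rw [map_mul]; exact SetLike.mul_mem_graded (mem_gr.1 ha).2 (mem_gr.1 hb).2⟩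

theorem of_mem_gr {i : ℕ} {t s : T} (ht : t ∈ Gr T i) (hs : s ∈ J.carrier) (hsi : s ∈ Gr T i) :
    (of t s hs : Cyl I J) ∈ gr I J i :=
  mem_gr.2 ⟨ht, I.proj_mem_grQuot (add_mem ht hsi)⟩

theorem iSup_gr : ⨆ i, gr I J i = ⊤ := by
  rw [eq_top_iff]
  intro a ha
  clear ha
  obtain ⟨t, s, hs, rfl⟩ := exists_of a
  have h : (of t s hs : Cyl I J) = of t 0 (zero_mem _) + of 0 s hs :=
    ext (by simp [fst_of]) (by simp [snd_of])
  rw [h]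
  clear h
  refine add_mem ?_ ?_
  · induction t using Gr_induction with
    | hmem i t ht => exact Submodule.mem_iSup_of_mem i (of_mem_gr I J ht _ (zero_mem _))
    | hadd t t' ht ht' =>
      have h : (of (t + t') 0 (zero_mem _) : Cyl I J) =
          of t 0 (zero_mem _) + of t' 0 (zero_mem _) :=
        ext (by simp [fst_of]) (by simp [snd_of])
      rw [h]
      exact add_mem ht ht'
  · have key : ∃ hs : s ∈ J.carrier, (of 0 s hs : Cyl I J) ∈ ⨆ i, gr I J i := by
      induction hs using J.isHom.induction with
      | hmem i s hs hsi =>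
        exact ⟨hs, Submodule.mem_iSup_of_mem i (of_mem_gr I J (zero_mem _) hs hsi)⟩
      | hadd s s' _ _ h h' =>
        obtain ⟨hs, h⟩ := h
        obtain ⟨hs', h'⟩ := h'
        have h0 : (of 0 (s + s') (add_mem hs hs') : Cyl I J) = of 0 s hs + of 0 s' hs' :=
          ext (by simp [fst_of]) (by simp [snd_of])
        exact ⟨add_mem hs hs', h0 ▸ add_mem h h'⟩
    exact key.2

theorem iSupIndep_gr : iSupIndep (gr I J) := by
  let f : Cyl I J →ₗ[ℚ] T × I.Quot := (fst I J).toLinearMap.prod (snd I J).toLinearMap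
  refine iSupIndep_of_injective (f := f) (fun a b h => ?_)
    (iSupIndep_of_weight (LinearMap.prodMap (weight T) (weight I.Quot))
      (G := fun i => (Gr T i).prod (Gr I.Quot i)) ?_) fun i a ha => mem_gr.1 ha
  · exact ext (congrArg Prod.fst h) (congrArg Prod.snd h)
  · rintro i ⟨a, b⟩ ⟨ha, hb⟩
    exact Prod.ext (weight_apply ha) (weight_apply hb)

instance : GradedAlgebra (gr I J) :=
  { (inferInstance : SetLike.GradedMonoid (gr I J)),
    (DirectSum.isInternal_submodule_of_iSupIndep_of_iSup_eq_top (iSupIndep_gr I J)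
      (iSup_gr I J)).chooseDecomposition with }

instance : GCDGA (Cyl I J) where
  grading := gr I J
  gradedAlgebra := inferInstance
  grading_comm i j a b ha hb := ext
    (by rw [map_mul, map_smul, map_mul, GCDGA.grading_comm i j _ _ (mem_gr.1 ha).1 (mem_gr.1 hb).1])
    (by rw [map_mul, map_smul, map_mul, GCDGA.grading_comm i j _ _ (mem_gr.1 ha).2 (mem_gr.1 hb).2])
  d := d I J
  d_sq a := ext (by rw [fst_d, fst_d, Dd_Dd, map_zero]) (by rw [snd_d, snd_d, Dd_Dd, map_zero])
  d_grading i a ha := mem_gr.2 ⟨Dd_mem (mem_gr.1 ha).1, Dd_mem (mem_gr.1 ha).2⟩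
  d_leibniz i a b ha := ext
    (by rw [fst_d, map_mul, Dd_mul (mem_gr.1 ha).1, map_add, map_smul, map_mul, map_mul, fst_d, fst_d])
    (by rw [snd_d, map_mul, Dd_mul (mem_gr.1 ha).2, map_add, map_smul, map_mul, map_mul, snd_d, snd_d])

/-- The diagonal inclusion. -/
def diag : T →ₐ[ℚ] Cyl I J :=
  AlgHom.codRestrict ((AlgHom.id ℚ T).prod I.proj) (cylSub I J) fun t => ⟨0, zero_mem _, by simp⟩

end Cyl

/-- The quotient map by an ideal contained in an acyclic one admits a homotopy retraction. -/
def htpyRetraction (hIJ : I.carrier ≤ J.carrier)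
    (hJ : ∀ a ∈ J.carrier, Dd T a = 0 → ∃ b ∈ J.carrier, a = Dd T b) : HtpyRetraction I.proj where
  C := Cyl I J
  j := Cyl.diag I J
  q := Cyl.snd I J
  τ := Cyl.fst I J
  j_dga := ⟨fun t => Cyl.ext rfl (I.Dd_proj t).symm, fun i t ht => ⟨ht, I.proj_mem_grQuot ht⟩⟩
  q_dga := ⟨fun a => rfl, fun i a ha => ha.2⟩
  τ_dga := ⟨fun a => rfl, fun i a ha => ha.1⟩
  q_surj a := by
    obtain ⟨t, rfl⟩ := I.proj_surjective a
    exact ⟨Cyl.diag I J t, rfl⟩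
  hqj := rfl
  hτj := rfl
  q_quasi := by
    have main : ∀ t, ∀ s ∈ J.carrier, Dd T (t + s) ∈ I.carrier → ∃ a : Cyl I J,
        Cyl.snd I J a = I.proj (t + s) ∧ Dd _ a = 0 := by
      intro t s hs h
      obtain ⟨b, hb, hd⟩ := hJ _ (hIJ h) (Dd_Dd _)
      refine ⟨Cyl.of (t + s - b) b hb, ?_, Cyl.ext ?_ ?_⟩
      · rw [Cyl.snd_of, sub_add_cancel]
      · change Dd T (t + s - b) = 0
        rw [map_sub, ← hd, sub_self]
      · change Dd I.Quot (I.proj (t + s - b + b)) = 0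
        rw [sub_add_cancel, Dd_proj, proj_eq_zero]
        exact h
    constructor
    · intro q hq
      obtain ⟨t, rfl⟩ := I.proj_surjective q
      rw [Dd_proj, proj_eq_zero] at hq
      obtain ⟨a, ha, hda⟩ := main t 0 (zero_mem _) (by rwa [add_zero])
      exact ⟨a, hda, 0, by rw [ha, add_zero, sub_self, map_zero]⟩
    · rintro a ha ⟨c, hc⟩
      obtain ⟨c, rfl⟩ := I.proj_surjective c
      have hd : Dd T (Cyl.fst I J a) = 0 := by
        have := congrArg (Cyl.fst I J) ha
        rwa [map_zero] at this
      obtain ⟨s, hs, h⟩ := Cyl.exists_snd a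
      have h1 : Cyl.fst I J a + s - Dd T c ∈ I.carrier := by
        rw [← proj_eq_zero, map_sub, ← h, hc, Dd_proj, sub_self]
      have h2 : Cyl.fst I J a - Dd T c ∈ J.carrier := by
        have := sub_mem (hIJ h1) hs
        rwa [show Cyl.fst I J a + s - Dd T c - s = Cyl.fst I J a - Dd T c by abel] at this
      obtain ⟨b, hb, hdb⟩ := hJ _ h2 (by rw [map_sub, hd, Dd_Dd, sub_zero])
      refine ⟨Cyl.of (c + b) (-b) (neg_mem hb), Cyl.ext ?_ ?_⟩
      · change _ = Dd T (c + b)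
        rw [map_add, ← hdb]
        abel
      · change _ = Dd I.Quot (I.proj (c + b + -b))
        rw [hc, add_neg_cancel_right]

end DGIdeal

section Acyclic

open scoped TensorProduct
open MvPolynomial

theorem mul_top_mul_mem {A : Type} [Ring A] [Algebra ℚ A] {p : Submodule ℚ A} {a : A}
    (ha : a ∈ p * ⊤) (b : A) : a * b ∈ p * ⊤ := by
  have h := Submodule.mul_mem_mul ha (Submodule.mem_top (R := ℚ) (x := b))
  rw [mul_assoc] at h
  have h' : p * (⊤ * ⊤) ≤ p * (⊤ : Submodule ℚ A) := mul_le_mul' le_rfl le_top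
  exact h' h

namespace Koszul

variable {I J : Type} {D : KoszulData I J}

/-- Division by the square of an even generator. -/
def divSq (D : KoszulData I J) (i : I) : Koszul D →ₗ[ℚ] Koszul D :=
  (TensorProduct.map (R := ℚ)
    { toFun p := p.divMonomial (Finsupp.single i 2)
      map_add' p q := add_divMonomial p q _
      map_smul' c p := by ext m; simp [coeff_divMonomial] } LinearMap.id :
      MvPolynomial I ℚ ⊗[ℚ] ExteriorAlgebra ℚ (J → ℚ) →ₗ[ℚ]
        MvPolynomial I ℚ ⊗[ℚ] ExteriorAlgebra ℚ (J → ℚ))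

theorem divSq_mk (i : I) (p : MvPolynomial I ℚ) (s : ExteriorAlgebra ℚ (J → ℚ)) :
    divSq D i (mk p s) = mk (p.divMonomial (Finsupp.single i 2)) s := rfl

theorem divSq_poly (i : I) (p : MvPolynomial I ℚ) :
    divSq D i (poly D p) = poly D (p.divMonomial (Finsupp.single i 2)) := rfl

theorem divSq_ev_mul (i : I) (v : J → ℚ) (a : Koszul D) :
    divSq D i (ev D v * a) = ev D v * divSq D i a := by
  induction a using mk_induction with
  | h0 => simp
  | hmk p s => simp_rw [divSq_mk, ev_eq, mk_mul_mk, divSq_mk, one_mul]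
  | hadd a b ha hb => simp only [mul_add, map_add, ha, hb]

theorem divSq_sq_mul_self (i : I) (a : Koszul D) : divSq D i (poly D (X i ^ 2) * a) = a := by
  induction a using mk_induction with
  | h0 => simp
  | hmk p s =>
    rw [poly_eq, mk_mul_mk, divSq_mk, one_mul, X_pow_eq_monomial, divMonomial_monomial_mul]
  | hadd a b ha hb => simp only [mul_add, map_add, ha, hb]

theorem divSq_sq_mul {i j : I} (h : j ≠ i) (a : Koszul D) :
    divSq D i (poly D (X j ^ 2) * a) = poly D (X j ^ 2) * divSq D i a := by
  classical
  induction a using mk_induction with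
  | h0 => simp
  | hmk p s =>
    simp_rw [poly_eq, divSq_mk, mk_mul_mk, divSq_mk, X_pow_eq_monomial]
    congr 1
    ext m
    rw [coeff_divMonomial, coeff_monomial_mul', coeff_monomial_mul', coeff_divMonomial]
    have hle : (Finsupp.single j 2 ≤ Finsupp.single i 2 + m) ↔ Finsupp.single j 2 ≤ m := by
      simp [Finsupp.single_le_iff, h.symm]
    by_cases hm : Finsupp.single j 2 ≤ m
    · rw [if_pos (hle.2 hm), if_pos hm, add_tsub_assoc_of_le hm]
    · rw [if_neg (hle.not.2 hm), if_neg hm]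
  | hadd a b ha hb => simp only [mul_add, map_add, ha, hb]

theorem divSq_comm (i j : I) (a : Koszul D) :
    divSq D i (divSq D j a) = divSq D j (divSq D i a) := by
  induction a using mk_induction with
  | h0 => simp
  | hmk p s =>
    simp_rw [divSq_mk]
    congr 1
    ext m
    simp only [coeff_divMonomial]
    rw [add_left_comm]
  | hadd a b ha hb => simp only [map_add, ha, hb]

variable [Fintype J] [DecidableEq J]

/-- The augmentation killing the odd generators. -/
def aug (D : KoszulData I J) : Koszul D →ₐ[ℚ] MvPolynomial I ℚ :=
  lift D X (fun _ _ => mul_comm _ _) (fun _ => 0) (fun _ _ => by simp)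

theorem aug_poly (p : MvPolynomial I ℚ) : aug D (poly D p) = p := by
  have : (aug D).comp (poly D) = AlgHom.id ℚ _ := by
    ext i
    have := lift_xg (D := D) X (fun _ _ => mul_comm _ _) (fun _ => (0 : MvPolynomial I ℚ))
      (fun _ _ => by simp) i
    rw [xg] at this
    exact congrArg _ this
  exact DFunLike.congr_fun this p

theorem aug_wg (j : J) : aug D (wg D j) = 0 := lift_wg ..

/-- The function dual to an odd generator. -/
def dual (j : J) : J → MvPolynomial I ℚ := Pi.single j 1

theorem contr_eq_sum (f : J → MvPolynomial I ℚ) (a : Koszul D) :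
    contr D f a = ∑ j, poly D (f j) * contr D (dual j) a := by
  have : f = ∑ j, fun k => f j * dual (I := I) j k := by
    ext1 k
    simp [dual, Pi.single_apply]
  conv_lhs => rw [this]
  rw [contr_sum]
  simp_rw [contr_mul]

theorem contr_dual_wg_mul (j k : J) (a : Koszul D) : contr D (dual j) (wg D k * a) =
    (if k = j then a else 0) - wg D k * contr D (dual j) a := by
  rw [wg, contr_ev_mul, pair_single, dual, Pi.single_apply]
  split_ifs <;> simp

theorem scale_eq_of_contr_eq_zero (s : Finset J) {a : Koszul D}
    (h : ∀ j ∈ s, contr D (dual j) a = 0) :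
    scale D 1 (fun k => if k ∈ s then 0 else 1) a = a := by
  induction s using Finset.induction_on with
  | empty =>
    have : scale D 1 (fun k => if k ∈ (∅ : Finset J) then 0 else 1) = AlgHom.id ℚ _ :=
      algHom_ext (fun i => by simp [scale_xg]) fun j => by simp [scale_wg]
    rw [this, AlgHom.id_apply]
  | insert j s _ ih =>
    have h1 : scale D 1 (fun k => if k ∈ insert j s then 0 else 1) =
        (scale D 1 (fun k => if k ∈ s then 0 else 1)).comp
          (scale D 1 (fun k => if k = j then 0 else 1)) := by
      refine algHom_ext (fun i => by simp [scale_xg]) fun k => ?_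
      by_cases hk : k = j <;> by_cases hk' : k ∈ s <;> simp [scale_wg, hk, hk']
    have h2 : ∀ b : Koszul D, scale D 1 (fun k => if k = j then 0 else 1) b =
        b - wg D j * contr D (dual j) b := by
      intro b
      induction b using induction_gen with
      | h1 => simp [contr_one]
      | hadd b c hb hc => rw [map_add, map_add, hb, hc, mul_add]; abel
      | hsmul r b hb => rw [map_smul, map_smul, hb, smul_sub, mul_smul_comm]
      | hx i b hb =>
        rw [map_mul, hb, scale_xg, xg, contr_poly_mul, ← mul_assoc (wg D j), ← poly_comm]
        simp [mul_sub, mul_assoc]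
      | hw k b hb =>
        rw [map_mul, hb, scale_wg, contr_dual_wg_mul]
        by_cases hk : k = j
        · subst hk
          have : wg D k * (wg D k * contr D (dual k) b) = 0 := by
            rw [← mul_assoc, wg, ev_sq, zero_mul]
          simp [mul_sub, this]
        · have : wg D j * (wg D k * contr D (dual j) b) =
              -(wg D k * (wg D j * contr D (dual j) b)) := by
            rw [← mul_assoc, wg, wg, ev_anticomm, neg_mul, mul_assoc]
          simp [hk, mul_sub, this]
    rw [h1, AlgHom.comp_apply, h2, h j (Finset.mem_insert_self _ _), mul_zero, sub_zero]
    exact ih fun k hk => h k (Finset.mem_insert_of_mem hk)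

theorem eq_poly_of_contr_eq_zero {a : Koszul D} (h : ∀ j, contr D (dual j) a = 0) :
    a = poly D (aug D a) := by
  have h1 := scale_eq_of_contr_eq_zero (D := D) Finset.univ fun j _ => h j
  have h2 : scale D 1 (fun k => if k ∈ Finset.univ then 0 else 1) = (poly D).comp (aug D) := by
    refine algHom_ext (fun i => ?_) fun j => ?_
    · rw [scale_xg, AlgHom.comp_apply, xg, aug_poly]; simp
    · rw [scale_wg, AlgHom.comp_apply, aug_wg]; simp
  rw [h2] at h1
  exact h1.symm

theorem divSq_contr_dual (i : I) (j : J) (a : Koszul D) :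
    divSq D i (contr D (dual j) a) = contr D (dual j) (divSq D i a) := by
  have h1 : ∀ (j k : J) (p : MvPolynomial I ℚ), (dual j k * p).divMonomial (Finsupp.single i 2) =
      dual j k * p.divMonomial (Finsupp.single i 2) := by
    intro j k p
    rw [dual, Pi.single_apply]
    split_ifs <;> simp
  induction a using mk_induction with
  | h0 => simp
  | hmk p s => simp_rw [divSq_mk, contr_mk, map_sum, divSq_mk, h1]
  | hadd a b ha hb => simp only [map_add, ha, hb]

variable {s : I → J}

/-- The generators of the ideal `sqIdeal`. -/
def sqGen (D : KoszulData I J) (s : I → J) : Set (Koszul D) :=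
  (Set.range fun i => poly D (X i ^ 2)) ∪ Set.range fun i => wg D (s i)

/-- The ideal generated by the squares of the even generators and the odd generators killing
them. -/
def sqIdeal (D : KoszulData I J) (s : I → J) (hs : ∀ i, D.q (s i) = X i ^ 2) :
    DGIdeal (Koszul D) where
  carrier := Submodule.span ℚ (sqGen D s) * ⊤
  mul_left t a ha := by
    induction ha using Submodule.mul_induction_on' with
    | mem_mul_mem g hg b _ =>
      have : t * g ∈ Submodule.span ℚ (sqGen D s) * ⊤ := by
        clear b ‹b ∈ ⊤›
        induction hg using Submodule.span_induction with
        | mem g hg =>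
          obtain ⟨i, rfl⟩ | ⟨i, rfl⟩ := hg
          · simp only
            rw [← poly_comm]
            exact Submodule.mul_mem_mul (Submodule.subset_span (Or.inl ⟨i, rfl⟩)) trivial
          · simp only
            rw [← par_par t, wg, ← ev_mul]
            exact Submodule.mul_mem_mul (Submodule.subset_span (Or.inr ⟨i, rfl⟩)) trivial
        | zero => rw [mul_zero]; exact zero_mem _
        | add a b _ _ ha hb => rw [mul_add]; exact add_mem ha hb
        | smul c a _ ha => rw [mul_smul_comm]; exact Submodule.smul_mem _ _ ha
      rw [← mul_assoc]
      exact mul_top_mul_mem this b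
    | add a _ b _ ha hb => rw [mul_add]; exact add_mem ha hb
  mul_right t a ha := mul_top_mul_mem ha t
  isHom := by
    refine (isHom_span ?_).mul isHom_top
    rintro _ (⟨i, rfl⟩ | ⟨i, rfl⟩)
    · refine ⟨2 • D.degI i, ?_⟩
      simp only
      rw [map_pow]
      exact SetLike.pow_mem_graded 2 (xg_mem_grd i)
    · exact ⟨_, wg_mem_grd _⟩
  isDStable := by
    refine IsDStable.mul (isHom_span ?_) ?_ fun _ _ => trivial
    · rintro _ (⟨i, rfl⟩ | ⟨i, rfl⟩)
      · refine ⟨2 • D.degI i, ?_⟩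
        simp only
        rw [map_pow]
        exact SetLike.pow_mem_graded 2 (xg_mem_grd i)
      · exact ⟨_, wg_mem_grd _⟩
    · refine Submodule.span_le.2 ?_
      rintro _ (⟨i, rfl⟩ | ⟨i, rfl⟩)
      · change Dd (Koszul D) (poly D _) ∈ Submodule.span ℚ (sqGen D s)
        rw [Dd_eq, contr_poly]
        exact zero_mem _
      · change Dd (Koszul D) (wg D _) ∈ Submodule.span ℚ (sqGen D s)
        rw [Dd_wg, hs]
        exact Submodule.subset_span (Or.inl ⟨i, rfl⟩)

variable {hs : ∀ i, D.q (s i) = X i ^ 2}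

theorem sq_mul_mem (i : I) (b : Koszul D) : poly D (X i ^ 2) * b ∈ (sqIdeal D s hs).carrier :=
  Submodule.mul_mem_mul (Submodule.subset_span (Or.inl ⟨i, rfl⟩)) trivial

theorem wg_mul_mem (i : I) (b : Koszul D) : wg D (s i) * b ∈ (sqIdeal D s hs).carrier :=
  Submodule.mul_mem_mul (Submodule.subset_span (Or.inr ⟨i, rfl⟩)) trivial

theorem sqIdeal_induction {P : Koszul D → Prop} {a : Koszul D} (ha : a ∈ (sqIdeal D s hs).carrier)
    (hsq : ∀ i b, P (poly D (X i ^ 2) * b)) (hwg : ∀ i b, P (wg D (s i) * b)) (h0 : P 0)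
    (hadd : ∀ a b, P a → P b → P (a + b)) : P a := by
  induction ha using Submodule.mul_induction_on' with
  | mem_mul_mem g hg b _ =>
    clear ‹b ∈ ⊤›
    induction hg using Submodule.span_induction generalizing b with
    | mem g hg =>
      obtain ⟨i, rfl⟩ | ⟨i, rfl⟩ := hg
      · exact hsq i b
      · exact hwg i b
    | zero => rw [zero_mul]; exact h0
    | add a c _ _ ha hc => rw [add_mul]; exact hadd _ _ (ha b) (hc b)
    | smul c a _ ha => rw [smul_mul_assoc, ← mul_smul_comm]; exact ha _
  | add a _ b _ ha hb => exact hadd _ _ ha hb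

theorem contr_mem_sqIdeal {f : J → MvPolynomial I ℚ} (hf : ∀ i, f (s i) = 0) {a : Koszul D}
    (ha : a ∈ (sqIdeal D s hs).carrier) : contr D f a ∈ (sqIdeal D s hs).carrier := by
  refine sqIdeal_induction (P := fun a => contr D f a ∈ _) ha (fun i b => ?_) (fun i b => ?_) ?_
    fun a b ha hb => ?_
  · rw [contr_poly_mul]
    exact sq_mul_mem _ _
  · rw [wg, contr_ev_mul, pair_single, hf, map_zero, zero_mul, zero_sub]
    exact neg_mem (wg_mul_mem _ _)
  · rw [map_zero]
    exact zero_mem _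
  · rw [map_add]
    exact add_mem ha hb

theorem coeff_aug_eq_zero {a : Koszul D} (ha : a ∈ (sqIdeal D s hs).carrier) {m : I →₀ ℕ}
    (hm : ∀ i, m i < 2) : coeff m (aug D a) = 0 := by
  classical
  refine sqIdeal_induction (P := fun a => coeff m (aug D a) = 0) ha (fun i b => ?_)
    (fun i b => ?_) ?_ fun a b ha hb => ?_
  · rw [map_mul, aug_poly, X_pow_eq_monomial, coeff_monomial_mul', if_neg]
    simpa using hm i
  · rw [map_mul, aug_wg, zero_mul, coeff_zero]
  · simp
  · rw [map_add, coeff_add, ha, hb, add_zero]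

theorem Dd_eq_sum [Fintype I] (hs : ∀ i, D.q (s i) = X i ^ 2) (hinj : Function.Injective s)
    {a : Koszul D} (ha : ∀ j ∉ Set.range s, contr D (dual j) a = 0) :
    Dd (Koszul D) a = ∑ i, poly D (X i ^ 2) * contr D (dual (s i)) a := by
  rw [Dd_eq, contr_eq_sum]
  refine (Fintype.sum_of_injective s hinj _ _ (fun j hj => ?_) fun i => ?_).symm
  · rw [ha j hj, mul_zero]
  · rw [hs]

theorem contr_Dd (f : J → MvPolynomial I ℚ) (a : Koszul D) :
    contr D f (Dd (Koszul D) a) = -Dd (Koszul D) (contr D f a) := by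
  rw [Dd_eq, Dd_eq, contr_anticomm]

theorem Dd_wg_mul (j : J) (a : Koszul D) :
    Dd (Koszul D) (wg D j * a) = poly D (D.q j) * a - wg D j * Dd (Koszul D) a := by
  rw [Dd_eq, Dd_eq, wg, contr_ev_mul, pair_single]

theorem exists_reduced [Fintype I] (hinj : Function.Injective s)
    (S : Finset I) {a : Koszul D} (hda : Dd (Koszul D) a = 0) (ha : ∀ j ∉ Set.range s, contr D (dual j) a = 0) :
    ∃ b ∈ (sqIdeal D s hs).carrier, (∀ j ∉ Set.range s, contr D (dual j) b = 0) ∧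
      ∀ i ∈ S, divSq D i (a - Dd (Koszul D) b) = 0 ∧
        contr D (dual (s i)) (a - Dd (Koszul D) b) = 0 := by
  classical
  induction S using Finset.induction_on with
  | empty => exact ⟨0, zero_mem _, by simp, by simp⟩
  | insert i S hi ih =>
    obtain ⟨b, hbJ, hb, hred⟩ := ih
    obtain ⟨c, hc⟩ : ∃ c, c = a - Dd (Koszul D) b := ⟨_, rfl⟩
    rw [← hc] at hred
    have hdc : Dd (Koszul D) c = 0 := by rw [hc, map_sub, hda, Dd_Dd, sub_zero]
    have hcy : ∀ j ∉ Set.range s, contr D (dual j) c = 0 := fun j hj => by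
      rw [hc, map_sub, ha j hj, contr_Dd, hb j hj, map_zero, neg_zero, sub_zero]
    have hvy : ∀ j ∉ Set.range s, contr D (dual j) (divSq D i c) = 0 := fun j hj => by
      rw [← divSq_contr_dual, hcy j hj, map_zero]
    have key : Dd (Koszul D) (divSq D i c) =
        poly D (X i ^ 2) * contr D (dual (s i)) (divSq D i c) - contr D (dual (s i)) c := by
      have h0 : divSq D i (Dd (Koszul D) c) = 0 := by rw [hdc, map_zero]
      rw [Dd_eq_sum hs hinj hcy, map_sum, ← Finset.add_sum_erase _ _ (Finset.mem_univ i),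
        divSq_sq_mul_self] at h0
      rw [Dd_eq_sum hs hinj hvy, ← Finset.add_sum_erase _ _ (Finset.mem_univ i),
        eq_neg_of_add_eq_zero_left h0, sub_neg_eq_add]
      congr 1
      refine Finset.sum_congr rfl fun k hk => ?_
      rw [divSq_sq_mul (Finset.ne_of_mem_erase hk), divSq_contr_dual]
    obtain ⟨c', hc'⟩ : ∃ c', c' = c - poly D (X i ^ 2) * divSq D i c := ⟨_, rfl⟩
    have hd : a - Dd (Koszul D) (b + wg D (s i) * divSq D i c) =
        c' - wg D (s i) * contr D (dual (s i)) c' := by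
      rw [map_add, ← sub_sub, ← hc, Dd_wg_mul, key, hs, hc', map_sub, contr_poly_mul]
      simp only [mul_sub]
      abel
    refine ⟨b + wg D (s i) * divSq D i c, add_mem hbJ (wg_mul_mem _ _), fun j hj => ?_,
      fun k hk => ?_⟩
    · rw [map_add, hb j hj, contr_dual_wg_mul, if_neg (fun h => hj ⟨i, h⟩), hvy j hj]
      simp
    · rw [hd, map_sub, map_sub, contr_dual_wg_mul, wg, divSq_ev_mul, divSq_contr_dual,
        ← wg]
      rcases Finset.mem_insert.1 hk with rfl | hk
      · have h0 : divSq D k c' = 0 := by rw [hc', map_sub, divSq_sq_mul_self, sub_self]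
        simp [h0, contr_contr_self]
      · have hki : i ≠ k := fun h => hi (h ▸ hk)
        have h0 : divSq D k c' = 0 := by
          rw [hc', map_sub, divSq_sq_mul hki, divSq_comm, (hred k hk).1]
          simp
        have h1 : contr D (dual (s k)) c' = 0 := by
          rw [hc', map_sub, contr_poly_mul, ← divSq_contr_dual, (hred k hk).2]
          simp
        rw [contr_anticomm, h1, h0, if_neg (fun h => hki (hinj h))]
        simp

theorem exists_primitive [Fintype I] (hinj : Function.Injective s) (S : Finset J)
    {a : Koszul D} (haJ : a ∈ (sqIdeal D s hs).carrier)
    (hda : Dd (Koszul D) a = 0) (ha : ∀ j ∉ Set.range s, j ∉ S → contr D (dual j) a = 0) :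
    ∃ b ∈ (sqIdeal D s hs).carrier, (∀ j ∉ Set.range s, j ∉ S → contr D (dual j) b = 0) ∧
      a = Dd (Koszul D) b := by
  induction S using Finset.induction_on generalizing a with
  | empty =>
    simp only [Finset.notMem_empty, not_false_eq_true, forall_true_left] at ha ⊢
    obtain ⟨b, hbJ, hb, hred⟩ := exists_reduced (hs := hs) hinj Finset.univ hda ha
    refine ⟨b, hbJ, hb, ?_⟩
    rw [← sub_eq_zero]
    have h1 : a - Dd (Koszul D) b = poly D (aug D (a - Dd (Koszul D) b)) := by
      refine eq_poly_of_contr_eq_zero fun j => ?_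
      by_cases hj : j ∈ Set.range s
      · obtain ⟨i, rfl⟩ := hj
        exact (hred i (Finset.mem_univ _)).2
      · rw [map_sub, ha j hj, contr_Dd, hb j hj, map_zero, neg_zero, sub_zero]
    have h2 : aug D (a - Dd (Koszul D) b) = 0 := by
      ext m
      rw [coeff_zero]
      by_cases hm : ∀ i, m i < 2
      · exact coeff_aug_eq_zero (sub_mem haJ ((sqIdeal D s hs).isDStable hbJ)) hm
      · push Not at hm
        obtain ⟨i, hi⟩ := hm
        have h3 := (hred i (Finset.mem_univ _)).1
        rw [h1, divSq_poly] at h3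
        have h4 := congrArg (aug D) h3
        rw [aug_poly, map_zero] at h4
        have h5 := congrArg (coeff (m - Finsupp.single i 2)) h4
        rwa [coeff_divMonomial, add_tsub_cancel_of_le (by simpa using hi), coeff_zero] at h5
    rw [h1, h2, map_zero]
  | insert k S hk ih =>
    by_cases hkr : k ∈ Set.range s
    · refine (ih haJ hda fun j hj hjS => ha j hj ?_).imp fun b hb => ⟨hb.1, fun j hj hjS => ?_, hb.2.2⟩
      · simp only [Finset.mem_insert, not_or]
        exact ⟨fun h => hj (h ▸ hkr), hjS⟩
      · exact hb.2.1 j hj fun h => hjS (Finset.mem_insert_of_mem h)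
    · have hk0 : ∀ i, dual (I := I) k (s i) = 0 := fun i => by
        rw [dual, Pi.single_apply, if_neg (fun h => hkr ⟨i, h⟩)]
      have hins : ∀ j, j ∉ S → j ≠ k → j ∉ insert k S := fun j h h' => by simp [h, h']
      obtain ⟨b₁, hb₁J, hb₁, hd₁⟩ := ih (contr_mem_sqIdeal hk0 haJ)
        (by rw [← neg_eq_zero, ← contr_Dd, hda, map_zero]) (fun j hj hjS => by
          by_cases hjk : j = k
          · rw [hjk, contr_contr_self]
          · rw [contr_anticomm, ha j hj (hins j hjS hjk), map_zero, neg_zero])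
      obtain ⟨b, hbJ, hb, hd⟩ := ih
        (a := a + Dd (Koszul D) (wg D k * b₁))
        (add_mem haJ ((sqIdeal D s hs).isDStable ((sqIdeal D s hs).mul_left _ _ hb₁J)))
        (by rw [map_add, hda, Dd_Dd, add_zero]) (fun j hj hjS => by
          by_cases hjk : j = k
          · subst hjk
            rw [map_add, contr_Dd, contr_dual_wg_mul, if_pos rfl, hb₁ j hj hjS, mul_zero, sub_zero,
              ← hd₁, add_neg_cancel]
          · rw [map_add, contr_Dd, contr_dual_wg_mul, if_neg (fun h => hjk h.symm),
              ha j hj (hins j hjS hjk), hb₁ j hj hjS]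
            simp)
      refine ⟨b - wg D k * b₁, sub_mem hbJ ((sqIdeal D s hs).mul_left _ _ hb₁J),
        fun j hj hjS => ?_, by rw [map_sub, ← hd]; abel⟩
      simp only [Finset.mem_insert, not_or] at hjS
      rw [map_sub, hb j hj hjS.2, contr_dual_wg_mul, if_neg (fun h => hjS.1 h.symm),
        hb₁ j hj hjS.2]
      simp

theorem sqIdeal_acyclic [Fintype I] (hinj : Function.Injective s) (a : Koszul D)
    (haJ : a ∈ (sqIdeal D s hs).carrier) (hda : Dd (Koszul D) a = 0) :
    ∃ b ∈ (sqIdeal D s hs).carrier, a = Dd (Koszul D) b :=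
  (exists_primitive hinj Finset.univ haJ hda (by simp)).imp fun _ hb => ⟨hb.1, hb.2.2⟩

end Koszul

end Acyclic

section Constructions

variable {A T : Type} [GCDGA A] [GCDGA T]

theorem decompose_map {f : T →ₐ[ℚ] A} (hf : IsDGAHom f) (i : ℕ) (a : T) :
    (DirectSum.decompose (Gr A) (f a) i : A) = f (DirectSum.decompose (Gr T) a i : T) := by
  induction a using Gr_induction with
  | hmem j a ha =>
    by_cases h : j = i
    · subst h
      rw [DirectSum.decompose_of_mem_same _ ha, DirectSum.decompose_of_mem_same _ (hf.2 _ _ ha)]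
    · rw [DirectSum.decompose_of_mem_ne _ ha h, DirectSum.decompose_of_mem_ne _ (hf.2 _ _ ha) h,
        map_zero]
  | hadd a b ha hb => simp [ha, hb]

/-- The kernel of a morphism. -/
def DGIdeal.ker (f : T →ₐ[ℚ] A) (hf : IsDGAHom f) : DGIdeal T where
  carrier := LinearMap.ker f.toLinearMap
  mul_left t a ha := by
    rw [LinearMap.mem_ker, AlgHom.toLinearMap_apply] at *
    rw [map_mul, ha, mul_zero]
  mul_right t a ha := by
    rw [LinearMap.mem_ker, AlgHom.toLinearMap_apply] at *
    rw [map_mul, ha, zero_mul]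
  isHom a ha := by
    classical
    rw [← DirectSum.sum_support_decompose (Gr T) a]
    refine sum_mem fun i _ => Submodule.mem_iSup_of_mem i ⟨?_, SetLike.coe_mem _⟩
    rw [SetLike.mem_coe, LinearMap.mem_ker, AlgHom.toLinearMap_apply] at *
    rw [← decompose_map hf, ha]
    simp
  isDStable a ha := by
    rw [Submodule.mem_comap, LinearMap.mem_ker, AlgHom.toLinearMap_apply] at *
    rw [hf.1, ha, map_zero]

/-- The powers of an ideal. -/
def DGIdeal.pow (I : DGIdeal T) (m : ℕ) : DGIdeal T where
  carrier := I.carrier ^ (m + 1)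
  mul_left t a ha := by
    rw [pow_succ'] at *
    induction ha using Submodule.mul_induction_on' with
    | mem_mul_mem a ha b hb =>
      rw [← mul_assoc]
      exact Submodule.mul_mem_mul (I.mul_left t a ha) hb
    | add a _ b _ ha hb => rw [mul_add]; exact add_mem ha hb
  mul_right t a ha := by
    rw [pow_succ] at *
    induction ha using Submodule.mul_induction_on' with
    | mem_mul_mem a ha b hb =>
      rw [mul_assoc]
      exact Submodule.mul_mem_mul ha (I.mul_right t b hb)
    | add a _ b _ ha hb => rw [add_mul]; exact add_mem ha hb
  isHom := I.isHom.pow_succ m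
  isDStable := IsDStable.pow_succ I.isHom I.isDStable m

/-- The preimage of an ideal under an isomorphism. -/
def DGIdeal.comap (I : DGIdeal T) (f : A ≃ₐ[ℚ] T) (hf : IsDGAHom (f : A →ₐ[ℚ] T))
    (hf' : IsDGAHom (f.symm : T →ₐ[ℚ] A)) : DGIdeal A where
  carrier := I.carrier.comap (f : A →ₐ[ℚ] T).toLinearMap
  mul_left t a ha := by
    change f (t * a) ∈ I.carrier
    rw [map_mul]
    exact I.mul_left _ _ ha
  mul_right t a ha := by
    change f (a * t) ∈ I.carrier
    rw [map_mul]
    exact I.mul_right _ _ ha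
  isHom a ha := by
    have key : ∀ b ∈ I.carrier, f.symm b ∈
        ⨆ i, I.carrier.comap (f : A →ₐ[ℚ] T).toLinearMap ⊓ Gr A i := by
      intro b hb
      induction hb using I.isHom.induction with
      | hmem i b hb hbi =>
        refine Submodule.mem_iSup_of_mem i ⟨?_, hf'.2 i b hbi⟩
        change f (f.symm b) ∈ I.carrier
        rwa [f.apply_symm_apply]
      | hadd a b _ _ ha hb => rw [map_add]; exact add_mem ha hb
    have := key (f a) ha
    rwa [f.symm_apply_apply] at this
  isDStable a ha := by
    change f (Dd A a) ∈ I.carrier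
    have h : f (Dd A a) = Dd T (f a) := hf.1 a
    rw [h]
    exact I.isDStable ha

theorem DGIdeal.comap_acyclic {I : DGIdeal T} {f : A ≃ₐ[ℚ] T} {hf : IsDGAHom (f : A →ₐ[ℚ] T)}
    {hf' : IsDGAHom (f.symm : T →ₐ[ℚ] A)}
    (hI : ∀ a ∈ I.carrier, Dd T a = 0 → ∃ b ∈ I.carrier, a = Dd T b) :
    ∀ a ∈ (I.comap f hf hf').carrier, Dd A a = 0 → ∃ b ∈ (I.comap f hf hf').carrier, a = Dd A b := by
  intro a ha hda
  have h : Dd T (f a) = 0 := by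
    have h := hf.1 a
    rw [hda, map_zero] at h
    exact h.symm
  obtain ⟨b, hb, hab⟩ := hI _ ha h
  refine ⟨f.symm b, ?_, ?_⟩
  · change f (f.symm b) ∈ I.carrier
    rwa [f.apply_symm_apply]
  · have h1 : f.symm (Dd T b) = Dd A (f.symm b) := hf'.1 b
    rw [← h1, ← hab]
    exact (f.symm_apply_apply a).symm

theorem DGIdeal.ker_proj (I : DGIdeal T) : LinearMap.ker I.proj.toLinearMap = I.carrier := by
  ext a
  exact I.proj_eq_zero

/-- A retraction of algebras is a retraction of modules. -/
def HtpyRetraction.toMod {ρ : T →ₐ[ℚ] A} (R : HtpyRetraction ρ) : ModHtpyRetraction ρ where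
  C := R.C
  j := R.j
  q := R.q
  τ := R.τ.toLinearMap
  j_dga := R.j_dga
  q_dga := R.q_dga
  q_surj := R.q_surj
  q_quasi := R.q_quasi
  hqj := R.hqj
  τ_chain := R.τ_dga.1
  τ_mod t c := by
    have h := DFunLike.congr_fun R.hτj t
    rw [AlgHom.comp_apply, AlgHom.id_apply] at h
    rw [AlgHom.toLinearMap_apply, map_mul, h]
    rfl
  hτj := DFunLike.congr_fun R.hτj

/-- A bound for `TC` is a bound for `MTC`. -/
def TCWitness.toMTC {r m : ℕ} (W : TCWitness A r m) : MTCWitness A r m :=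
  letI := W.instT
  letI := W.instQ
  { T := W.T
    TP := W.TP
    Q := W.Q
    ρ := W.ρ
    ρ_dga := W.ρ_dga
    ρ_surj := W.ρ_surj
    ρ_ker := W.ρ_ker
    retr := W.retr.map HtpyRetraction.toMod }

/-- The bound for `TC` coming from an acyclic ideal. -/
def TCWitness.ofAcyclic {r m : ℕ} (TP : TensorPower A r T) (J : DGIdeal T)
    (hle : TP.kerMu ^ (m + 1) ≤ J.carrier)
    (hJ : ∀ a ∈ J.carrier, Dd T a = 0 → ∃ b ∈ J.carrier, a = Dd T b) : TCWitness A r m :=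
  let I := (DGIdeal.ker TP.mu TP.mu_spec.1).pow m
  { T := T
    TP := TP
    Q := I.Quot
    ρ := I.proj
    ρ_dga := I.proj_dga
    ρ_surj := I.proj_surjective
    ρ_ker := I.ker_proj
    retr := ⟨DGIdeal.htpyRetraction I J hle hJ⟩ }

end Constructions

section Filtration

namespace Koszul

variable {I J : Type} {D : KoszulData I J} [Fintype J] [DecidableEq J]

/-- Two-sided ideals stable under the parity automorphism. -/
structure IsParIdeal (p : Submodule ℚ (Koszul D)) : Prop where
  mul_left : ∀ t, ∀ a ∈ p, t * a ∈ p
  mul_right : ∀ t, ∀ a ∈ p, a * t ∈ p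
  par_mem : ∀ a ∈ p, par D a ∈ p

theorem isParIdeal_top : IsParIdeal (⊤ : Submodule ℚ (Koszul D)) :=
  ⟨fun _ _ _ => trivial, fun _ _ _ => trivial, fun _ _ => trivial⟩

/-- Elements that are even or odd. -/
def HasParity (v : Koszul D) : Prop := par D v = v ∨ par D v = -v

theorem IsParIdeal.mul_comm_mem {p : Submodule ℚ (Koszul D)} (hp : IsParIdeal p) {v : Koszul D}
    (hv : HasParity v) {a : Koszul D} (ha : a ∈ p) :
    (∃ b ∈ p, a * v = v * b) ∧ ∃ b ∈ p, v * a = b * v := by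
  rcases hv with hv | hv
  · exact ⟨⟨a, ha, mul_comm_of_par_eq hv a⟩, a, ha, (mul_comm_of_par_eq hv a).symm⟩
  · refine ⟨⟨par D a, hp.par_mem a ha, mul_comm_of_par_neg hv a⟩, par D a, hp.par_mem a ha, ?_⟩
    rw [mul_comm_of_par_neg hv, par_par]

theorem IsParIdeal.sup {p q : Submodule ℚ (Koszul D)} (hp : IsParIdeal p) (hq : IsParIdeal q) :
    IsParIdeal (p ⊔ q) where
  mul_left t a ha := by
    obtain ⟨b, hb, c, hc, rfl⟩ := Submodule.mem_sup.1 ha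
    rw [mul_add]
    exact add_mem (Submodule.mem_sup_left (hp.mul_left t b hb))
      (Submodule.mem_sup_right (hq.mul_left t c hc))
  mul_right t a ha := by
    obtain ⟨b, hb, c, hc, rfl⟩ := Submodule.mem_sup.1 ha
    rw [add_mul]
    exact add_mem (Submodule.mem_sup_left (hp.mul_right t b hb))
      (Submodule.mem_sup_right (hq.mul_right t c hc))
  par_mem a ha := by
    obtain ⟨b, hb, c, hc, rfl⟩ := Submodule.mem_sup.1 ha
    rw [map_add]
    exact add_mem (Submodule.mem_sup_left (hp.par_mem b hb))
      (Submodule.mem_sup_right (hq.par_mem c hc))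

theorem IsParIdeal.span_mul {p : Submodule ℚ (Koszul D)} (hp : IsParIdeal p) {v : Koszul D}
    (hv : HasParity v) : IsParIdeal (p.map (LinearMap.mulLeft ℚ v)) where
  mul_left := by
    rintro t _ ⟨a, ha, rfl⟩
    obtain ⟨t', -, h⟩ := (isParIdeal_top.mul_comm_mem hv (Submodule.mem_top (x := t))).1
    exact ⟨t' * a, hp.mul_left _ _ ha, by simp only [LinearMap.mulLeft_apply, ← mul_assoc, h]⟩
  mul_right := by
    rintro t _ ⟨a, ha, rfl⟩
    exact ⟨a * t, hp.mul_right _ _ ha, by simp only [LinearMap.mulLeft_apply, ← mul_assoc]⟩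
  par_mem := by
    rintro _ ⟨a, ha, rfl⟩
    rw [LinearMap.mulLeft_apply, map_mul]
    rcases hv with hv | hv
    · exact ⟨par D a, hp.par_mem a ha, by rw [LinearMap.mulLeft_apply, hv]⟩
    · exact ⟨-par D a, neg_mem (hp.par_mem a ha), by
        rw [LinearMap.mulLeft_apply, hv, mul_neg, neg_mul]⟩

/-- The filtration by the number of factors from a list, modulo a submodule. -/
def fil (N : Submodule ℚ (Koszul D)) : List (Koszul D) → ℕ → Submodule ℚ (Koszul D)
  | _, 0 => ⊤
  | [], _ + 1 => N
  | v :: l, m + 1 => fil N l (m + 1) ⊔ (fil N l m).map (LinearMap.mulLeft ℚ v)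

variable {N : Submodule ℚ (Koszul D)}

theorem fil_zero (l : List (Koszul D)) : fil N l 0 = ⊤ := by cases l <;> rfl

theorem fil_nil (m : ℕ) : fil N [] (m + 1) = N := rfl

theorem fil_cons (v : Koszul D) (l : List (Koszul D)) (m : ℕ) : fil N (v :: l) (m + 1) =
    fil N l (m + 1) ⊔ (fil N l m).map (LinearMap.mulLeft ℚ v) := rfl

theorem le_fil (l : List (Koszul D)) (m : ℕ) : N ≤ fil N l m := by
  cases m with
  | zero => rw [fil_zero]; exact le_top
  | succ m =>
    induction l with
    | nil => exact le_rfl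
    | cons v l ih => exact ih.trans le_sup_left

theorem isParIdeal_fil (hN : IsParIdeal N) (l : List (Koszul D)) (hl : ∀ v ∈ l, HasParity v)
    (m : ℕ) : IsParIdeal (fil N l m) := by
  induction l generalizing m with
  | nil =>
    cases m with
    | zero => rw [fil_zero]; exact isParIdeal_top
    | succ m => exact hN
  | cons v l ih =>
    cases m with
    | zero => rw [fil_zero]; exact isParIdeal_top
    | succ m =>
      have ih' := ih fun w hw => hl w (List.mem_cons_of_mem _ hw)
      exact (ih' _).sup ((ih' _).span_mul (hl v (by simp)))

theorem fil_mul (hN : IsParIdeal N) (l : List (Koszul D)) (hl : ∀ v ∈ l, HasParity v)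
    (hsq : ∀ v ∈ l, v * v ∈ N) (m m' : ℕ) {a b : Koszul D} (ha : a ∈ fil N l m)
    (hb : b ∈ fil N l m') : a * b ∈ fil N l (m + m') := by
  induction l generalizing m m' a b with
  | nil =>
    rcases m with _ | m
    · rw [zero_add]
      exact (isParIdeal_fil hN _ hl _).mul_left _ _ hb
    · rw [Nat.succ_add]
      exact hN.mul_right _ _ ha
  | cons v l ih =>
    rcases m with _ | m
    · rw [zero_add]
      exact (isParIdeal_fil hN _ hl _).mul_left _ _ hb
    rcases m' with _ | m'
    · exact (isParIdeal_fil hN _ hl _).mul_right _ _ ha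
    have hl' : ∀ v ∈ l, HasParity v := fun w hw => hl w (List.mem_cons_of_mem _ hw)
    have ih' := @ih hl' fun w hw => hsq w (List.mem_cons_of_mem _ hw)
    have hv : HasParity v := hl v (by simp)
    rw [fil_cons] at ha hb
    rw [show m + 1 + (m' + 1) = m + m' + 1 + 1 by omega, fil_cons]
    obtain ⟨a₁, ha₁, _, ⟨a₂, ha₂, rfl⟩, rfl⟩ := Submodule.mem_sup.1 ha
    obtain ⟨b₁, hb₁, _, ⟨b₂, hb₂, rfl⟩, rfl⟩ := Submodule.mem_sup.1 hb
    simp only [LinearMap.mulLeft_apply]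
    rw [add_mul, mul_add, mul_add]
    refine add_mem (add_mem (Submodule.mem_sup_left ?_) (Submodule.mem_sup_right ?_))
      (add_mem (Submodule.mem_sup_right ?_) (Submodule.mem_sup_left ?_))
    · have := ih' _ _ ha₁ hb₁
      rwa [show m + 1 + (m' + 1) = m + m' + 1 + 1 by omega] at this
    · obtain ⟨c, hc, h⟩ := ((isParIdeal_fil hN l hl' _).mul_comm_mem hv ha₁).1
      refine ⟨c * b₂, ?_, ?_⟩
      · have := ih' _ _ hc hb₂
        rwa [show m + 1 + m' = m + m' + 1 by omega] at this
      · rw [LinearMap.mulLeft_apply, ← mul_assoc, ← mul_assoc, h]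
    · refine ⟨a₂ * b₁, ih' m (m' + 1) ha₂ hb₁, ?_⟩
      rw [LinearMap.mulLeft_apply, mul_assoc]
    · obtain ⟨c, -, h⟩ := (isParIdeal_top.mul_comm_mem hv (Submodule.mem_top (x := a₂))).1
      refine le_fil l _ ?_
      rw [mul_assoc, ← mul_assoc a₂, h, mul_assoc v c b₂, ← mul_assoc v v]
      exact hN.mul_right _ _ (hsq v (by simp))

theorem fil_le_of_length_lt (hN : IsParIdeal N) (l : List (Koszul D)) {m : ℕ}
    (h : l.length < m) : fil N l m ≤ N := by
  induction l generalizing m with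
  | nil =>
    obtain ⟨m, rfl⟩ := Nat.exists_eq_add_of_lt h
    simp [fil_nil]
  | cons v l ih =>
    rw [List.length_cons] at h
    obtain ⟨m, rfl⟩ : ∃ m', m = m' + 1 := ⟨m - 1, by omega⟩
    rw [fil_cons]
    refine sup_le (ih (by omega)) ?_
    rintro _ ⟨a, ha, rfl⟩
    exact hN.mul_left _ _ (ih (by omega) ha)

theorem pow_le_fil (hN : IsParIdeal N) (l : List (Koszul D)) (hl : ∀ v ∈ l, HasParity v)
    (hsq : ∀ v ∈ l, v * v ∈ N) {p : Submodule ℚ (Koszul D)} (hp : p ≤ fil N l 1) (m : ℕ) :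
    p ^ m ≤ fil N l m := by
  induction m with
  | zero => rw [fil_zero]; exact le_top
  | succ m ih =>
    rw [pow_succ]
    exact Submodule.mul_le.2 fun a ha b hb => fil_mul hN l hl hsq _ _ (ih ha) (hp hb)

theorem mem_fil_one (l : List (Koszul D)) {v : Koszul D} (hv : v ∈ l) : v ∈ fil N l 1 := by
  induction l with
  | nil => simp at hv
  | cons w l ih =>
    rw [fil_cons]
    rcases List.mem_cons.1 hv with rfl | hv
    · exact Submodule.mem_sup_right ⟨1, by rw [fil_zero]; trivial, by simp⟩
    · exact Submodule.mem_sup_left (ih hv)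

end Koszul

end Filtration

section UpperBound

open MvPolynomial

namespace Koszul

variable {I J : Type} {D : KoszulData I J} [Fintype J] [DecidableEq J]

theorem hasParity_xg (i : I) : HasParity (xg D i) := Or.inl (par_poly _)

theorem hasParity_ev (v : J → ℚ) : HasParity (ev D v) := Or.inr (par_ev v)

theorem isParIdeal_sqIdeal {s : I → J} {hs : ∀ i, D.q (s i) = X i ^ 2} :
    IsParIdeal (sqIdeal D s hs).carrier where
  mul_left := (sqIdeal D s hs).mul_left
  mul_right := (sqIdeal D s hs).mul_right
  par_mem a ha := by
    refine sqIdeal_induction (P := fun a => par D a ∈ _) ha (fun i b => ?_) (fun i b => ?_) ?_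
      fun a b ha hb => ?_
    · rw [map_mul, par_poly]
      exact sq_mul_mem _ _
    · rw [map_mul, par_wg, neg_mul]
      exact neg_mem (wg_mul_mem _ _)
    · rw [map_zero]
      exact zero_mem _
    · rw [map_add]
      exact add_mem ha hb

theorem xg_mul_self_mem {s : I → J} {hs : ∀ i, D.q (s i) = X i ^ 2} (i : I) :
    xg D i * xg D i ∈ (sqIdeal D s hs).carrier := by
  have h := sq_mul_mem (hs := hs) i 1
  rwa [mul_one, pow_two, map_mul] at h

theorem sub_apply_mem {p : Submodule ℚ (Koszul D)} (hp : IsParIdeal p)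
    {φ : Koszul D →ₐ[ℚ] Koszul D} (hx : ∀ i, xg D i - φ (xg D i) ∈ p)
    (hw : ∀ j, wg D j - φ (wg D j) ∈ p) (a : Koszul D) : a - φ a ∈ p := by
  have hmul : ∀ g a, g - φ g ∈ p → a - φ a ∈ p → g * a - φ (g * a) ∈ p := by
    intro g a hg ha
    have : g * a - φ (g * a) = g * (a - φ a) + (g - φ g) * φ a := by
      rw [map_mul]; noncomm_ring
    rw [this]
    exact add_mem (hp.mul_left _ _ ha) (hp.mul_right _ _ hg)
  induction a using induction_gen with
  | h1 => rw [map_one, sub_self]; exact zero_mem _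
  | hadd a b ha hb => rw [map_add, add_sub_add_comm]; exact add_mem ha hb
  | hsmul c a ha => rw [map_smul, ← smul_sub]; exact Submodule.smul_mem _ _ ha
  | hx i a ha => exact hmul _ _ (hx i) ha
  | hw j a ha => exact hmul _ _ (hw j) ha

end Koszul

namespace SpecialData

open Koszul

variable {n : ℕ} (S : SpecialData n) (r : ℕ)

theorem copies_q_some (p : Fin n × Fin r) : (S.K.copies r).q (some p.1, p.2) = X p ^ 2 := by
  change rename _ (S.K.q (some p.1)) = _
  rw [S.K_q_some, map_pow, rename_X]

variable {A : Type} [GCDGA A]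

theorem nonempty_tcWitness (Θ : Koszul S.K ≃ₐ[ℚ] A) (hΘ : IsDGAHom (Θ : Koszul S.K →ₐ[ℚ] A))
    (hΘ' : IsDGAHom (Θ.symm : A →ₐ[ℚ] Koszul S.K)) (hr : 0 < r) :
    Nonempty (TCWitness A r (r * (n + 1) - 1)) := by
  set D := S.K.copies r with hD
  let s : Fin n × Fin r → Option (Fin n) × Fin r := fun p => (some p.1, p.2)
  have hs : ∀ p, D.q (s p) = X p ^ 2 := S.copies_q_some r
  have hinj : Function.Injective s := fun p q h => by
    simpa [s, Prod.ext_iff] using h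
  let J := sqIdeal D s hs
  let TP := tensorPower Θ hΘ hΘ' r
  let k₀ : Fin r := ⟨0, hr⟩
  let v : Fin r → Option (Fin n) × Fin r → ℚ := fun k =>
    Pi.single (none, k) 1 - Pi.single (none, k₀) 1
  let l : List (Koszul D) := (Finset.univ : Finset (Fin n × Fin r)).toList.map (xg D) ++
    (Finset.univ.erase k₀).toList.map fun k => ev D (v k)
  have hlen : l.length = n * r + (r - 1) := by
    simp [l, Finset.card_erase_of_mem]
  have hl : ∀ v ∈ l, HasParity v ∧ v * v ∈ J.carrier := by
    intro w hw
    rcases List.mem_append.1 hw with hw | hw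
    · obtain ⟨i, -, rfl⟩ := List.mem_map.1 hw
      exact ⟨hasParity_xg i, xg_mul_self_mem i⟩
    · obtain ⟨i, -, rfl⟩ := List.mem_map.1 hw
      refine ⟨hasParity_ev _, ?_⟩
      rw [ev_sq]
      exact zero_mem _
  have hN : IsParIdeal J.carrier := isParIdeal_sqIdeal
  have hp := isParIdeal_fil hN l (fun v hv => (hl v hv).1) 1
  have hxm : ∀ i, xg D i ∈ fil J.carrier l 1 := fun i =>
    mem_fil_one l (List.mem_append.2 (Or.inl (List.mem_map.2 ⟨i, by simp, rfl⟩)))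
  have hwm : ∀ i k, wg D (some i, k) ∈ fil J.carrier l 1 := fun i k => by
    have h := wg_mul_mem (hs := hs) (i, k) 1
    rw [mul_one] at h
    exact le_fil l 1 h
  have hym : ∀ k, wg D (none, k) - wg D (none, k₀) ∈ fil J.carrier l 1 := fun k => by
    by_cases hk : k = k₀
    · rw [hk, sub_self]
      exact zero_mem _
    · have : wg D (none, k) - wg D (none, k₀) = ev D (v k) := by rw [map_sub]; rfl
      rw [this]
      exact mem_fil_one l (List.mem_append.2 (Or.inr (List.mem_map.2 ⟨k, by simp [hk], rfl⟩)))
  have hmu : ∀ k a, TP.mu (copy S.K r k a) = Θ a := fun k a => by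
    have := TP.mu_spec.2 k (Θ a)
    simpa [TP, tensorPower] using this
  let φ : Koszul D →ₐ[ℚ] Koszul D :=
    (copy S.K r k₀).comp ((Θ.symm : A →ₐ[ℚ] Koszul S.K).comp TP.mu)
  have hφ : ∀ k a, φ (copy S.K r k a) = copy S.K r k₀ a := fun k a => by
    simp [φ, hmu]
  have hker : TP.kerMu ≤ fil J.carrier l 1 := by
    intro a ha
    have ha' : φ a = 0 := by
      have : TP.mu a = 0 := ha
      simp [φ, this]
    have h := sub_apply_mem hp (φ := φ) (fun i => ?_) (fun j => ?_) a
    · rwa [ha', sub_zero] at h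
    · have h := hφ i.2 (xg S.K i.1)
      rw [copy_xg, copy_xg] at h
      rw [h]
      exact sub_mem (hxm _) (hxm _)
    · have h := hφ j.2 (wg S.K j.1)
      rw [copy_wg, copy_wg] at h
      rw [h]
      obtain ⟨_ | i, k⟩ := j
      · exact hym k
      · exact sub_mem (hwm _ _) (hwm _ _)
  refine ⟨TCWitness.ofAcyclic TP J ?_ (sqIdeal_acyclic hinj)⟩
  refine (pow_le_fil hN l (fun v hv => (hl v hv).1) (fun v hv => (hl v hv).2) hker _).trans
    (fil_le_of_length_lt hN l ?_)
  rw [hlen, Nat.mul_add, mul_one, mul_comm r n]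
  omega

end SpecialData

end UpperBound

section WordLength

open MvPolynomial

variable {A : Type} [GCDGA A]

namespace MinimalSullivan

variable (S : MinimalSullivan A)

/-- The elements of word length greater than `m`. -/
def lamGt (m : ℕ) : Submodule ℚ A := ⨆ k, ⨆ (_ : m < k), S.lam k

theorem lam_le_lamGt {m k : ℕ} (h : m < k) : S.lam k ≤ S.lamGt m :=
  le_iSup₂_of_le k h le_rfl

theorem lam_mul_lamGt (p m : ℕ) : S.lam p * S.lamGt m ≤ S.lamGt (p + m) := by
  simp only [lamGt, Submodule.mul_iSup]
  exact iSup₂_le fun k hk => (S.lam_mul p k).trans (S.lam_le_lamGt (by omega))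

theorem lamGt_mul_lam (p m : ℕ) : S.lamGt m * S.lam p ≤ S.lamGt (m + p) := by
  simp only [lamGt, Submodule.iSup_mul]
  exact iSup₂_le fun k hk => (S.lam_mul k p).trans (S.lam_le_lamGt (by omega))

theorem lamGt_anti {m m' : ℕ} (h : m ≤ m') : S.lamGt m' ≤ S.lamGt m :=
  iSup₂_le fun k hk => S.lam_le_lamGt (by omega)

theorem iSup_lam : ⨆ k, S.lam k = ⊤ := S.lam_internal.submodule_iSup_eq_top

theorem lamGt_mul_left (m : ℕ) (t a : A) (ha : a ∈ S.lamGt m) : t * a ∈ S.lamGt m := by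
  have h : (⨆ k, S.lam k) * S.lamGt m ≤ S.lamGt m := by
    rw [Submodule.iSup_mul]
    exact iSup_le fun k => (S.lam_mul_lamGt k m).trans (S.lamGt_anti (by omega))
  exact h (Submodule.mul_mem_mul (by rw [iSup_lam]; trivial) ha)

theorem lamGt_mul_right (m : ℕ) (t a : A) (ha : a ∈ S.lamGt m) : a * t ∈ S.lamGt m := by
  have h : S.lamGt m * (⨆ k, S.lam k) ≤ S.lamGt m := by
    rw [Submodule.mul_iSup]
    exact iSup_le fun k => (S.lamGt_mul_lam k m).trans (S.lamGt_anti (by omega))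
  exact h (Submodule.mul_mem_mul ha (by rw [iSup_lam]; trivial))

theorem lam_one_pow_le (k : ℕ) : S.lam 1 ^ k ≤ S.lam k := by
  induction k with
  | zero => rw [pow_zero, S.lam_zero]
  | succ k ih =>
    rw [pow_succ]
    exact (mul_le_mul' ih le_rfl).trans (S.lam_mul k 1)

theorem isHom_lam_one : IsHom (S.lam 1) := by
  rw [lam_one]
  refine isHom_iSup fun k a ha => ?_
  exact Submodule.mem_iSup_of_mem k ⟨ha, S.V_le k ha⟩

theorem Dd_mem_of_mem_lam_one {a : A} (ha : a ∈ S.lam 1) : Dd A a ∈ S.lamGt 1 := by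
  have : S.lam 1 ≤ (S.lamGt 1).comap (Dd A) := by
    rw [lam_one]
    exact iSup_le fun k v hv => S.minimal k v hv
  exact this ha

theorem Dd_mem_of_mem_lam_one_pow (k : ℕ) {a : A} (ha : a ∈ S.lam 1 ^ k) :
    Dd A a ∈ S.lamGt k := by
  induction k generalizing a with
  | zero =>
    rw [pow_zero] at ha
    obtain ⟨c, rfl⟩ := Submodule.mem_one.1 ha
    rw [Algebra.algebraMap_eq_smul_one, map_smul, Dd_one, smul_zero]
    exact zero_mem _
  | succ k ih =>
    rw [pow_succ'] at ha
    have : S.lam 1 * S.lam 1 ^ k ≤ (S.lamGt (k + 1)).comap (Dd A) := by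
      refine Submodule.mul_le.2 fun a ha b hb => ?_
      rw [Submodule.mem_comap]
      induction ha using S.isHom_lam_one.induction with
      | hmem i a ha hai =>
        rw [Dd_mul hai]
        refine add_mem ?_ (Submodule.smul_mem _ _ ?_)
        · rw [add_comm k]
          exact S.lamGt_mul_lam _ _ (Submodule.mul_mem_mul (S.Dd_mem_of_mem_lam_one ha)
            (S.lam_one_pow_le k hb))
        · rw [add_comm k]
          exact S.lam_mul_lamGt _ _ (Submodule.mul_mem_mul ha (ih hb))
      | hadd a b _ _ ha hb => rw [add_mul, map_add]; exact add_mem ha hb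
    exact this ha

theorem lam_one_pow (htop : ⨆ k, S.lam 1 ^ k = ⊤) (k : ℕ) : S.lam 1 ^ k = S.lam k :=
  iSupIndep.eq_of_le S.lam_internal.submodule_iSupIndep S.lam_one_pow_le htop k

/-- The ideal of elements of word length greater than `m`. -/
def lamIdeal (htop : ⨆ k, S.lam 1 ^ k = ⊤) (m : ℕ) : DGIdeal A where
  carrier := S.lamGt m
  mul_left := S.lamGt_mul_left m
  mul_right := S.lamGt_mul_right m
  isHom := by
    refine isHom_iSup fun k => isHom_iSup fun hk => ?_
    rw [← S.lam_one_pow htop, ← Nat.succ_pred_eq_of_pos (Nat.zero_lt_of_lt hk)]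
    exact S.isHom_lam_one.pow_succ _
  isDStable := iSup₂_le fun k hk a ha => by
    rw [← S.lam_one_pow htop] at ha
    exact S.lamGt_anti hk.le (S.Dd_mem_of_mem_lam_one_pow k ha)

/-- A bound for the category coming from an acyclic ideal. -/
theorem nonempty_catWitness (htop : ⨆ k, S.lam 1 ^ k = ⊤) {m : ℕ} (J : DGIdeal A)
    (hle : S.lamGt m ≤ J.carrier)
    (hJ : ∀ a ∈ J.carrier, Dd A a = 0 → ∃ b ∈ J.carrier, a = Dd A b) :
    Nonempty (CatWitness A S m) :=
  let I := S.lamIdeal htop m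
  ⟨{ Q := I.Quot
     π := I.proj
     π_dga := I.proj_dga
     π_surj := I.proj_surjective
     π_ker := I.ker_proj
     retr := ⟨DGIdeal.htpyRetraction I J hle hJ⟩ }⟩

end MinimalSullivan

namespace Koszul

variable {I J : Type} (D : KoszulData I J) [Fintype J] [DecidableEq J]

/-- The span of the generators. -/
def genSpan : Submodule ℚ (Koszul D) :=
  Submodule.span ℚ (Set.range (xg D) ∪ Set.range (wg D))

variable {D}

theorem xg_mem_genSpan (i : I) : xg D i ∈ genSpan D :=
  Submodule.subset_span (Or.inl ⟨i, rfl⟩)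

theorem wg_mem_genSpan (j : J) : wg D j ∈ genSpan D :=
  Submodule.subset_span (Or.inr ⟨j, rfl⟩)

theorem iSup_genSpan_pow : ⨆ k, genSpan D ^ k = ⊤ := by
  rw [eq_top_iff]
  rintro a -
  have hmul : ∀ g ∈ genSpan D, ∀ a ∈ ⨆ k, genSpan D ^ k, g * a ∈ ⨆ k, genSpan D ^ k := by
    intro g hg a ha
    have h : genSpan D * ⨆ k, genSpan D ^ k ≤ ⨆ k, genSpan D ^ k := by
      rw [Submodule.mul_iSup]
      refine iSup_le fun k => ?_
      rw [← pow_succ']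
      exact le_iSup (fun k => genSpan D ^ k) (k + 1)
    exact h (Submodule.mul_mem_mul hg ha)
  induction a using induction_gen with
  | h1 =>
    refine Submodule.mem_iSup_of_mem 0 ?_
    rw [pow_zero]
    exact Submodule.one_le.1 le_rfl
  | hadd a b ha hb => exact add_mem ha hb
  | hsmul c a ha => exact Submodule.smul_mem _ _ ha
  | hx i a ha => exact hmul _ (xg_mem_genSpan i) _ ha
  | hw j a ha => exact hmul _ (wg_mem_genSpan j) _ ha

end Koszul

namespace SpecialData

open Koszul

variable {n : ℕ} (Sd : SpecialData n) (S : MinimalSullivan A) {Θ : Koszul Sd.K ≃ₐ[ℚ] A}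

theorem iSup_lam_one_pow
    (hgen : (genSpan Sd.K).map (Θ : Koszul Sd.K →ₐ[ℚ] A).toLinearMap = S.lam 1) :
    ⨆ k, S.lam 1 ^ k = ⊤ := by
  rw [← hgen]
  simp_rw [← Submodule.map_pow]
  rw [← Submodule.map_iSup, iSup_genSpan_pow, Submodule.map_top, LinearMap.range_eq_top]
  exact Θ.surjective

theorem nonempty_catWitness (hΘ : IsDGAHom (Θ : Koszul Sd.K →ₐ[ℚ] A))
    (hΘ' : IsDGAHom (Θ.symm : A →ₐ[ℚ] Koszul Sd.K))
    (hgen : (genSpan Sd.K).map (Θ : Koszul Sd.K →ₐ[ℚ] A).toLinearMap = S.lam 1) :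
    Nonempty (CatWitness A S (n + 1)) := by
  have htop := Sd.iSup_lam_one_pow S hgen
  have hs : ∀ p, Sd.K.q (some p) = X p ^ 2 := Sd.K_q_some
  let J := sqIdeal Sd.K some hs
  let l : List (Koszul Sd.K) := wg Sd.K none :: (Finset.univ : Finset (Fin n)).toList.map (xg Sd.K)
  have hlen : l.length = n + 1 := by simp [l]
  have hl : ∀ v ∈ l, HasParity v ∧ v * v ∈ J.carrier := by
    intro w hw
    rcases List.mem_cons.1 hw with rfl | hw
    · refine ⟨hasParity_ev _, ?_⟩
      rw [wg, ev_sq]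
      exact zero_mem _
    · obtain ⟨i, -, rfl⟩ := List.mem_map.1 hw
      exact ⟨hasParity_xg i, xg_mul_self_mem i⟩
  have hN : IsParIdeal J.carrier := isParIdeal_sqIdeal
  have hfil : genSpan Sd.K ≤ fil J.carrier l 1 := by
    refine Submodule.span_le.2 ?_
    rintro _ (⟨i, rfl⟩ | ⟨_ | i, rfl⟩)
    · exact mem_fil_one l (List.mem_cons_of_mem _ (List.mem_map.2 ⟨i, by simp, rfl⟩))
    · exact mem_fil_one l List.mem_cons_self
    · have h := wg_mul_mem (hs := hs) i 1
      rw [mul_one] at h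
      exact le_fil l 1 h
  refine S.nonempty_catWitness htop (J.comap Θ.symm hΘ' hΘ)
    (iSup₂_le fun k hk => ?_) (DGIdeal.comap_acyclic (sqIdeal_acyclic (Option.some_injective _)))
  rw [← S.lam_one_pow htop, ← hgen, ← Submodule.map_pow]
  rintro _ ⟨a, ha, rfl⟩
  have h := (pow_le_fil hN l (fun v hv => (hl v hv).1) (fun v hv => (hl v hv).2) hfil _).trans
    (fil_le_of_length_lt hN l (hlen.trans_lt hk)) ha
  change Θ.symm (Θ a) ∈ J.carrier
  rwa [Θ.symm_apply_apply]

end SpecialData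

end WordLength

section Contractions

open MvPolynomial

namespace Koszul

variable {I J : Type} {D : KoszulData I J} [Fintype J]

/-- Successive contractions, the head of the list being applied first. -/
def contrs (D : KoszulData I J) : List (J → MvPolynomial I ℚ) → Koszul D →ₗ[ℚ] Koszul D
  | [] => LinearMap.id
  | f :: L => contrs D L ∘ₗ contr D f

theorem contrs_nil (a : Koszul D) : contrs D [] a = a := rfl

theorem contrs_cons (f : J → MvPolynomial I ℚ) (L : List (J → MvPolynomial I ℚ)) (a : Koszul D) :
    contrs D (f :: L) a = contrs D L (contr D f a) := rfl

theorem contrs_append (L L' : List (J → MvPolynomial I ℚ)) (a : Koszul D) :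
    contrs D (L ++ L') a = contrs D L' (contrs D L a) := by
  induction L generalizing a with
  | nil => rfl
  | cons f L ih => exact ih _

theorem contrs_poly_mul (L : List (J → MvPolynomial I ℚ)) (p : MvPolynomial I ℚ) (a : Koszul D) :
    contrs D L (poly D p * a) = poly D p * contrs D L a := by
  induction L generalizing a with
  | nil => rfl
  | cons f L ih => rw [contrs_cons, contr_poly_mul, ih, contrs_cons]

theorem contr_contrs (f : J → MvPolynomial I ℚ) (L : List (J → MvPolynomial I ℚ)) (a : Koszul D) :
    contr D f (contrs D L a) = (-1 : ℚ) ^ L.length • contrs D L (contr D f a) := by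
  induction L generalizing a with
  | nil => simp [contrs_nil]
  | cons g L ih =>
    rw [contrs_cons, ih, contr_anticomm, contrs_cons, map_neg, List.length_cons, pow_succ]
    simp

theorem contr_contrs_eq_zero {f : J → MvPolynomial I ℚ} {L : List (J → MvPolynomial I ℚ)}
    (hf : f ∈ L) (a : Koszul D) : contr D f (contrs D L a) = 0 := by
  induction L generalizing a with
  | nil => simp at hf
  | cons g L ih =>
    rw [contrs_cons]
    rcases List.mem_cons.1 hf with rfl | hf
    · rw [contr_contrs, contr_contr_self, map_zero, smul_zero]
    · exact ih hf _

theorem contrs_contrs (L L' : List (J → MvPolynomial I ℚ)) :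
    ∃ ε : ℚ, ε ≠ 0 ∧ ∀ a : Koszul D, contrs D L (contrs D L' a) = ε • contrs D L' (contrs D L a) := by
  induction L with
  | nil => exact ⟨1, one_ne_zero, fun a => by simp [contrs_nil]⟩
  | cons f L ih =>
    obtain ⟨ε, hε, h⟩ := ih
    refine ⟨(-1) ^ L'.length * ε, mul_ne_zero (pow_ne_zero _ (by norm_num)) hε, fun a => ?_⟩
    rw [contrs_cons, contr_contrs, map_smul, h, contrs_cons, mul_smul]

theorem contrs_Dd (L : List (J → MvPolynomial I ℚ)) : ∃ ε : ℚ, ∀ a : Koszul D,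
    contrs D L (contr D D.q a) = ε • contr D D.q (contrs D L a) := by
  obtain ⟨ε, -, h⟩ := contrs_contrs (D := D) L [D.q]
  exact ⟨ε, h⟩

theorem contr_eq_zero_of_mem_span {f : J → MvPolynomial I ℚ} {s : Set (J → MvPolynomial I ℚ)}
    {a : Koszul D} (hs : ∀ f ∈ s, contr D f a = 0)
    (hf : f ∈ Submodule.span (MvPolynomial I ℚ) s) : contr D f a = 0 := by
  induction hf using Submodule.span_induction with
  | mem f hf => exact hs f hf
  | zero => exact contr_zero a
  | add f g _ _ hf hg => rw [contr_add, hf, hg, add_zero]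
  | smul p f _ hf =>
    have : p • f = fun j => p * f j := rfl
    rw [this, contr_mul, hf, mul_zero]

theorem contr_prod_ev_eq_zero {f : J → MvPolynomial I ℚ} {l : List (J → ℚ)}
    (h : ∀ v ∈ l, pair f v = 0) : contr D f (l.map (ev D)).prod = 0 := by
  induction l with
  | nil => exact contr_one f
  | cons v l ih =>
    rw [List.map_cons, List.prod_cons, contr_ev_mul, h v (by simp),
      ih fun w hw => h w (List.mem_cons_of_mem _ hw)]
    simp

/-- The evaluation of a triangular system of contractions. -/
theorem contrs_prod_ev {P : List ((J → MvPolynomial I ℚ) × (J → ℚ))}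
    (hP : P.Pairwise fun p p' => pair p.1 p'.2 = 0) :
    contrs D (P.map Prod.fst) ((P.map Prod.snd).map (ev D)).prod =
      poly D (P.map fun p => pair p.1 p.2).prod := by
  induction P with
  | nil => simp [contrs_nil]
  | cons p P ih =>
    rw [List.pairwise_cons] at hP
    have h : contr D p.1 ((P.map Prod.snd).map (ev D)).prod = 0 := by
      refine contr_prod_ev_eq_zero fun v hv => ?_
      obtain ⟨p', hp', rfl⟩ := List.mem_map.1 hv
      exact hP.1 p' hp'
    simp only [List.map_cons, List.prod_cons, contrs_cons]
    rw [contr_ev_mul, h, mul_zero, sub_zero, contrs_poly_mul, ih hP.2, map_mul]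

variable [DecidableEq J]

theorem contrs_prod_ev_ne_Dd [Fintype I] {s : I → J} (hs : ∀ i, D.q (s i) = X i ^ 2)
    (hinj : Function.Injective s) {Y L : List ((J → MvPolynomial I ℚ) × (J → ℚ))}
    (hP : (Y ++ L).Pairwise fun p p' => pair p.1 p'.2 = 0)
    (hY : ∀ j ∉ Set.range s, dual j ∈ Y.map Prod.fst) {m : I →₀ ℕ} (hm : ∀ i, m i < 2)
    (hcoeff : coeff m ((Y ++ L).map fun p => pair p.1 p.2).prod ≠ 0) (c : Koszul D) :
    contrs D (L.map Prod.fst) (((Y ++ L).map Prod.snd).map (ev D)).prod ≠ Dd (Koszul D) c := by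
  intro hc
  obtain ⟨ε, hε, h⟩ := contrs_contrs (D := D) (L.map Prod.fst) (Y.map Prod.fst)
  obtain ⟨ε', h'⟩ := contrs_Dd (D := D) (Y.map Prod.fst)
  have h1 := contrs_prod_ev (D := D) hP
  rw [List.map_append (f := Prod.fst), contrs_append, h, hc, Dd_eq, h'] at h1
  set c' := contrs D (Y.map Prod.fst) c with hc'
  have h2 : Dd (Koszul D) c' ∈ (sqIdeal D s hs).carrier := by
    rw [Dd_eq_sum hs hinj fun j hj => contr_contrs_eq_zero (hY j hj) c]
    exact sum_mem fun i _ => sq_mul_mem i _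
  have h3 := coeff_aug_eq_zero (Submodule.smul_mem _ ε (Submodule.smul_mem _ ε' h2)) hm
  rw [Dd_eq, h1, aug_poly] at h3
  exact hcoeff h3

end Koszul

end Contractions

section Lengths

open MvPolynomial

namespace Koszul

variable {I J : Type} {D : KoszulData I J}

/-- The span of some polynomials and some odd vectors. -/
def gens (D : KoszulData I J) (P : Set (MvPolynomial I ℚ)) (V : Set (J → ℚ)) :
    Submodule ℚ (Koszul D) :=
  Submodule.span ℚ (poly D '' P ∪ ev D '' V)

/-- The elements of length at least `m` in some generators. -/
def len (D : KoszulData I J) (P : Set (MvPolynomial I ℚ)) (V : Set (J → ℚ)) (m : ℕ) :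
    Submodule ℚ (Koszul D) :=
  gens D P V ^ m * ⊤

variable {P : Set (MvPolynomial I ℚ)} {V : Set (J → ℚ)}

theorem len_zero : len D P V 0 = ⊤ := by
  rw [len, pow_zero, one_mul]

theorem len_succ (m : ℕ) : len D P V (m + 1) = gens D P V * len D P V m := by
  rw [len, pow_succ', mul_assoc, len]

theorem len_succ_induction {m : ℕ} {p : Submodule ℚ (Koszul D)} {φ : Koszul D →ₗ[ℚ] Koszul D}
    (hpoly : ∀ q ∈ P, ∀ a ∈ len D P V m, φ (poly D q * a) ∈ p)
    (hev : ∀ v ∈ V, ∀ a ∈ len D P V m, φ (ev D v * a) ∈ p) {a : Koszul D}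
    (ha : a ∈ len D P V (m + 1)) : φ a ∈ p := by
  rw [len_succ] at ha
  refine (Submodule.mul_le (P := p.comap φ)).2 (fun g hg a ha => ?_) ha
  refine Submodule.span_le (p := p.comap (φ ∘ₗ LinearMap.mulRight ℚ a)).2 ?_ hg
  rintro _ (⟨q, hq, rfl⟩ | ⟨v, hv, rfl⟩)
  · exact hpoly q hq a ha
  · exact hev v hv a ha

theorem mul_mem_len {m : ℕ} {g a : Koszul D} (hg : g ∈ gens D P V) (ha : a ∈ len D P V m) :
    g * a ∈ len D P V (m + 1) := by
  rw [len_succ]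
  exact Submodule.mul_mem_mul hg ha

theorem poly_mem_gens {q : MvPolynomial I ℚ} (hq : q ∈ P) : poly D q ∈ gens D P V :=
  Submodule.subset_span (Or.inl ⟨q, hq, rfl⟩)

theorem ev_mem_gens {v : J → ℚ} (hv : v ∈ V) : ev D v ∈ gens D P V :=
  Submodule.subset_span (Or.inr ⟨v, hv, rfl⟩)

theorem ev_mul_mem_len {m : ℕ} (w : J → ℚ) {a : Koszul D} (ha : a ∈ len D P V m) :
    ev D w * a ∈ len D P V m := by
  induction m generalizing a with
  | zero => rw [len_zero]; trivial
  | succ m ih =>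
    refine len_succ_induction (φ := LinearMap.mulLeft ℚ (ev D w)) (fun q hq a ha => ?_)
      (fun v hv a ha => ?_) ha
    · rw [LinearMap.mulLeft_apply, ← mul_assoc, ← poly_comm, mul_assoc]
      exact mul_mem_len (poly_mem_gens hq) (ih ha)
    · rw [LinearMap.mulLeft_apply, ← mul_assoc, ev_anticomm, neg_mul, mul_assoc]
      exact neg_mem (mul_mem_len (ev_mem_gens hv) (ih ha))

theorem prod_ev_mul_mem_len {m : ℕ} (l : List (J → ℚ)) {a : Koszul D} (ha : a ∈ len D P V m) :
    (l.map (ev D)).prod * a ∈ len D P V m := by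
  induction l with
  | nil => simpa using ha
  | cons w l ih =>
    rw [List.map_cons, List.prod_cons, mul_assoc]
    exact ev_mul_mem_len w ih

theorem prod_ev_mul_mem_len_add {m : ℕ} {l : List (J → ℚ)} (hl : ∀ v ∈ l, v ∈ V) {a : Koszul D}
    (ha : a ∈ len D P V m) : (l.map (ev D)).prod * a ∈ len D P V (m + l.length) := by
  induction l with
  | nil => simpa using ha
  | cons w l ih =>
    rw [List.map_cons, List.prod_cons, mul_assoc]
    exact mul_mem_len (ev_mem_gens (hl w (by simp))) (ih fun v hv => hl v (by simp [hv]))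

variable [Fintype J]

theorem contr_mem_len {f : J → MvPolynomial I ℚ} (hf : ∀ v ∈ V, poly D (pair f v) ∈ gens D P V)
    {m : ℕ} {a : Koszul D} (ha : a ∈ len D P V m) : contr D f a ∈ len D P V m := by
  induction m generalizing a with
  | zero => rw [len_zero]; trivial
  | succ m ih =>
    refine len_succ_induction (fun q hq a ha => ?_) (fun v hv a ha => ?_) ha
    · rw [contr_poly_mul]
      exact mul_mem_len (poly_mem_gens hq) (ih ha)
    · rw [contr_ev_mul]
      exact sub_mem (mul_mem_len (hf v hv) ha) (mul_mem_len (ev_mem_gens hv) (ih ha))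

theorem contrs_mem_len {L : List (J → MvPolynomial I ℚ)}
    (hL : ∀ f ∈ L, ∀ v ∈ V, poly D (pair f v) ∈ gens D P V)
    {m : ℕ} {a : Koszul D} (ha : a ∈ len D P V m) : contrs D L a ∈ len D P V m := by
  induction L generalizing a with
  | nil => exact ha
  | cons f L ih =>
    exact ih (fun g hg => hL g (by simp [hg])) (contr_mem_len (hL f (by simp)) ha)

variable [DecidableEq J]

theorem contr_mem_len_succ {f : J → MvPolynomial I ℚ} (hf : ∀ v ∈ V, pair f v = 0)
    (hf' : ∀ j, poly D (f j) ∈ gens D P V) {m : ℕ} {a : Koszul D} (ha : a ∈ len D P V m) :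
    contr D f a ∈ len D P V (m + 1) := by
  induction m generalizing a with
  | zero =>
    rw [contr_eq_sum]
    exact sum_mem fun j _ => mul_mem_len (hf' j) (by rw [len_zero]; trivial)
  | succ m ih =>
    refine len_succ_induction (fun q hq a ha => ?_) (fun v hv a ha => ?_) ha
    · rw [contr_poly_mul]
      exact mul_mem_len (poly_mem_gens hq) (ih ha)
    · rw [contr_ev_mul, hf v hv, map_zero, zero_mul, zero_sub]
      exact neg_mem (mul_mem_len (ev_mem_gens hv) (ih ha))

theorem contrs_mem_len_add {L : List (J → MvPolynomial I ℚ)}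
    (hL : ∀ f ∈ L, ∀ v ∈ V, pair f v = 0) (hL' : ∀ f ∈ L, ∀ j, poly D (f j) ∈ gens D P V)
    {m : ℕ} {a : Koszul D} (ha : a ∈ len D P V m) : contrs D L a ∈ len D P V (m + L.length) := by
  induction L generalizing a m with
  | nil => exact ha
  | cons f L ih =>
    have := ih (fun g hg => hL g (by simp [hg])) (fun g hg => hL' g (by simp [hg]))
      (contr_mem_len_succ (hL f (by simp)) (hL' f (by simp)) ha)
    rwa [List.length_cons, Nat.add_comm L.length, ← Nat.add_assoc]

end Koszul

end Lengths

section Obstruction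

variable {A T Q : Type} [GCDGA A] [GCDGA T] [GCDGA Q]

theorem ModHtpyRetraction.exact_of_apply_eq_zero {ρ : T →ₐ[ℚ] Q} (R : ModHtpyRetraction ρ) {a : T}
    (ha : ρ a = 0) (hda : Dd T a = 0) : ∃ c, a = Dd T c := by
  have h1 : R.q (R.j a) = 0 := by
    have := DFunLike.congr_fun R.hqj a
    rw [AlgHom.comp_apply] at this
    rw [this, ha]
  obtain ⟨e, he⟩ := R.q_quasi.2 (R.j a) (by rw [← R.j_dga.1, hda, map_zero])
    ⟨0, by rw [h1, map_zero]⟩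
  refine ⟨R.τ e, ?_⟩
  rw [← R.τ_chain, ← he, R.hτj]

theorem TensorPower.exists_comparison {r : ℕ} {T T' : Type} [GCDGA T] [GCDGA T']
    (TP : TensorPower A r T) (TP' : TensorPower A r T') :
    ∃ (g : T →ₐ[ℚ] T') (g' : T' →ₐ[ℚ] T), IsDGAHom g ∧ IsDGAHom g' ∧ (∀ a, g' (g a) = a) ∧
      ∀ a, TP'.mu (g a) = TP.mu a := by
  obtain ⟨g, ⟨hg, hg1⟩, -⟩ := TP.coprod T' TP'.ι TP'.ι_dga
  obtain ⟨g', ⟨hg', hg1'⟩, -⟩ := TP'.coprod T TP.ι TP.ι_dga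
  refine ⟨g, g', hg, hg', fun a => ?_, fun a => ?_⟩
  · have := (TP.coprod T TP.ι TP.ι_dga).unique (y₁ := g'.comp g) (y₂ := AlgHom.id ℚ T)
      ⟨hg'.comp hg, fun j => by rw [AlgHom.comp_assoc, hg1, hg1']⟩
      ⟨isDGAHom_id T, fun j => AlgHom.id_comp _⟩
    exact DFunLike.congr_fun this a
  · have := (TP.coprod A (fun _ => AlgHom.id ℚ A) fun _ => isDGAHom_id A).unique
      (y₁ := TP'.mu.comp g) (y₂ := TP.mu)
      ⟨TP'.mu_spec.1.comp hg, fun j => by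
        rw [AlgHom.comp_assoc, hg1]
        ext a
        exact TP'.mu_spec.2 j a⟩
      ⟨TP.mu_spec.1, fun j => by
        ext a
        exact TP.mu_spec.2 j a⟩
    exact DFunLike.congr_fun this a

/-- A non-exact cocycle in a power of the kernel of the multiplication bounds `MTC` below. -/
theorem MTCWitness.le_of_cocycle {r m N : ℕ} (W : MTCWitness A r m) (TP : TensorPower A r T)
    {a : T} (ha : ∀ k, k + 1 ≤ N → a ∈ TP.kerMu ^ (k + 1)) (hda : Dd T a = 0)
    (hne : ∀ c, a ≠ Dd T c) : N ≤ m := by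
  by_contra hm
  let _ := W.instT
  let _ := W.instQ
  obtain ⟨g, g', hg, hg', hgg, hmu⟩ := TP.exists_comparison W.TP
  have hle : TP.kerMu.map g.toLinearMap ≤ W.TP.kerMu := by
    rintro _ ⟨b, hb, rfl⟩
    change W.TP.mu (g b) = 0
    rw [hmu]
    exact hb
  have h1 : g a ∈ W.TP.kerMu ^ (m + 1) := by
    refine pow_le_pow_left' hle _ ?_
    rw [← Submodule.map_pow]
    exact ⟨a, ha m (by omega), rfl⟩
  rw [← W.ρ_ker] at h1
  obtain ⟨R⟩ := W.retr
  obtain ⟨c, hc⟩ := R.exact_of_apply_eq_zero h1 (by rw [← hg.1, hda, map_zero])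
  refine hne (g' c) ?_
  rw [← hg'.1, ← hc, hgg]

end Obstruction

section Cocycle

open MvPolynomial

theorem prod_X_eq_monomial (I : Type) [Fintype I] :
    (∏ i, X i : MvPolynomial I ℚ) = monomial (Finsupp.equivFunOnFinite.symm fun _ => 1) 1 := by
  rw [monomial_eq, map_one, one_mul, Finsupp.prod_fintype _ _ fun _ => pow_zero _]
  simp

namespace SpecialData

open Koszul

variable {n : ℕ} (S : SpecialData n)

/-- The linear forms polarizing the quadratic differentials. -/
def form {I : Type} (φ : Fin n → I) (q : Fin n) (a : Option (Fin n)) : MvPolynomial I ℚ :=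
  ∑ p, MvPolynomial.C (S.B a q p) * X (φ p)

theorem form_some {I : Type} (φ : Fin n → I) (q i : Fin n) :
    S.form φ q (some i) = if q = i then X (φ i) else 0 := by
  by_cases h : q = i <;> simp [form, B, h, apply_ite MvPolynomial.C, ite_mul]

theorem sum_X_mul_form_comm {I : Type} (φ ψ : Fin n → I) (a : Option (Fin n)) :
    ∑ q, X (φ q) * S.form ψ q a = ∑ q, X (ψ q) * S.form φ q a := by
  simp only [form, Finset.mul_sum]
  rw [Finset.sum_comm]
  refine Finset.sum_congr rfl fun p _ => Finset.sum_congr rfl fun q _ => ?_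
  rw [S.B_symm]
  ring

theorem q_eq_form (a : Option (Fin n)) : S.K.q a = ∑ q, X q * S.form id q a := by
  rw [K_q]
  refine Finset.sum_congr rfl fun p _ => ?_
  rw [form, Finset.mul_sum]
  refine Finset.sum_congr rfl fun q _ => ?_
  rw [smul_eq_C_mul, id]
  ring

theorem copies_q_eq_form (r : ℕ) (a : Option (Fin n)) (k : Fin r) :
    (S.K.copies r).q (a, k) = ∑ q, X (q, k) * S.form (fun i => (i, k)) q a := by
  change rename _ (S.K.q a) = _
  rw [q_eq_form]
  simp [form]

theorem exists_cocycle : ∃ a : Koszul S.K,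
    a ∈ len S.K (Set.range X) (Set.range fun j => Pi.single j 1) (n + 1) ∧
      Dd (Koszul S.K) a = 0 ∧ ∀ c, a ≠ Dd (Koszul S.K) c := by
  let Y : List ((Option (Fin n) → MvPolynomial (Fin n) ℚ) × (Option (Fin n) → ℚ)) :=
    [(dual none, Pi.single none 1)]
  let L : List ((Option (Fin n) → MvPolynomial (Fin n) ℚ) × (Option (Fin n) → ℚ)) :=
    (Finset.univ : Finset (Fin n)).toList.map fun q => (S.form id q, Pi.single (some q) 1)
  refine ⟨contrs S.K (L.map Prod.fst) (((Y ++ L).map Prod.snd).map (ev S.K)).prod, ?_, ?_, ?_⟩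
  · refine contrs_mem_len ?_ ?_
    · rintro f hf _ ⟨j, rfl⟩
      obtain ⟨p, hp, rfl⟩ := List.mem_map.1 hf
      obtain ⟨q, -, rfl⟩ := List.mem_map.1 hp
      rw [pair_single]
      simp only [form, map_sum, ← smul_eq_C_mul, map_smul]
      exact sum_mem fun i _ => Submodule.smul_mem _ _ (poly_mem_gens ⟨i, rfl⟩)
    · have h := prod_ev_mul_mem_len_add (D := S.K) (P := Set.range X)
        (V := Set.range fun j => Pi.single j (1 : ℚ)) (m := 0) (l := (Y ++ L).map Prod.snd)
        (fun v hv => ?_) (a := 1) (by rw [len_zero]; trivial)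
      · rw [mul_one] at h
        have hl : 0 + ((Y ++ L).map Prod.snd).length = n + 1 := by simp [Y, L]
        rwa [hl] at h
      · obtain ⟨p, hp, rfl⟩ := List.mem_map.1 hv
        rcases List.mem_append.1 hp with hp | hp
        · rw [List.mem_singleton.1 hp]
          exact ⟨none, rfl⟩
        · obtain ⟨q, -, rfl⟩ := List.mem_map.1 hp
          exact ⟨some q, rfl⟩
  · refine contr_eq_zero_of_mem_span (s := {f | f ∈ L.map Prod.fst})
      (fun f hf => contr_contrs_eq_zero hf _) ?_
    have : S.K.q = ∑ q, (X q : MvPolynomial (Fin n) ℚ) • S.form id q := by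
      ext1 a
      rw [q_eq_form, Finset.sum_apply]
      rfl
    rw [this]
    refine Submodule.sum_mem _ fun q _ => Submodule.smul_mem _ _ (Submodule.subset_span ?_)
    exact List.mem_map.2 ⟨_, List.mem_map.2 ⟨q, by simp, rfl⟩, rfl⟩
  · refine contrs_prod_ev_ne_Dd S.K_q_some (Option.some_injective _) ?_ ?_
      (m := Finsupp.equivFunOnFinite.symm fun _ => 1) ?_ ?_
    · rw [List.pairwise_append]
      refine ⟨List.pairwise_singleton _ _, ?_, ?_⟩
      · refine List.pairwise_map.2 ((Finset.nodup_toList _).imp ?_)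
        intro p q h
        rw [pair_single]
        exact (S.form_some id p q).trans (if_neg h)
      · intro p hp p' hp'
        rw [List.mem_singleton.1 hp]
        obtain ⟨q, -, rfl⟩ := List.mem_map.1 hp'
        rw [pair_single]
        simp [dual]
    · rintro (_ | i) hj
      · simp [Y]
      · exact absurd ⟨i, rfl⟩ hj
    · simp
    · have : ((Y ++ L).map fun p => pair p.1 p.2).prod = ∏ i, X i := by
        rw [List.map_append, List.prod_append, List.map_map, Finset.prod_map_toList]
        simp [Y, pair_single, dual, form_some]
      rw [this, prod_X_eq_monomial, coeff_monomial, if_pos rfl]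
      exact one_ne_zero

end SpecialData

end Cocycle

section SquareFree

open MvPolynomial

theorem mul_prod_sub_of_sq_eq_zero {R κ : Type} [CommRing R] {x : κ → R} {a : R} (ha : a * a = 0)
    (s : Finset κ) : a * ∏ k ∈ s, (x k - a) = a * ∏ k ∈ s, x k := by
  classical
  induction s using Finset.induction_on with
  | empty => rfl
  | insert k s hk ih =>
    rw [Finset.prod_insert hk, Finset.prod_insert hk]
    linear_combination (x k - a) * ih - (∏ k ∈ s, x k) * ha

theorem sub_mul_prod_sub_of_sq_eq_zero {R κ : Type} [CommRing R] [Fintype κ] [DecidableEq κ]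
    {x : κ → R} (hx : ∀ k, x k * x k = 0) {k₀ k₁ : κ} (hk : k₁ ≠ k₀) :
    (x k₁ - x k₀) * ∏ k ∈ Finset.univ.erase k₀, (x k - x k₀) = -2 * ∏ k, x k := by
  have hk' : k₁ ∈ Finset.univ.erase k₀ := by simp [hk]
  rw [← Finset.mul_prod_erase Finset.univ x (Finset.mem_univ k₀),
    ← Finset.mul_prod_erase _ x hk', ← Finset.mul_prod_erase _ (fun k => x k - x k₀) hk']
  have h := mul_prod_sub_of_sq_eq_zero (x := x) (hx k₀) ((Finset.univ.erase k₀).erase k₁)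
  linear_combination (-2 * x k₁) * h +
    (∏ k ∈ (Finset.univ.erase k₀).erase k₁, (x k - x k₀)) * (hx k₁ + hx k₀)

theorem coeff_eq_zero_of_mem_span_sq {I : Type} {p : MvPolynomial I ℚ}
    (hp : p ∈ Ideal.span (Set.range fun i => (X i ^ 2 : MvPolynomial I ℚ))) {m : I →₀ ℕ}
    (hm : ∀ i, m i < 2) : coeff m p = 0 := by
  have h : (Set.range fun i => (X i ^ 2 : MvPolynomial I ℚ)) =
      (fun s => monomial s (1 : ℚ)) '' Set.range fun i => Finsupp.single i 2 := by
    rw [← Set.range_comp]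
    exact congrArg _ (funext fun i => X_pow_eq_monomial)
  rw [h, mem_ideal_span_monomial_image] at hp
  by_contra hc
  obtain ⟨_, ⟨i, rfl⟩, hi⟩ := hp m (mem_support_iff.2 hc)
  have := hi i
  rw [Finsupp.single_eq_same] at this
  exact absurd (hm i) (by omega)

theorem coeff_prod_sub_ne_zero {ι κ : Type} [Fintype ι] [Fintype κ] [DecidableEq κ] {k₀ k₁ : κ}
    (hk : k₁ ≠ k₀) {c : ℚ} (hc : c ≠ 0) :
    coeff (Finsupp.equivFunOnFinite.symm fun _ => 1)
      (∏ i, (C c * (X (i, k₁) - X (i, k₀)) *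
        ∏ k ∈ Finset.univ.erase k₀, (X (i, k) - X (i, k₀))) : MvPolynomial (ι × κ) ℚ) ≠ 0 := by
  classical
  let I := Ideal.span (Set.range fun i => (X i ^ 2 : MvPolynomial (ι × κ) ℚ))
  have hX : ∀ i, Ideal.Quotient.mk I (X i) * Ideal.Quotient.mk I (X i) = 0 := fun i => by
    rw [← map_mul, ← pow_two]
    exact Ideal.Quotient.eq_zero_iff_mem.2 (Ideal.subset_span ⟨i, rfl⟩)
  have h : (∏ i, (C c * (X (i, k₁) - X (i, k₀)) *
      ∏ k ∈ Finset.univ.erase k₀, (X (i, k) - X (i, k₀))) : MvPolynomial (ι × κ) ℚ) -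
      C ((-2 * c) ^ Fintype.card ι) * ∏ p, X p ∈ I := by
    rw [← Ideal.Quotient.eq, Fintype.prod_prod_type, map_pow, Fintype.card, ← Finset.prod_const,
      ← Finset.prod_mul_distrib, map_prod, map_prod]
    refine Finset.prod_congr rfl fun i _ => ?_
    have := sub_mul_prod_sub_of_sq_eq_zero (x := fun k => Ideal.Quotient.mk I (X (i, k)))
      (fun k => hX (i, k)) hk
    rw [mul_assoc, map_mul, map_mul, map_mul, map_mul C, map_mul, map_sub, map_prod, map_prod]
    simp only [map_sub]
    rw [this]
    simp only [map_neg, map_ofNat]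
    ring
  have h2 := coeff_eq_zero_of_mem_span_sq h
    (m := Finsupp.equivFunOnFinite.symm fun _ => 1) fun i => by simp
  rw [coeff_sub, sub_eq_zero, coeff_C_mul, prod_X_eq_monomial, coeff_monomial, if_pos rfl,
    mul_one] at h2
  rw [h2]
  exact pow_ne_zero _ (by simpa using hc)

end SquareFree

section CopiesCocycle

open MvPolynomial

namespace SpecialData

open Koszul

variable {n : ℕ} (S : SpecialData n) {r : ℕ} (k₀ k₁ : Fin r)

/-- The linear forms of the `k`-th copy. -/
def copyForm (k : Fin r) (q : Fin n) (a : Option (Fin n)) : MvPolynomial (Fin n × Fin r) ℚ :=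
  S.form (fun i => (i, k)) q a

/-- The contracting forms which do not depend on the copy. -/
def chi (q : Fin n) (p : Option (Fin n) × Fin r) : MvPolynomial (Fin n × Fin r) ℚ :=
  MvPolynomial.C (1 / 4) * (S.copyForm k₁ q p.1 - S.copyForm k₀ q p.1)

/-- The contracting forms which single out a copy. -/
def psi (t : Fin r × Fin n) (p : Option (Fin n) × Fin r) : MvPolynomial (Fin n × Fin r) ℚ :=
  (if p.2 = t.1 then S.copyForm t.1 t.2 p.1 - S.copyForm k₀ t.2 p.1 else 0) +
    if t.1 = k₁ then MvPolynomial.C (3 / 4) * S.copyForm k₀ t.2 p.1 -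
      MvPolynomial.C (1 / 4) * S.copyForm k₁ t.2 p.1 else 0

/-- The difference of the copies of an odd generator. -/
def oddDiff (a : Option (Fin n)) (k : Fin r) : Option (Fin n) × Fin r → ℚ :=
  Pi.single (a, k) 1 - Pi.single (a, k₀) 1

/-- The polynomial generators of the kernel of the multiplication. -/
def evenDiffs : Set (MvPolynomial (Fin n × Fin r) ℚ) :=
  Set.range fun p : Fin n × Fin r => X p - X (p.1, k₀)

/-- The odd generators of the kernel of the multiplication. -/
def oddDiffs : Set (Option (Fin n) × Fin r → ℚ) :=
  Set.range fun p : Option (Fin n) × Fin r => oddDiff k₀ p.1 p.2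

theorem copyForm_some (k : Fin r) (q i : Fin n) :
    S.copyForm k q (some i) = if q = i then X (i, k) else 0 :=
  S.form_some _ q i

theorem pair_oddDiff (f : Option (Fin n) × Fin r → MvPolynomial (Fin n × Fin r) ℚ)
    (a : Option (Fin n)) (k : Fin r) : pair f (oddDiff k₀ a k) = f (a, k) - f (a, k₀) := by
  rw [oddDiff, map_sub, pair_single, pair_single]

theorem pair_chi_oddDiff (q : Fin n) (a : Option (Fin n)) (k : Fin r) :
    pair (S.chi k₀ k₁ q) (oddDiff k₀ a k) = 0 := by
  rw [pair_oddDiff]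
  exact sub_self _

theorem pair_psi_oddDiff {t : Fin r × Fin n} (ht : t.1 ≠ k₀) (a : Option (Fin n)) (k : Fin r) :
    pair (S.psi k₀ k₁ t) (oddDiff k₀ a k) =
      if k = t.1 then S.copyForm t.1 t.2 a - S.copyForm k₀ t.2 a else 0 := by
  rw [pair_oddDiff]
  simp [psi, ht.symm]

theorem poly_copyForm_sub_mem (k : Fin r) (q : Fin n) (a : Option (Fin n)) :
    poly (S.K.copies r) (S.copyForm k q a - S.copyForm k₀ q a) ∈
      gens (S.K.copies r) (evenDiffs k₀) (oddDiffs k₀) := by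
  simp only [copyForm, form, ← Finset.sum_sub_distrib, ← mul_sub, map_sum]
  simp only [← smul_eq_C_mul, map_smul]
  exact sum_mem fun i _ => Submodule.smul_mem _ _ (poly_mem_gens ⟨(i, k), rfl⟩)

theorem copies_q_mem_span (h₁ : k₁ ≠ k₀) : (S.K.copies r).q ∈
    Submodule.span (MvPolynomial (Fin n × Fin r) ℚ)
      (Set.range (S.chi k₀ k₁) ∪ S.psi k₀ k₁ '' {t | t.1 ≠ k₀}) := by
  have : (S.K.copies r).q = ∑ q, (X (q, k₁) - X (q, k₀) : MvPolynomial (Fin n × Fin r) ℚ) •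
      S.chi k₀ k₁ q + ∑ k ∈ Finset.univ.erase k₀, ∑ q,
        (X (q, k) + X (q, k₀) : MvPolynomial (Fin n × Fin r) ℚ) • S.psi k₀ k₁ (k, q) := by
    funext ⟨a, j⟩
    have hcomm : ∀ k k', ∑ q, (X (q, k) : MvPolynomial (Fin n × Fin r) ℚ) * S.copyForm k' q a =
        ∑ q, X (q, k') * S.copyForm k q a := fun k k' =>
      S.sum_X_mul_form_comm (fun i => (i, k)) (fun i => (i, k')) a
    have h1 : ∑ k ∈ Finset.univ.erase k₀, ∑ q,
        (X (q, k) + X (q, k₀) : MvPolynomial (Fin n × Fin r) ℚ) * S.psi k₀ k₁ (k, q) (a, j) =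
        ∑ q, (X (q, j) + X (q, k₀)) * (S.copyForm j q a - S.copyForm k₀ q a) +
        ∑ q, (X (q, k₁) + X (q, k₀)) * (MvPolynomial.C (3 / 4) * S.copyForm k₀ q a -
          MvPolynomial.C (1 / 4) * S.copyForm k₁ q a) := by
      simp only [psi, mul_add, Finset.sum_add_distrib, mul_ite, mul_zero]
      have hs : ∀ F : Fin r → MvPolynomial (Fin n × Fin r) ℚ, F k₀ = 0 →
          ∑ k ∈ Finset.univ.erase k₀, (if j = k then F k else 0) = F j := fun F hF => by
        rw [Finset.sum_ite_eq]
        by_cases hj : j = k₀ <;> simp [hj, hF]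
      have hs' : ∀ F : Fin r → MvPolynomial (Fin n × Fin r) ℚ,
          ∑ k ∈ Finset.univ.erase k₀, (if k = k₁ then F k else 0) = F k₁ := fun F => by
        rw [Finset.sum_ite_eq']
        simp [h₁]
      have hite : ∀ (p : Prop) [Decidable p] (F : Fin n → MvPolynomial (Fin n × Fin r) ℚ),
          ∑ q, (if p then F q else 0) = if p then ∑ q, F q else 0 := fun p _ F => by
        split_ifs <;> simp
      simp only [hite]
      rw [hs (fun k => ∑ q, (X (q, k) + X (q, k₀)) * (S.copyForm k q a - S.copyForm k₀ q a))
        (by simp)]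
      rw [hs' (fun k => ∑ q, (X (q, k) + X (q, k₀)) * (MvPolynomial.C (3 / 4) *
        S.copyForm k₀ q a - MvPolynomial.C (1 / 4) * S.copyForm k₁ q a))]
    simp only [Pi.add_apply, Finset.sum_apply, Pi.smul_apply, smul_eq_mul]
    rw [h1, copies_q_eq_form]
    change ∑ q, X (q, j) * S.copyForm j q a = _
    have h3 : (MvPolynomial.C (3 / 4) : MvPolynomial (Fin n × Fin r) ℚ) =
        3 * MvPolynomial.C (1 / 4) := by
      rw [← map_ofNat (MvPolynomial.C : ℚ →+* _), ← map_mul]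
      norm_num
    have h4 : 4 * (MvPolynomial.C (1 / 4) : MvPolynomial (Fin n × Fin r) ℚ) = 1 := by
      rw [← map_ofNat (MvPolynomial.C : ℚ →+* _), ← map_mul]
      norm_num
    rw [h3, ← Finset.sum_add_distrib, ← Finset.sum_add_distrib]
    have h5 : ∀ q, (X (q, k₁) - X (q, k₀)) * S.chi k₀ k₁ q (a, j) +
        ((X (q, j) + X (q, k₀)) * (S.copyForm j q a - S.copyForm k₀ q a) +
          (X (q, k₁) + X (q, k₀)) * (3 * MvPolynomial.C (1 / 4) * S.copyForm k₀ q a -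
            MvPolynomial.C (1 / 4) * S.copyForm k₁ q a)) =
        X (q, j) * S.copyForm j q a +
          (X (q, k₀) * S.copyForm j q a - X (q, j) * S.copyForm k₀ q a) +
          2 * MvPolynomial.C (1 / 4) *
            (X (q, k₁) * S.copyForm k₀ q a - X (q, k₀) * S.copyForm k₁ q a) := fun q => by
      rw [chi]
      linear_combination (X (q, k₀) * S.copyForm k₀ q a) * h4
    simp only [h5, Finset.sum_add_distrib, ← Finset.mul_sum, Finset.sum_sub_distrib]
    rw [hcomm k₀ j, hcomm k₁ k₀]
    ring
  rw [this]
  refine add_mem (sum_mem fun q _ => Submodule.smul_mem _ _ (Submodule.subset_span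
    (Or.inl ⟨q, rfl⟩))) (sum_mem fun k hk => sum_mem fun q _ => Submodule.smul_mem _ _
      (Submodule.subset_span (Or.inr ⟨(k, q), (Finset.mem_erase.1 hk).1, rfl⟩)))

end SpecialData

end CopiesCocycle

section CopiesCocycle

open MvPolynomial

namespace SpecialData

open Koszul

variable {n : ℕ} (S : SpecialData n) {r : ℕ} (k₀ k₁ : Fin r)

theorem exists_copies_cocycle (h₁ : k₁ ≠ k₀) : ∃ a : Koszul (S.K.copies r),
    a ∈ len (S.K.copies r) (evenDiffs k₀) (oddDiffs k₀) (r * (n + 1) - 1) ∧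
      Dd (Koszul (S.K.copies r)) a = 0 ∧ ∀ c, a ≠ Dd (Koszul (S.K.copies r)) c := by
  let Y₁ : List ((Option (Fin n) × Fin r → MvPolynomial (Fin n × Fin r) ℚ) ×
      (Option (Fin n) × Fin r → ℚ)) :=
    (Finset.univ.erase k₀).toList.map fun k => (dual (none, k), oddDiff k₀ none k)
  let Y₂ : List ((Option (Fin n) × Fin r → MvPolynomial (Fin n × Fin r) ℚ) ×
      (Option (Fin n) × Fin r → ℚ)) := [(dual (none, k₀), Pi.single (none, k₀) 1)]
  let L₁ : List ((Option (Fin n) × Fin r → MvPolynomial (Fin n × Fin r) ℚ) ×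
      (Option (Fin n) × Fin r → ℚ)) :=
    (Finset.univ : Finset (Fin n)).toList.map fun q =>
      (S.chi k₀ k₁ q, Pi.single (some q, k₀) 1)
  let s : Finset (Fin r × Fin n) := (Finset.univ.erase k₀) ×ˢ Finset.univ
  have hs : ∀ t ∈ s, t.1 ≠ k₀ := fun t ht => by simpa [s] using ht
  let L₂ : List ((Option (Fin n) × Fin r → MvPolynomial (Fin n × Fin r) ℚ) ×
      (Option (Fin n) × Fin r → ℚ)) :=
    s.toList.map fun t => (S.psi k₀ k₁ t, oddDiff k₀ (some t.2) t.1)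
  have hr : 0 < r := k₀.pos
  refine ⟨contrs (S.K.copies r) ((L₁ ++ L₂).map Prod.fst)
    ((((Y₁ ++ Y₂) ++ (L₁ ++ L₂)).map Prod.snd).map (ev (S.K.copies r))).prod, ?_, ?_, ?_⟩
  · rw [List.map_append, contrs_append]
    refine contrs_mem_len ?_ ?_
    · rintro f hf _ ⟨⟨a, k⟩, rfl⟩
      obtain ⟨p, hp, rfl⟩ := List.mem_map.1 hf
      obtain ⟨t, ht, rfl⟩ := List.mem_map.1 hp
      rw [S.pair_psi_oddDiff k₀ k₁ (hs t (Finset.mem_toList.1 ht))]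
      split_ifs
      · exact S.poly_copyForm_sub_mem k₀ _ _ _
      · rw [map_zero]
        exact zero_mem _
    · have hN : r * (n + 1) - 1 = s.card + (r - 1) + (L₁.map Prod.fst).length := by
        have hlen : (L₁.map Prod.fst).length = n := by simp [L₁]
        have : s.card = (r - 1) * n := by simp [s, Finset.card_erase_of_mem]
        obtain ⟨r, rfl⟩ : ∃ r', r = r' + 1 := ⟨r - 1, by omega⟩
        rw [this, hlen]
        simp only [Nat.add_sub_cancel]
        rw [Nat.add_mul]
        have : r * (n + 1) = r * n + r := by ring
        omega
      rw [hN]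
      refine contrs_mem_len_add ?_ ?_ ?_
      · rintro f hf _ ⟨⟨a, k⟩, rfl⟩
        obtain ⟨p, hp, rfl⟩ := List.mem_map.1 hf
        obtain ⟨q, -, rfl⟩ := List.mem_map.1 hp
        exact S.pair_chi_oddDiff k₀ k₁ _ _ _
      · rintro f hf ⟨a, k⟩
        obtain ⟨p, hp, rfl⟩ := List.mem_map.1 hf
        obtain ⟨q, -, rfl⟩ := List.mem_map.1 hp
        simp only [chi, ← smul_eq_C_mul, map_smul]
        exact Submodule.smul_mem _ _ (S.poly_copyForm_sub_mem k₀ _ _ _)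
      · have h2 : (((Y₁ ++ Y₂) ++ (L₁ ++ L₂)).map Prod.snd) =
          Y₁.map Prod.snd ++ ((Y₂ ++ L₁).map Prod.snd ++ L₂.map Prod.snd) := by simp
        have h3 : s.card + (r - 1) = 0 + (L₂.map Prod.snd).length + (Y₁.map Prod.snd).length := by
          simp [Y₁, L₂, Finset.card_erase_of_mem]
        rw [h2, h3, List.map_append, List.prod_append, List.map_append, List.prod_append]
        refine prod_ev_mul_mem_len_add (fun v hv => ?_) (prod_ev_mul_mem_len _ ?_)
        · obtain ⟨p, hp, rfl⟩ := List.mem_map.1 hv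
          obtain ⟨k, -, rfl⟩ := List.mem_map.1 hp
          exact ⟨(none, k), rfl⟩
        · rw [← mul_one (List.prod _)]
          refine prod_ev_mul_mem_len_add (fun v hv => ?_) (by rw [len_zero]; trivial)
          obtain ⟨p, hp, rfl⟩ := List.mem_map.1 hv
          obtain ⟨t, -, rfl⟩ := List.mem_map.1 hp
          exact ⟨(some t.2, t.1), rfl⟩
  · refine contr_eq_zero_of_mem_span (s := {f | f ∈ (L₁ ++ L₂).map Prod.fst})
      (fun f hf => contr_contrs_eq_zero hf _)
      (Submodule.span_mono ?_ (S.copies_q_mem_span k₀ k₁ h₁))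
    rintro f (⟨q, rfl⟩ | ⟨t, ht, rfl⟩)
    · exact List.mem_map.2 ⟨_, List.mem_append_left _ (List.mem_map.2 ⟨q, by simp, rfl⟩), rfl⟩
    · exact List.mem_map.2 ⟨_, List.mem_append_right _ (List.mem_map.2
        ⟨t, by simpa [s] using ht, rfl⟩), rfl⟩
  · refine contrs_prod_ev_ne_Dd (S.copies_q_some r)
      (fun p q h => by simpa [Prod.ext_iff] using h) ?_ ?_
      (m := Finsupp.equivFunOnFinite.symm fun _ => 1) ?_ ?_
    · have hnone : ∀ k, ∀ p' ∈ L₁ ++ L₂,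
          pair (dual (none, k) : _ → MvPolynomial (Fin n × Fin r) ℚ) p'.2 = 0 := by
        intro k p' hp'
        rcases List.mem_append.1 hp' with hp' | hp'
        · obtain ⟨q, -, rfl⟩ := List.mem_map.1 hp'
          rw [pair_single]
          simp [dual]
        · obtain ⟨q, -, rfl⟩ := List.mem_map.1 hp'
          rw [pair_oddDiff]
          simp [dual]
      rw [List.pairwise_append, List.pairwise_append, List.pairwise_append]
      refine ⟨⟨?_, List.pairwise_singleton _ _, ?_⟩, ⟨?_, ?_, ?_⟩, ?_⟩
      · refine List.pairwise_map.2 ((Finset.nodup_toList _).pairwise_of_forall_ne ?_)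
        intro k hk k' hk' h
        have hk0 : k ≠ k₀ := by simpa using hk
        rw [pair_oddDiff]
        simp [dual, h.symm, hk0.symm]
      · intro p hp p' hp'
        rw [List.mem_singleton.1 hp']
        obtain ⟨k, hk, rfl⟩ := List.mem_map.1 hp
        have hk0 : k ≠ k₀ := by simpa using hk
        rw [pair_single]
        simp [dual, hk0.symm]
      · refine List.pairwise_map.2 ((Finset.nodup_toList _).imp ?_)
        intro p q h
        rw [pair_single]
        simp [chi, copyForm_some, h]
      · refine List.pairwise_map.2 ((Finset.nodup_toList _).pairwise_of_forall_ne ?_)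
        intro t ht t' ht' h
        rw [S.pair_psi_oddDiff k₀ k₁ (hs t (Finset.mem_toList.1 ht))]
        split_ifs with hk
        · have : t.2 ≠ t'.2 := fun h' => h (Prod.ext hk.symm h')
          rw [copyForm_some, copyForm_some, if_neg this, if_neg this, sub_self]
        · rfl
      · intro p hp p' hp'
        obtain ⟨q, -, rfl⟩ := List.mem_map.1 hp
        obtain ⟨t, -, rfl⟩ := List.mem_map.1 hp'
        exact S.pair_chi_oddDiff k₀ k₁ _ _ _
      · intro p hp p' hp'
        rcases List.mem_append.1 hp with hp | hp
        · obtain ⟨k, -, rfl⟩ := List.mem_map.1 hp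
          exact hnone k p' hp'
        · rw [List.mem_singleton.1 hp]
          exact hnone k₀ p' hp'
    · rintro ⟨_ | i, k⟩ hj
      · by_cases hk : k = k₀
        · simp [Y₁, Y₂, hk]
        · rw [List.map_append]
          exact List.mem_append_left _ (List.mem_map.2
            ⟨_, List.mem_map.2 ⟨k, by simp [hk], rfl⟩, rfl⟩)
      · exact absurd ⟨(i, k), rfl⟩ hj
    · simp
    · have hY : ((Y₁ ++ Y₂).map fun p => pair p.1 p.2).prod = 1 := by
        refine List.prod_eq_one fun z hz => ?_
        obtain ⟨p, hp, rfl⟩ := List.mem_map.1 hz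
        rcases List.mem_append.1 hp with hp | hp
        · obtain ⟨k, hk, rfl⟩ := List.mem_map.1 hp
          have hk0 : k ≠ k₀ := by simpa using hk
          rw [pair_oddDiff]
          simp [dual, hk0.symm]
        · rw [List.mem_singleton.1 hp, pair_single]
          simp [dual]
      have hL₁ : (L₁.map fun p => pair p.1 p.2).prod =
          ∏ q, MvPolynomial.C (1 / 4) * (X (q, k₁) - X (q, k₀)) := by
        rw [List.map_map, Finset.prod_map_toList]
        refine Finset.prod_congr rfl fun q _ => ?_
        change pair _ _ = _
        rw [pair_single]
        simp [chi, copyForm_some]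
      have hL₂ : (L₂.map fun p => pair p.1 p.2).prod =
          ∏ q, ∏ k ∈ Finset.univ.erase k₀, (X (q, k) - X (q, k₀)) := by
        rw [List.map_map, Finset.prod_map_toList, Finset.prod_comm, ← Finset.prod_product']
        refine Finset.prod_congr rfl fun t ht => ?_
        change pair _ _ = _
        rw [S.pair_psi_oddDiff k₀ k₁ (hs t ht)]
        simp [copyForm_some]
      rw [List.map_append, List.prod_append, hY, one_mul, List.map_append, List.prod_append,
        hL₁, hL₂, ← Finset.prod_mul_distrib]
      exact coeff_prod_sub_ne_zero h₁ (by norm_num)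

end SpecialData

end CopiesCocycle

section LowerBounds

open MvPolynomial

namespace Koszul

variable {I J : Type} {D : KoszulData I J} {P : Set (MvPolynomial I ℚ)} {V : Set (J → ℚ)}

theorem len_le_pow {p : Submodule ℚ (Koszul D)} (hp : gens D P V ≤ p)
    {N m : ℕ} (hmul : ∀ t, ∀ a ∈ p ^ (m + 1), a * t ∈ p ^ (m + 1)) (hm : m + 1 ≤ N) :
    len D P V N ≤ p ^ (m + 1) := by
  obtain ⟨t, rfl⟩ := Nat.exists_eq_add_of_le hm
  rw [len, pow_add, mul_assoc]
  exact Submodule.mul_le.2 fun a ha b _ => hmul b a (pow_le_pow_left' hp _ ha)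

end Koszul

namespace SpecialData

open Koszul

variable {n : ℕ} (Sd : SpecialData n) {A : Type} [GCDGA A] {Θ : Koszul Sd.K ≃ₐ[ℚ] A}

theorem gens_le_kerMu (hΘ : IsDGAHom (Θ : Koszul Sd.K →ₐ[ℚ] A))
    (hΘ' : IsDGAHom (Θ.symm : A →ₐ[ℚ] Koszul Sd.K)) {r : ℕ} (k₀ : Fin r) :
    gens (Sd.K.copies r) (evenDiffs k₀) (oddDiffs k₀) ≤ (tensorPower Θ hΘ hΘ' r).kerMu := by
  have hmu : ∀ k a, (tensorPower Θ hΘ hΘ' r).mu (copy Sd.K r k a) = Θ a := fun k a => by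
    have := (tensorPower Θ hΘ hΘ' r).mu_spec.2 k (Θ a)
    simpa [tensorPower] using this
  refine Submodule.span_le.2 ?_
  rintro _ (⟨_, ⟨⟨i, k⟩, rfl⟩, rfl⟩ | ⟨_, ⟨⟨a, k⟩, rfl⟩, rfl⟩)
  · change (tensorPower Θ hΘ hΘ' r).mu _ = 0
    rw [map_sub, map_sub]
    have h := hmu k (xg Sd.K i)
    rw [← hmu k₀ (xg Sd.K i), copy_xg, copy_xg] at h
    exact sub_eq_zero.2 h
  · change (tensorPower Θ hΘ hΘ' r).mu
      (ev _ (Pi.single (a, k) 1 - Pi.single (a, k₀) 1)) = 0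
    rw [map_sub, map_sub]
    have h := hmu k (wg Sd.K a)
    rw [← hmu k₀ (wg Sd.K a), copy_wg, copy_wg] at h
    exact sub_eq_zero.2 h

theorem le_of_mtcWitness (hΘ : IsDGAHom (Θ : Koszul Sd.K →ₐ[ℚ] A))
    (hΘ' : IsDGAHom (Θ.symm : A →ₐ[ℚ] Koszul Sd.K)) {r m : ℕ} (hr : 2 ≤ r)
    (W : MTCWitness A r m) : r * (n + 1) - 1 ≤ m := by
  obtain ⟨a, ha, hda, hne⟩ := Sd.exists_copies_cocycle (r := r) ⟨0, by omega⟩ ⟨1, by omega⟩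
    (by simp)
  refine W.le_of_cocycle (tensorPower Θ hΘ hΘ' r) (fun k hk => ?_) hda hne
  exact len_le_pow (Sd.gens_le_kerMu hΘ hΘ' _)
    ((DGIdeal.ker _ (tensorPower Θ hΘ hΘ' r).mu_spec.1).pow k).mul_right hk ha

theorem le_of_catWitness (S : MinimalSullivan A) (hΘ : IsDGAHom (Θ : Koszul Sd.K →ₐ[ℚ] A))
    (hΘ' : IsDGAHom (Θ.symm : A →ₐ[ℚ] Koszul Sd.K))
    (hgen : (genSpan Sd.K).map (Θ : Koszul Sd.K →ₐ[ℚ] A).toLinearMap = S.lam 1) {m : ℕ}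
    (W : CatWitness A S m) : n + 1 ≤ m := by
  by_contra hm
  let _ := W.instQ
  obtain ⟨a, ha, hda, hne⟩ := Sd.exists_cocycle
  have hle : gens Sd.K (Set.range X) (Set.range fun j => Pi.single j 1) ≤ genSpan Sd.K := by
    refine Submodule.span_le.2 ?_
    rintro _ (⟨_, ⟨i, rfl⟩, rfl⟩ | ⟨_, ⟨j, rfl⟩, rfl⟩)
    · exact xg_mem_genSpan i
    · exact wg_mem_genSpan j
  have hlen : len Sd.K (Set.range X) (Set.range fun j => Pi.single j 1) (n + 1) ≤
      (S.lamGt m).comap (Θ : Koszul Sd.K →ₐ[ℚ] A).toLinearMap := by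
    refine Submodule.mul_le.2 fun g hg b _ => ?_
    rw [Submodule.mem_comap, AlgHom.toLinearMap_apply, map_mul]
    refine S.lamGt_mul_right m _ _ (S.lam_le_lamGt (by omega : m < n + 1)
      (S.lam_one_pow_le _ ?_))
    rw [← hgen, ← Submodule.map_pow]
    exact ⟨g, pow_le_pow_left' hle _ hg, rfl⟩
  have h0 : W.π (Θ a) = 0 := by
    have : Θ a ∈ LinearMap.ker W.π.toLinearMap := W.π_ker ▸ hlen ha
    exact this
  obtain ⟨R⟩ := W.retr
  have hd : Dd A (Θ a) = 0 := by
    have := hΘ.1 a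
    rw [hda, map_zero] at this
    exact this.symm
  obtain ⟨c, hc⟩ := R.toMod.exact_of_apply_eq_zero h0 hd
  refine hne (Θ.symm c) ?_
  have := hΘ'.1 c
  rw [← hc] at this
  simpa using this

end SpecialData

end LowerBounds

section Generators

namespace MinimalSullivan

variable {A : Type} [GCDGA A] (S : MinimalSullivan A)

theorem lam_one_eq_sup : S.lam 1 = S.Veven ⊔ S.Vodd := by
  rw [S.lam_one]
  refine le_antisymm (iSup_le fun m => ?_) (sup_le (iSup_le fun m => le_iSup S.V _)
    (iSup_le fun m => le_iSup S.V _))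
  obtain ⟨m, rfl | rfl⟩ := m.even_or_odd'
  · exact le_sup_of_le_left (le_iSup (fun i => S.V (2 * i)) m)
  · exact le_sup_of_le_right (le_iSup (fun i => S.V (2 * i + 1)) m)

end MinimalSullivan

end Generators

/-- For the minimal Sullivan model
`(ΛW,d) = (Λ(x₁,…,x_n,u₁,…,u_n,y),d)` with `dx_i = 0`, `du_i = x_i²` and
`dy ∈ Λ²(x₁,…,x_n)` (the `x_i` of even degree, the `u_i` and `y` of odd
degree), one has, for every `r ≥ 2`,
`TC_r(ΛW) = r·cat(ΛW) + χ_π(ΛW) = r·(n+1) − 1`, and moreover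
`MTC_r(ΛW) = TC_r(ΛW)`. -/
theorem TC_special_family (A : Type) [GCDGA A] (S : MinimalSullivan A)
    (n : ℕ) (x u : Fin n → A) (y : A) (e : Fin n → ℕ) (k : ℕ)
    (he_even : ∀ i, Even (e i)) (he_pos : ∀ i, 0 < e i) (hk_odd : Odd k)
    (hx_mem : ∀ i, x i ∈ S.V (e i)) (hu_mem : ∀ i, u i ∈ S.V (2 * e i - 1))
    (hy_mem : y ∈ S.V k)
    (hx_li : LinearIndependent ℚ x)
    (hx_span : Submodule.span ℚ (Set.range x) = S.Veven)
    (huy_li : LinearIndependent ℚ (Sum.elim u (fun _ : Unit => y)))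
    (huy_span : Submodule.span ℚ (Set.range u ∪ {y}) = S.Vodd)
    (hdx : ∀ i, Dd A (x i) = 0) (hdu : ∀ i, Dd A (u i) = x i ^ 2)
    (hdy : Dd A y ∈ Submodule.span ℚ {w : A | ∃ p q, w = x p * x q})
    (r : ℕ) (hr : 2 ≤ r) :
    (TC A r : ℤ) = r * cat A S + S.chiPi ∧
      (TC A r : ℤ) = r * (n + 1) - 1 ∧
        MTC A r = TC A r := by
  obtain ⟨Sd, Θ, hΘ, hΘ', hx, hu, hy⟩ := exists_equiv S he_even he_pos hk_odd hx_mem hu_mem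
    hy_mem hx_li hx_span huy_li huy_span hdx hdu hdy
  have hgen : (Koszul.genSpan Sd.K).map (Θ : Koszul Sd.K →ₐ[ℚ] A).toLinearMap = S.lam 1 := by
    rw [S.lam_one_eq_sup, ← hx_span, ← huy_span, ← Submodule.span_union, Koszul.genSpan,
      Submodule.map_span]
    congr 1
    rw [Set.image_union, ← Set.range_comp, ← Set.range_comp]
    congr 1
    · exact congrArg Set.range (funext hx)
    · ext a
      constructor
      · rintro ⟨_ | i, rfl⟩
        · exact Or.inr hy
        · exact Or.inl ⟨i, (hu i).symm⟩
      · rintro (⟨i, rfl⟩ | rfl)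
        · exact ⟨some i, hu i⟩
        · exact ⟨none, hy⟩
  have hchi : S.chiPi = -1 := by
    have huy_range : Set.range (Sum.elim u fun _ : Unit => y) = Set.range u ∪ {y} := by
      rw [Set.Sum.elim_range, Set.range_const]
    rw [MinimalSullivan.chiPi, ← hx_span, ← huy_span, ← huy_range, finrank_span_eq_card hx_li,
      finrank_span_eq_card huy_li]
    simp
  have hcat : cat A S = n + 1 :=
    le_antisymm (Nat.sInf_le (Sd.nonempty_catWitness S hΘ hΘ' hgen))
      (le_csInf ⟨_, Sd.nonempty_catWitness S hΘ hΘ' hgen⟩ fun m hm =>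
        Sd.le_of_catWitness S hΘ hΘ' hgen hm.some)
  have hW := Sd.nonempty_tcWitness r Θ hΘ hΘ' (by omega)
  have hTC : TC A r = r * (n + 1) - 1 :=
    le_antisymm (Nat.sInf_le hW)
      (le_csInf ⟨_, hW⟩ fun m hm => Sd.le_of_mtcWitness hΘ hΘ' hr hm.some.toMTC)
  have hMTC : MTC A r = r * (n + 1) - 1 :=
    le_antisymm (Nat.sInf_le (hW.map TCWitness.toMTC))
      (le_csInf ⟨_, hW.map TCWitness.toMTC⟩ fun m hm => Sd.le_of_mtcWitness hΘ hΘ' hr hm.some)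
  have hpos : 1 ≤ r * (n + 1) := Nat.mul_pos (by omega) n.succ_pos
  have hTC' : (TC A r : ℤ) = r * (n + 1) - 1 := by
    rw [hTC, Nat.cast_sub hpos]
    push_cast
    rfl
  refine ⟨?_, hTC', hMTC.trans hTC.symm⟩
  rw [hTC', hcat, hchi]
  push_cast
  ring

end RHT
end
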